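/- Let E be a finite-dimensional simple normed real algebra. For every κ > 0 and every σ < dim_ℝ E there exist ε > 0 and δ₀ > 0 (depending on E, κ, σ) such that for all 0 < δ < δ₀ the following holds. Let A ⊆ E satisfy: (i) A ⊆ B(0, δ^{-ε}); (ii) for every ρ ≥ δ, N_ρ(A) ≥ δ^ε ρ^{-κ}; (iii) N_δ(A) ≤ δ^{-σ-ε}; (iv) A is δ^ε-away from subalgebras. Then N_δ(A + A) + N_δ(A + A·A) ≥ δ^{-ε} N_δ(A), where A + A·A = {a + bc : a, b, c ∈ A}. -/

import Mathlib

open Pointwise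

section SeminormDefs

variable {E : Type*} [AddCommGroup E] [Module ℝ E]

/-- Closed ball of radius `r` around `x`, with respect to the (semi)norm `nm`. -/
def SBall (nm : Seminorm ℝ E) (x : E) (r : ℝ) : Set E := {y | nm (y - x) ≤ r}

/-- Distance from the point `a` to the set `W`, with respect to the (semi)norm `nm`. -/
noncomputable def SDist (nm : Seminorm ℝ E) (a : E) (W : Set E) : ℝ :=
  sInf ((fun w => nm (a - w)) '' W)

/-- Covering number of `S` at scale `δ`: the least number of closed `δ`-balls
(for the norm `nm`) needed to cover `S`. -/
noncomputable def SCov (nm : Seminorm ℝ E) (δ : ℝ) (S : Set E) : ℕ :=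
  sInf {N : ℕ | ∃ F : Finset E, F.card ≤ N ∧ S ⊆ ⋃ x ∈ F, SBall nm x δ}

end SeminormDefs

section AlgDefs

variable {E : Type*} [Ring E] [Algebra ℝ E]

/-- `A` is `ρ`-away from subalgebras: every proper unital subalgebra of `E` has a point of `A`
at distance at least `ρ` from it. -/
def AwayFromSubalgebras (nm : Seminorm ℝ E) (ρ : ℝ) (A : Set E) : Prop :=
  ∀ W : Subalgebra ℝ E, W ≠ ⊤ → ∃ a ∈ A, ρ ≤ SDist nm a (W : Set E)

/-- `GenSet A s` is the set `⟨A⟩_{s+1}` of the paper: `GenSet A 0 = A ∪ (-A) = ⟨A⟩₁` and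
`⟨A⟩_{s+1} = ⟨A⟩_s ∪ (⟨A⟩_s + ⟨A⟩₁) ∪ (⟨A⟩_s ⬝ ⟨A⟩₁)`. -/
def GenSet (A : Set E) : ℕ → Set E
  | 0 => A ∪ (-A)
  | (s + 1) => GenSet A s ∪ (GenSet A s + (A ∪ (-A))) ∪ (GenSet A s * (A ∪ (-A)))

end AlgDefs

namespace SumProduct

open Filter Topology

/-- A fixed nonprincipal ultrafilter on `ℕ`. -/
noncomputable abbrev hyp : Filter ℕ := (hyperfilter ℕ : Filter ℕ)

/-- A sequence of scales in `(0, 1)` tending to `0`. -/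
class IsScale (δ : ℕ → ℝ) : Prop where
  pos : ∀ n, 0 < δ n
  lt_one : ∀ n, δ n < 1
  tendsto : Tendsto δ hyp (𝓝 0)

/-- `x` grows slower than every negative power of `δ`. -/
def Tame (δ : ℕ → ℝ) {X : Type*} [Norm X] (x : ℕ → X) : Prop :=
  ∀ η : ℝ, 0 < η → ∀ᶠ n in hyp, ‖x n‖ ≤ δ n ^ (-η)

/-- `x` is bounded by some positive power of `δ`. -/
def Small (δ : ℕ → ℝ) {X : Type*} [Norm X] (x : ℕ → X) : Prop :=
  ∃ c : ℝ, 0 < c ∧ ∀ᶠ n in hyp, ‖x n‖ ≤ δ n ^ c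

section Calculus

variable {δ : ℕ → ℝ} [hδ : IsScale δ]

lemma eventually_ge_nat (m : ℕ) : ∀ᶠ n in hyp, m ≤ n :=
  (Nat.hyperfilter_le_atTop) (eventually_ge_atTop m)

lemma eventually_const_le (C : ℝ) {η : ℝ} (hη : 0 < η) : ∀ᶠ n in hyp, C ≤ δ n ^ (-η) := by
  have h1 : Tendsto (fun n => δ n ^ η) hyp (𝓝[>] 0) := by
    refine tendsto_nhdsWithin_iff.2 ⟨?_, Eventually.of_forall fun n => ?_⟩
    · have := (Real.continuousAt_rpow_const 0 η (Or.inr hη.le)).tendsto.comp hδ.tendsto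
      simpa [Real.zero_rpow hη.ne', Function.comp_def] using this
    · exact Real.rpow_pos_of_pos (hδ.pos n) _
  have h2 := tendsto_inv_nhdsGT_zero.comp h1
  filter_upwards [h2.eventually_ge_atTop C] with n hn
  simpa [Real.rpow_neg (hδ.pos n).le] using hn

omit hδ in
lemma Small.of_le {X Y : Type*} [Norm X] [Norm Y] {x : ℕ → X} {y : ℕ → Y} (hy : Small δ y)
    (h : ∀ᶠ n in hyp, ‖x n‖ ≤ ‖y n‖) : Small δ x := by
  obtain ⟨c, hc, h'⟩ := hy
  exact ⟨c, hc, by filter_upwards [h, h'] with n h1 h2 using h1.trans h2⟩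

omit hδ in
lemma Tame.of_le {X Y : Type*} [Norm X] [Norm Y] {x : ℕ → X} {y : ℕ → Y} (hy : Tame δ y)
    (h : ∀ᶠ n in hyp, ‖x n‖ ≤ ‖y n‖) : Tame δ x := fun η hη => by
  filter_upwards [h, hy η hη] with n h1 h2 using h1.trans h2

lemma tame_of_bounded {X : Type*} [Norm X] {x : ℕ → X} (C : ℝ)
    (h : ∀ᶠ n in hyp, ‖x n‖ ≤ C) : Tame δ x := fun η hη => by
  filter_upwards [h, eventually_const_le (δ := δ) C hη] with n h1 h2 using h1.trans h2

lemma tame_const {X : Type*} [Norm X] (x : X) : Tame δ (fun _ => x) :=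
  tame_of_bounded ‖x‖ (Eventually.of_forall fun _ => le_rfl)

/-- Multiplicative estimate for two tame majorants. -/
lemma tame_mul_aux {X Y Z : Type*} [Norm X] [SeminormedAddCommGroup Y] [SeminormedAddCommGroup Z]
    {x : ℕ → X} {y : ℕ → Y} {z : ℕ → Z} (hy : Tame δ y) (hz : Tame δ z)
    (h : ∀ᶠ n in hyp, ‖x n‖ ≤ ‖y n‖ * ‖z n‖) : Tame δ x := fun η hη => by
  filter_upwards [h, hy (η / 2) (by positivity), hz (η / 2) (by positivity)] with n h1 h2 h3
  calc ‖x n‖ ≤ ‖y n‖ * ‖z n‖ := h1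
    _ ≤ δ n ^ (-(η / 2)) * δ n ^ (-(η / 2)) := by
      gcongr
      exact Real.rpow_nonneg (hδ.pos n).le _
    _ = δ n ^ (-η) := by rw [← Real.rpow_add (hδ.pos n)]; congr 1; ring

lemma small_mul_aux {X Y Z : Type*} [Norm X] [SeminormedAddCommGroup Y] [SeminormedAddCommGroup Z]
    {x : ℕ → X} {y : ℕ → Y} {z : ℕ → Z} (hy : Tame δ y) (hz : Small δ z)
    (h : ∀ᶠ n in hyp, ‖x n‖ ≤ ‖y n‖ * ‖z n‖) : Small δ x := by
  obtain ⟨c, hc, hz⟩ := hz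
  refine ⟨c / 2, by positivity, ?_⟩
  filter_upwards [h, hy (c / 2) (by positivity), hz] with n h1 h2 h3
  calc ‖x n‖ ≤ ‖y n‖ * ‖z n‖ := h1
    _ ≤ δ n ^ (-(c / 2)) * δ n ^ c := by
      gcongr
      exact Real.rpow_nonneg (hδ.pos n).le _
    _ = δ n ^ (c / 2) := by rw [← Real.rpow_add (hδ.pos n)]; congr 1; ring

lemma Tame.mul {R : Type*} [NormedRing R] {x y : ℕ → R} (hx : Tame δ x) (hy : Tame δ y) :
    Tame δ (fun n => x n * y n) :=
  tame_mul_aux hx hy (Eventually.of_forall fun _ => norm_mul_le _ _)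

lemma Tame.smul {V : Type*} [SeminormedAddCommGroup V] [NormedSpace ℝ V] {t : ℕ → ℝ} {x : ℕ → V}
    (ht : Tame δ t) (hx : Tame δ x) : Tame δ (fun n => t n • x n) :=
  tame_mul_aux ht hx (Eventually.of_forall fun _ => norm_smul_le _ _)

lemma Tame.mul_small {R : Type*} [NormedRing R] {x y : ℕ → R} (hx : Tame δ x) (hy : Small δ y) :
    Small δ (fun n => x n * y n) :=
  small_mul_aux hx hy (Eventually.of_forall fun _ => norm_mul_le _ _)

lemma Small.mul_tame {R : Type*} [NormedRing R] {x y : ℕ → R} (hx : Small δ x) (hy : Tame δ y) :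
    Small δ (fun n => x n * y n) :=
  small_mul_aux hy hx (Eventually.of_forall fun _ => (norm_mul_le _ _).trans (mul_comm _ _).le)

lemma Tame.smul_small {V : Type*} [SeminormedAddCommGroup V] [NormedSpace ℝ V] {t : ℕ → ℝ}
    {x : ℕ → V} (ht : Tame δ t) (hx : Small δ x) : Small δ (fun n => t n • x n) :=
  small_mul_aux ht hx (Eventually.of_forall fun _ => norm_smul_le _ _)

lemma Small.smul_tame {V : Type*} [SeminormedAddCommGroup V] [NormedSpace ℝ V] {t : ℕ → ℝ}
    {x : ℕ → V} (ht : Small δ t) (hx : Tame δ x) : Small δ (fun n => t n • x n) :=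
  small_mul_aux hx ht (Eventually.of_forall fun _ =>
    (norm_smul_le _ _).trans (mul_comm _ _).le)

lemma Tame.add {V : Type*} [SeminormedAddCommGroup V] {x y : ℕ → V} (hx : Tame δ x)
    (hy : Tame δ y) : Tame δ (fun n => x n + y n) := fun η hη => by
  filter_upwards [hx (η / 2) (by positivity), hy (η / 2) (by positivity),
    eventually_const_le (δ := δ) 2 (η := η / 2) (by positivity)] with n h1 h2 h3
  have hp : 0 ≤ δ n ^ (-(η / 2)) := Real.rpow_nonneg (hδ.pos n).le _
  calc ‖x n + y n‖ ≤ ‖x n‖ + ‖y n‖ := norm_add_le _ _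
    _ ≤ 2 * δ n ^ (-(η / 2)) := by linarith
    _ ≤ δ n ^ (-(η / 2)) * δ n ^ (-(η / 2)) := by gcongr
    _ = δ n ^ (-η) := by rw [← Real.rpow_add (hδ.pos n)]; congr 1; ring

lemma scale_rpow_le {a b : ℝ} (h : a ≤ b) (n : ℕ) : δ n ^ b ≤ δ n ^ a :=
  Real.rpow_le_rpow_of_exponent_ge (hδ.pos n) (hδ.lt_one n).le h

lemma eventually_const_mul_rpow_le (C : ℝ) {a b : ℝ} (h : a < b) :
    ∀ᶠ n in hyp, C * δ n ^ b ≤ δ n ^ a := by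
  filter_upwards [eventually_const_le (δ := δ) C (sub_pos.2 h)] with n hn
  have hp : 0 ≤ δ n ^ b := Real.rpow_nonneg (hδ.pos n).le _
  calc C * δ n ^ b ≤ δ n ^ (-(b - a)) * δ n ^ b := by gcongr
    _ = δ n ^ a := by rw [← Real.rpow_add (hδ.pos n)]; congr 1; ring

lemma Small.add {V : Type*} [SeminormedAddCommGroup V] {x y : ℕ → V} (hx : Small δ x)
    (hy : Small δ y) : Small δ (fun n => x n + y n) := by
  obtain ⟨c, hc, hx⟩ := hx
  obtain ⟨c', hc', hy⟩ := hy
  have hm : 0 < min c c' := lt_min hc hc'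
  refine ⟨min c c' / 2, by positivity, ?_⟩
  filter_upwards [hx, hy, eventually_const_mul_rpow_le (δ := δ) 2 (half_lt_self hm)]
    with n h1 h2 h3
  calc ‖x n + y n‖ ≤ ‖x n‖ + ‖y n‖ := norm_add_le _ _
    _ ≤ 2 * δ n ^ (min c c') := by
      have := scale_rpow_le (δ := δ) (min_le_left c c') n
      have := scale_rpow_le (δ := δ) (min_le_right c c') n
      linarith
    _ ≤ _ := h3

omit hδ in
lemma Tame.neg {V : Type*} [SeminormedAddCommGroup V] {x : ℕ → V} (hx : Tame δ x) :
    Tame δ (fun n => -x n) := hx.of_le (by simp)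

omit hδ in
lemma Small.neg {V : Type*} [SeminormedAddCommGroup V] {x : ℕ → V} (hx : Small δ x) :
    Small δ (fun n => -x n) := hx.of_le (by simp)

lemma small_zero {V : Type*} [SeminormedAddCommGroup V] : Small δ (fun _ => (0 : V)) :=
  ⟨1, one_pos, Eventually.of_forall fun n => by simpa using (hδ.pos n).le⟩

lemma Tame.sum {V ι : Type*} [SeminormedAddCommGroup V] (s : Finset ι) {x : ι → ℕ → V}
    (hx : ∀ i ∈ s, Tame δ (x i)) : Tame δ (fun n => ∑ i ∈ s, x i n) := by
  classical
  induction s using Finset.induction_on with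
  | empty => simpa using tame_const (δ := δ) (0 : V)
  | insert a s ha ih =>
    simp only [Finset.sum_insert ha]
    exact (hx a (by simp)).add (ih fun i hi => hx i (by simp [hi]))

lemma Small.sum {V ι : Type*} [SeminormedAddCommGroup V] (s : Finset ι) {x : ι → ℕ → V}
    (hx : ∀ i ∈ s, Small δ (x i)) : Small δ (fun n => ∑ i ∈ s, x i n) := by
  classical
  induction s using Finset.induction_on with
  | empty => simpa using small_zero (δ := δ) (V := V)
  | insert a s ha ih =>
    simp only [Finset.sum_insert ha]
    exact (hx a (by simp)).add (ih fun i hi => hx i (by simp [hi]))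

lemma Small.tame {X : Type*} [Norm X] {x : ℕ → X} (hx : Small δ x) : Tame δ x := by
  obtain ⟨c, hc, hx⟩ := hx
  intro η hη
  filter_upwards [hx] with n hn
  exact hn.trans (scale_rpow_le (by linarith) n)

omit hδ in
lemma not_small_iff {X : Type*} [Norm X] {x : ℕ → X} :
    ¬ Small δ x ↔ ∀ c : ℝ, 0 < c → ∀ᶠ n in hyp, δ n ^ c < ‖x n‖ := by
  simp only [Small, not_exists, not_and]
  refine forall₂_congr fun c _ => ?_
  rw [Ultrafilter.eventually_not.symm]
  simp

lemma not_small_const {x : ℝ} (hx : x ≠ 0) : ¬ Small δ (fun _ => x) := by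
  rw [not_small_iff]
  intro c hc
  filter_upwards [eventually_const_le (δ := δ) (2 * ‖x‖⁻¹) hc] with n hn
  have h0 : 0 < ‖x‖ := norm_pos_iff.2 hx
  rw [Real.rpow_neg (hδ.pos n).le] at hn
  have h1 : 0 < δ n ^ c := Real.rpow_pos_of_pos (hδ.pos n) _
  have : ‖x‖⁻¹ < (δ n ^ c)⁻¹ := by
    have : 0 < ‖x‖⁻¹ := by positivity
    linarith
  exact (inv_lt_inv₀ h0 h1).1 this

lemma tame_inv_of_not_small {X : Type*} [Norm X] {x : ℕ → X} (hx : ¬ Small δ x) :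
    Tame δ (fun n => ‖x n‖⁻¹) := by
  intro η hη
  filter_upwards [not_small_iff.1 hx η hη] with n hn
  have h1 : 0 < δ n ^ η := Real.rpow_pos_of_pos (hδ.pos n) _
  rw [Real.rpow_neg (hδ.pos n).le, norm_inv, Real.norm_of_nonneg (h1.trans hn).le]
  exact inv_anti₀ h1 hn.le

lemma Tame.pow {R : Type*} [NormedRing R] {x : ℕ → R} (hx : Tame δ x) (k : ℕ) :
    Tame δ (fun n => x n ^ k) := by
  induction k with
  | zero => simpa using tame_const (δ := δ) (1 : R)
  | succ k ih => simpa [pow_succ] using ih.mul hx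

lemma Tame.prod {ι : Type*} (s : Finset ι) {x : ι → ℕ → ℝ}
    (hx : ∀ i ∈ s, Tame δ (x i)) : Tame δ (fun n => ∏ i ∈ s, x i n) := by
  classical
  induction s using Finset.induction_on with
  | empty => simpa using tame_const (δ := δ) (1 : ℝ)
  | insert a s ha ih =>
    simp only [Finset.prod_insert ha]
    exact (hx a (by simp)).mul (ih fun i hi => hx i (by simp [hi]))

end Calculus

section Saturation

/-- A property holding eventually along every sequence holds eventually uniformly. -/
lemma eventually_forall_of_seq {Y : Type*} [Nonempty Y] {Q : ℕ → Y → Prop}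
    (h : ∀ y : ℕ → Y, ∀ᶠ n in hyp, Q n (y n)) : ∀ᶠ n in hyp, ∀ y, Q n y := by
  classical
  have := h (fun n => if hn : ∃ y, ¬ Q n y then hn.choose else Classical.arbitrary Y)
  filter_upwards [this] with n hn
  by_contra! hc
  rw [dif_pos hc] at hn
  exact hc.choose_spec hn

/-- Diagonal choice: a witness for each level gives one witness for all levels at once,
uniformly in the parameter `y`. -/
lemma exists_diagonal {Y Z : Type*} [Nonempty Z] {P : ℕ → ℕ → Y → Z → Prop}
    (hP : ∀ n m m' y z, m ≤ m' → P n m' y z → P n m y z) :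
    ∃ ψ : ℕ → Y → Z, ∀ y : ℕ → Y, (∀ m, ∀ᶠ n in hyp, ∃ z, P n m (y n) z) →
      ∀ m, ∀ᶠ n in hyp, P n m (y n) (ψ n (y n)) := by
  classical
  have key : ∀ n y, ∃ z, ∀ m ≤ n, (∃ z', P n m y z') → P n m y z := by
    intro n y
    by_cases h0 : ∃ m ≤ n, ∃ z', P n m y z'
    · let m₀ := Nat.findGreatest (fun m => ∃ z', P n m y z') n
      obtain ⟨m, hm, hz⟩ := h0
      have h1 : ∃ z', P n m₀ y z' :=
        Nat.findGreatest_spec (P := fun m => ∃ z', P n m y z') hm hz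
      refine ⟨h1.choose, fun m hm hz => hP n m m₀ y _ ?_ h1.choose_spec⟩
      exact Nat.le_findGreatest hm hz
    · exact ⟨Classical.arbitrary Z, fun m hm hz => absurd ⟨m, hm, hz⟩ h0⟩
  choose ψ hψ using key
  refine ⟨ψ, fun y hy m => ?_⟩
  filter_upwards [hy m, eventually_ge_nat m] with n hn hm
  exact hψ n (y n) m hm hn

end Saturation

end SumProduct

namespace SumProduct

open Filter Topology Pointwise Metric

/-- `S` is covered by at most `K` translates of `T`. -/
def CovBy {V : Type*} [AddCommGroup V] (K : ℝ) (S T : Set V) : Prop :=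
  ∃ X : Finset V, (X.card : ℝ) ≤ K ∧ S ⊆ (X : Set V) + T

/-- `S` is covered by tamely many translates of `T`. -/
def TCov (δ : ℕ → ℝ) {V : Type*} [AddCommGroup V] (S T : ℕ → Set V) : Prop :=
  ∀ η : ℝ, 0 < η → ∀ᶠ n in hyp, CovBy (δ n ^ (-η)) (S n) (T n)

section CovBy

variable {V W : Type*} [AddCommGroup V] [AddCommGroup W] {K L : ℝ} {S T U S' T' : Set V}

lemma CovBy.mono (h : CovBy K S T) (hK : K ≤ L) (hS : S' ⊆ S) (hT : T ⊆ T') : CovBy L S' T' := by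
  obtain ⟨X, hX, h⟩ := h
  exact ⟨X, hX.trans hK, hS.trans (h.trans (Set.add_subset_add_left hT))⟩

lemma CovBy.nonneg (h : CovBy K S T) : 0 ≤ K := by
  obtain ⟨X, hX, -⟩ := h
  exact (Nat.cast_nonneg _).trans hX

lemma CovBy.of_subset_add (X : Finset V) (h : S ⊆ (X : Set V) + T) : CovBy X.card S T :=
  ⟨X, le_rfl, h⟩

lemma CovBy.of_subset (h : S ⊆ T) : CovBy 1 S T := ⟨{0}, by simp, by simpa using h⟩

lemma CovBy.add (h : CovBy K S T) (h' : CovBy L S' T') : CovBy (K * L) (S + S') (T + T') := by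
  classical
  obtain ⟨X, hX, h⟩ := h
  obtain ⟨X', hX', h'⟩ := h'
  refine ⟨X + X', ?_, ?_⟩
  · calc ((X + X').card : ℝ) ≤ X.card * X'.card := by exact_mod_cast Finset.card_add_le
      _ ≤ K * L := by
        have : (0 : ℝ) ≤ X.card := Nat.cast_nonneg _
        gcongr
        linarith
  · calc S + S' ⊆ (X + T) + (X' + T') := Set.add_subset_add h h'
      _ = _ := by push_cast; rw [add_add_add_comm]

lemma CovBy.trans (h : CovBy K S T) (h' : CovBy L T U) : CovBy (K * L) S U := by
  classical
  obtain ⟨X, hX, h⟩ := h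
  obtain ⟨X', hX', h'⟩ := h'
  refine ⟨X + X', ?_, ?_⟩
  · calc ((X + X').card : ℝ) ≤ X.card * X'.card := by exact_mod_cast Finset.card_add_le
      _ ≤ K * L := by
        have : (0 : ℝ) ≤ X.card := Nat.cast_nonneg _
        gcongr
        linarith
  · calc S ⊆ X + T := h
      _ ⊆ X + (X' + U) := Set.add_subset_add_left h'
      _ = _ := by push_cast; rw [add_assoc]

lemma CovBy.image (h : CovBy K S T) (f : V →+ W) : CovBy K (f '' S) (f '' T) := by
  classical
  obtain ⟨X, hX, h⟩ := h
  refine ⟨X.image f, le_trans (by exact_mod_cast Finset.card_image_le) hX, ?_⟩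
  calc f '' S ⊆ f '' (X + T) := Set.image_mono h
    _ = _ := by rw [Set.image_add]; simp

lemma CovBy.translate (h : CovBy K S T) (v : V) : CovBy K (v +ᵥ S) T := by
  classical
  obtain ⟨X, hX, h⟩ := h
  refine ⟨v +ᵥ X, by simpa using hX, ?_⟩
  have := Set.vadd_set_mono (a := v) h
  rwa [← vadd_add_assoc, ← Finset.coe_vadd_finset] at this

end CovBy

section TCov

variable {δ : ℕ → ℝ} [hδ : IsScale δ] {V W : Type*} [AddCommGroup V] [AddCommGroup W]
  {S T U S' T' : ℕ → Set V}

omit hδ in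
lemma TCov.of_tame {K : ℕ → ℝ} (hK : Tame δ K) (h : ∀ᶠ n in hyp, CovBy (K n) (S n) (T n)) :
    TCov δ S T := fun η hη => by
  filter_upwards [hK η hη, h] with n h1 h2
  exact h2.mono ((le_abs_self _).trans h1) subset_rfl subset_rfl

lemma TCov.of_subset (h : ∀ᶠ n in hyp, S n ⊆ T n) : TCov δ S T :=
  TCov.of_tame (tame_const (1 : ℝ)) (by filter_upwards [h] with n hn using .of_subset hn)

omit hδ in
lemma TCov.mono (h : TCov δ S T) (hS : ∀ᶠ n in hyp, S' n ⊆ S n) (hT : ∀ᶠ n in hyp, T n ⊆ T' n) :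
    TCov δ S' T' := fun η hη => by
  filter_upwards [h η hη, hS, hT] with n h1 h2 h3 using h1.mono le_rfl h2 h3

lemma TCov.trans (h : TCov δ S T) (h' : TCov δ T U) : TCov δ S U := fun η hη => by
  filter_upwards [h (η / 2) (by positivity), h' (η / 2) (by positivity)] with n h1 h2
  have := h1.trans h2
  rw [← Real.rpow_add (hδ.pos n)] at this
  convert this using 2; ring

lemma TCov.add (h : TCov δ S T) (h' : TCov δ S' T') :
    TCov δ (fun n => S n + S' n) (fun n => T n + T' n) := fun η hη => by
  filter_upwards [h (η / 2) (by positivity), h' (η / 2) (by positivity)] with n h1 h2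
  have := h1.add h2
  rw [← Real.rpow_add (hδ.pos n)] at this
  convert this using 2; ring

omit hδ in
lemma TCov.image (h : TCov δ S T) (f : ℕ → V →+ W) :
    TCov δ (fun n => f n '' S n) (fun n => f n '' T n) := fun η hη => by
  filter_upwards [h η hη] with n h1 using h1.image (f n)

end TCov

section Packing

variable {V : Type*} [NormedAddCommGroup V] [NormedSpace ℝ V] [FiniteDimensional ℝ V]

open MeasureTheory in
/-- Volume bound for separated subsets of a ball. -/
lemma card_le_of_separated {δ R : ℝ} (hδ : 0 < δ) (hR : 0 ≤ R) (Y : Finset V)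
    (hY : (Y : Set V).Pairwise fun x y => δ ≤ dist x y) (hYR : ∀ y ∈ Y, ‖y‖ ≤ R) :
    (Y.card : ℝ) ≤ (1 + 2 * R / δ) ^ Module.finrank ℝ V := by
  borelize V
  set μ : Measure V := Measure.addHaar
  have h0 : μ (ball (0 : V) 1) ≠ 0 := (measure_ball_pos μ _ one_pos).ne'
  have h1 : μ (ball (0 : V) 1) ≠ ⊤ := measure_ball_lt_top.ne
  have hdisj : (Y : Set V).PairwiseDisjoint fun y => ball y (δ / 2) := by
    intro x hx y hy hxy
    refine ball_disjoint_ball ?_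
    have := hY hx hy hxy
    simpa using this
  have hsub : (⋃ y ∈ Y, ball y (δ / 2)) ⊆ ball (0 : V) (R + δ / 2) := by
    refine Set.iUnion₂_subset fun y hy => ball_subset_ball' ?_
    have := hYR y hy
    rw [dist_zero_right]; linarith
  have hm : μ (⋃ y ∈ Y, ball y (δ / 2)) = ∑ y ∈ Y, μ (ball y (δ / 2)) :=
    measure_biUnion_finset hdisj fun _ _ => measurableSet_ball
  have hle := measure_mono (μ := μ) hsub
  rw [hm] at hle
  simp only [Measure.addHaar_ball_of_pos μ _ (half_pos hδ),
    Measure.addHaar_ball_of_pos μ _ (add_pos_of_nonneg_of_pos hR (half_pos hδ)), Finset.sum_const, nsmul_eq_mul,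
    ← mul_assoc] at hle
  rw [ENNReal.mul_le_mul_iff_left h0 h1] at hle
  have hpos : 0 < (δ / 2) ^ Module.finrank ℝ V := by positivity
  rw [← ENNReal.ofReal_natCast, ← ENNReal.ofReal_mul (by positivity),
    ENNReal.ofReal_le_ofReal_iff (by positivity)] at hle
  calc (Y.card : ℝ) ≤ (R + δ / 2) ^ Module.finrank ℝ V / (δ / 2) ^ Module.finrank ℝ V :=
        (le_div_iff₀ hpos).2 hle
    _ = (1 + 2 * R / δ) ^ Module.finrank ℝ V := by
        rw [← div_pow]; congr 1; field_simp; ring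

/-- Maximal separated subsets. -/
lemma exists_separated_cover {δ R : ℝ} (hδ : 0 < δ) (hR : 0 ≤ R) {S : Set V}
    (hS : ∀ y ∈ S, ‖y‖ ≤ R) : ∃ Y : Finset V, (Y : Set V) ⊆ S ∧
      ((Y : Set V).Pairwise fun x y => δ < dist x y) ∧ S ⊆ (Y : Set V) + closedBall 0 δ := by
  classical
  let P : ℕ → Prop := fun N => ∃ Y : Finset V, (Y : Set V) ⊆ S ∧
      ((Y : Set V).Pairwise fun x y => δ < dist x y) ∧ Y.card = N
  obtain ⟨B, hB⟩ := exists_nat_ge ((1 + 2 * R / δ) ^ Module.finrank ℝ V)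
  have hbd : ∀ N, P N → N ≤ B := by
    rintro N ⟨Y, h1, h2, rfl⟩
    have := card_le_of_separated hδ hR Y (fun x hx y hy h => (h2 hx hy h).le)
      (fun y hy => hS y (h1 hy))
    exact_mod_cast this.trans hB
  have hP0 : P 0 := ⟨∅, by simp⟩
  obtain ⟨Y, h1, h2, h3⟩ : P (Nat.findGreatest P B) :=
    Nat.findGreatest_spec (P := P) (Nat.zero_le _) hP0
  refine ⟨Y, h1, h2, fun s hs => ?_⟩
  by_contra hcon
  have hfar : ∀ y ∈ Y, δ < dist s y := by
    intro y hy
    by_contra! hle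
    refine hcon ⟨y, hy, s - y, ?_, by simp⟩
    simpa [dist_eq_norm] using hle
  have hsY : s ∉ Y := fun h => by
    have := hfar s h
    simp at this; linarith
  have : P (Y.card + 1) := by
    refine ⟨insert s Y, ?_, ?_, Finset.card_insert_of_notMem hsY⟩
    · rw [Finset.coe_insert]; exact Set.insert_subset hs h1
    · rw [Finset.coe_insert]
      refine h2.insert fun y hy _ => ⟨hfar y hy, ?_⟩
      rw [dist_comm]; exact hfar y hy
  have h4 := Nat.le_findGreatest (hbd _ this) this
  omega

lemma covBy_closedBall {δ R : ℝ} (hδ : 0 < δ) (hR : 0 ≤ R) :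
    CovBy ((1 + 2 * R / δ) ^ Module.finrank ℝ V) (closedBall (0 : V) R) (closedBall 0 δ) := by
  obtain ⟨Y, h1, h2, h3⟩ := exists_separated_cover (S := closedBall (0 : V) R) hδ hR
    (fun y hy => by simpa using hy)
  exact ⟨Y, card_le_of_separated hδ hR Y (fun x hx y hy h => (h2 hx hy h).le)
    (fun y hy => by simpa using h1 hy), h3⟩

open MeasureTheory in
/-- A ball contains large separated subsets. -/
lemma exists_separated_ball {δ R : ℝ} (hδ : 0 < δ) (hR : 0 ≤ R) :
    ∃ Y : Finset V, (∀ y ∈ Y, ‖y‖ ≤ R) ∧ ((Y : Set V).Pairwise fun x y => δ < dist x y) ∧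
      (R / δ) ^ Module.finrank ℝ V ≤ Y.card := by
  obtain ⟨Y, h1, h2, h3⟩ := exists_separated_cover (S := closedBall (0 : V) R) hδ hR
    (fun y hy => by simpa using hy)
  refine ⟨Y, fun y hy => by simpa using h1 hy, h2, ?_⟩
  borelize V
  set μ : Measure V := Measure.addHaar
  have h0 : μ (ball (0 : V) 1) ≠ 0 := (measure_ball_pos μ _ one_pos).ne'
  have hfin : μ (ball (0 : V) 1) ≠ ⊤ := measure_ball_lt_top.ne
  have hsub : closedBall (0 : V) R ⊆ ⋃ y ∈ Y, closedBall y δ := by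
    intro s hs
    obtain ⟨y, hy, b, hb, rfl⟩ := h3 hs
    refine Set.mem_iUnion₂.2 ⟨y, hy, ?_⟩
    simpa using hb
  have hle : μ (closedBall (0 : V) R) ≤ ∑ y ∈ Y, μ (closedBall y δ) :=
    (measure_mono (μ := μ) hsub).trans (measure_biUnion_finset_le _ _)
  have hb : ∀ y : V, μ (closedBall y δ) = _ := fun y => Measure.addHaar_closedBall μ y hδ.le
  rw [Measure.addHaar_closedBall μ 0 hR] at hle
  simp only [hb, Finset.sum_const, nsmul_eq_mul, ← mul_assoc] at hle
  rw [ENNReal.mul_le_mul_iff_left h0 hfin, ← ENNReal.ofReal_natCast,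
    ← ENNReal.ofReal_mul (by positivity), ENNReal.ofReal_le_ofReal_iff (by positivity)] at hle
  rw [div_pow, div_le_iff₀ (by positivity)]
  exact hle

omit [NormedSpace ℝ V] [FiniteDimensional ℝ V] in
lemma CovBy.card_le {K δ : ℝ} {S : Set V} (h : CovBy K S (closedBall 0 δ)) {Y : Finset V}
    (hYS : (Y : Set V) ⊆ S) (hY : (Y : Set V).Pairwise fun x y => 2 * δ < dist x y) :
    (Y.card : ℝ) ≤ K := by
  obtain ⟨X, hX, hS⟩ := h
  refine le_trans ?_ hX
  have : ∀ y ∈ Y, ∃ x ∈ X, dist y x ≤ δ := by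
    intro y hy
    obtain ⟨x, hx, b, hb, rfl⟩ := hS (hYS hy)
    exact ⟨x, hx, by simpa using hb⟩
  choose! g hg hg' using this
  norm_cast
  refine Finset.card_le_card_of_injOn g hg fun y hy z hz hyz => ?_
  by_contra hne
  have h1 := hY hy hz hne
  have h2 := hg' y hy
  have h3 := hg' z hz
  have h4 := dist_triangle y (g y) z
  rw [hyz] at h4 h2
  rw [dist_comm (g z) z] at h4
  linarith

/-- Change of scale in a ball covering. -/
lemma CovBy.rescale {K δ r : ℝ} (hδ : 0 < δ) (hr : 0 ≤ r) {S : Set V}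
    (h : CovBy K S (closedBall 0 (r * δ))) :
    CovBy (K * (1 + 2 * r) ^ Module.finrank ℝ V) S (closedBall 0 δ) := by
  have := h.trans (covBy_closedBall (V := V) hδ (by positivity : 0 ≤ r * δ))
  convert this using 4
  field_simp

end Packing

end SumProduct

namespace SumProduct

open Filter Topology Pointwise Metric

/-- `N` is the `δ`-covering number of `S`. -/
def IsCov {V : Type*} [NormedAddCommGroup V] (δ N : ℝ) (S : Set V) : Prop :=
  CovBy N S (closedBall 0 δ) ∧ ∀ K, CovBy K S (closedBall 0 δ) → N ≤ K

section

variable {V : Type*} [NormedAddCommGroup V]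

lemma IsCov.one_le {N δ : ℝ} {S : Set V} (h : IsCov δ N S) (hS : S.Nonempty) : 1 ≤ N := by
  obtain ⟨⟨X, hX, h1⟩, h2⟩ := h
  refine le_trans ?_ hX
  norm_cast
  rw [Nat.succ_le_iff, Finset.card_pos]
  obtain ⟨s, hs⟩ := hS
  obtain ⟨x, hx, -⟩ := h1 hs
  exact ⟨x, hx⟩

/-- Maximal subsets of mutually `R`-related points. -/
lemma exists_maximal_pairwise {α : Type*} (R : α → α → Prop) (hR : ∀ a b, R a b → R b a)
    (S : Set α) (N : ℕ)
    (hN : ∀ F : Finset α, (F : Set α) ⊆ S → (F : Set α).Pairwise R → F.card ≤ N) :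
    ∃ F : Finset α, (F : Set α) ⊆ S ∧ (F : Set α).Pairwise R ∧
      ∀ s ∈ S, s ∈ F ∨ ∃ f ∈ F, ¬ R s f := by
  classical
  let P : ℕ → Prop := fun m => ∃ F : Finset α, (F : Set α) ⊆ S ∧ (F : Set α).Pairwise R ∧ F.card = m
  obtain ⟨F, h1, h2, h3⟩ : P (Nat.findGreatest P N) :=
    Nat.findGreatest_spec (P := P) (Nat.zero_le _) ⟨∅, by simp⟩
  refine ⟨F, h1, h2, fun s hs => ?_⟩
  by_contra! hcon
  have hP : P (F.card + 1) := by
    refine ⟨insert s F, ?_, ?_, Finset.card_insert_of_notMem hcon.1⟩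
    · rw [Finset.coe_insert]; exact Set.insert_subset hs h1
    · rw [Finset.coe_insert]
      exact h2.insert fun y hy _ => ⟨hcon.2 y hy, hR _ _ (hcon.2 y hy)⟩
  have h4 : F.card + 1 ≤ N := by
    obtain ⟨F', h5, h6, h7⟩ := hP
    exact h7 ▸ hN F' h5 h6
  have := Nat.le_findGreatest h4 hP
  omega

end

variable {V : Type*} [NormedAddCommGroup V] [NormedSpace ℝ V] [FiniteDimensional ℝ V]

omit [NormedSpace ℝ V] [FiniteDimensional ℝ V] in
lemma closedBall_add_closedBall_subset {r s : ℝ} :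
    closedBall (0 : V) r + closedBall 0 s ⊆ closedBall 0 (r + s) := by
  rintro _ ⟨a, ha, b, hb, rfl⟩
  simp only [mem_closedBall, dist_zero_right] at *
  exact (norm_add_le _ _).trans (add_le_add ha hb)

/-- Ruzsa's covering lemma at scale `δ`. -/
lemma ruzsa_covering {K L δ R : ℝ} (hδ : 0 < δ) (hR : 0 ≤ R) {A B : Set V}
    (hA : ∀ a ∈ A, ‖a‖ ≤ R)
    (h : CovBy K (A + B) (closedBall 0 δ)) (hL : 0 < L)
    (hLA : ∀ K', CovBy K' A (closedBall 0 δ) → L ≤ K') :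
    CovBy (K * 9 ^ Module.finrank ℝ V * 9 ^ Module.finrank ℝ V / L) B
      (A - A + closedBall 0 δ) := by
  classical
  set d := Module.finrank ℝ V
  obtain ⟨A', hA', hsep, hcov⟩ := exists_separated_cover (δ := 4 * δ) (by positivity) hR hA
  have hA'L : L ≤ A'.card * 9 ^ d := by
    have h1 : CovBy A'.card A (closedBall 0 (4 * δ)) := ⟨A', le_rfl, hcov⟩
    have h2 := hLA _ (h1.rescale hδ (by norm_num))
    norm_num at h2
    exact h2
  have hA'pos : (0 : ℝ) < A'.card := by
    by_contra hcon
    have : (A'.card : ℝ) = 0 := le_antisymm (not_lt.1 hcon) (Nat.cast_nonneg _)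
    rw [this] at hA'L; linarith
  have hKbound : ∀ F : Finset V, (F : Set V) ⊆ B →
      (F : Set V).Pairwise (fun f f' => ∀ a ∈ A', ∀ a' ∈ A', 4 * δ < dist (f + a) (f' + a')) →
      (F.card : ℝ) * A'.card ≤ K := by
    intro F hF hFp
    have hne : ∀ p ∈ F ×ˢ A', ∀ q ∈ F ×ˢ A', p ≠ q → 4 * δ < dist (p.1 + p.2) (q.1 + q.2) := by
      rintro ⟨f, a⟩ hp ⟨f', a'⟩ hq hpq
      simp only [Finset.mem_product] at hp hq
      by_cases hff : f = f'
      · subst hff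
        have : a ≠ a' := fun h => hpq (by rw [h])
        simpa using hsep hp.2 hq.2 this
      · exact hFp hp.1 hq.1 hff a hp.2 a' hq.2
    have hinj : Set.InjOn (fun p : V × V => p.1 + p.2) (F ×ˢ A' : Finset (V × V)) := by
      intro p hp q hq hpq
      by_contra hcon
      have := hne p hp q hq hcon
      simp only at hpq
      rw [hpq, dist_self] at this
      linarith
    have hcard := Finset.card_image_of_injOn hinj
    rw [Finset.card_product] at hcard
    have := h.card_le (Y := (F ×ˢ A').image fun p : V × V => p.1 + p.2) ?_ ?_
    · rw [hcard] at this; exact_mod_cast this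
    · intro x hx
      simp only [Finset.coe_image, Set.mem_image] at hx
      obtain ⟨p, hp, rfl⟩ := hx
      have hp' := Finset.mem_product.1 hp
      exact ⟨p.2, hA' hp'.2, p.1, hF hp'.1, add_comm _ _⟩
    · intro x hx y hy hxy
      simp only [Finset.coe_image, Set.mem_image] at hx hy
      obtain ⟨p, hp, rfl⟩ := hx
      obtain ⟨q, hq, rfl⟩ := hy
      have := hne p hp q hq (fun h => hxy (by rw [h]))
      linarith
  obtain ⟨M, hM⟩ := exists_nat_ge (K / A'.card)
  obtain ⟨F, hF, hFp, hmax⟩ := exists_maximal_pairwise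
    (fun f f' => ∀ a ∈ A', ∀ a' ∈ A', 4 * δ < dist (f + a) (f' + a'))
    (fun f f' h a ha a' ha' => by rw [dist_comm]; exact h a' ha' a ha) B M (fun F h1 h2 => by
      have := (le_div_iff₀ hA'pos).2 (hKbound F h1 h2)
      exact_mod_cast this.trans hM)
  have hFK := hKbound F hF hFp
  have hBsub : B ⊆ (F : Set V) + (A - A + closedBall 0 (4 * δ)) := by
    intro b hb
    obtain ⟨a₀, ha₀⟩ : A'.Nonempty := Finset.card_pos.1 (by exact_mod_cast hA'pos)
    rcases hmax b hb with h1 | ⟨f, hf, h1⟩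
    · refine ⟨b, h1, 0, ⟨0, ⟨a₀, hA' ha₀, a₀, hA' ha₀, sub_self _⟩, 0, ?_, add_zero _⟩, add_zero _⟩
      simp [hδ.le]
    · push Not at h1
      obtain ⟨a, ha, a', ha', h2⟩ := h1
      refine ⟨f, hf, b - f, ⟨a' - a, ⟨a', hA' ha', a, hA' ha, rfl⟩, (b + a) - (f + a'), ?_, ?_⟩, ?_⟩
      · simpa [dist_eq_norm] using h2
      · dsimp only; abel
      · dsimp only; abel
  have h1 : CovBy F.card B (A - A + closedBall 0 (4 * δ)) := ⟨F, le_rfl, hBsub⟩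
  have h2 := covBy_closedBall (V := V) (R := 4 * δ) hδ (by positivity)
  have h3 := h1.trans ((CovBy.of_subset (S := A - A) subset_rfl).add h2)
  refine h3.mono ?_ subset_rfl subset_rfl
  have e : 1 + 2 * (4 * δ) / δ = 9 := by field_simp; norm_num
  rw [e, one_mul, le_div_iff₀ hL]
  have : (0 : ℝ) ≤ F.card := Nat.cast_nonneg _
  calc (F.card : ℝ) * 9 ^ d * L ≤ F.card * 9 ^ d * (A'.card * 9 ^ d) := by gcongr
    _ = (F.card * A'.card) * 9 ^ d * 9 ^ d := by ring
    _ ≤ _ := by gcongr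

variable (V) in
lemma exists_rounding : ∃ C c : ℝ, 0 ≤ C ∧ 0 < c ∧ ∀ δ : ℝ, 0 < δ →
    ∃ (Λ : AddSubgroup V) (r : V → V), (∀ x, r x ∈ Λ) ∧ (∀ x, ‖x - r x‖ ≤ C * δ) ∧
      ∀ l ∈ Λ, l ≠ 0 → c * δ ≤ ‖l‖ := by
  let b := Module.finBasis ℝ V
  let L := (Submodule.span ℤ (Set.range b))
  obtain ⟨c, hc, hcL⟩ : ∃ c : ℝ, 0 < c ∧ ∀ l ∈ L, l ≠ 0 → c ≤ ‖l‖ := by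
    have h0 : IsOpen ({0} : Set L) := isOpen_discrete _
    obtain ⟨c, hc, h⟩ := Metric.isOpen_iff.1 h0 0 rfl
    refine ⟨c, hc, fun l hl hl0 => ?_⟩
    by_contra! hlt
    have := @h ⟨l, hl⟩ (by simpa using hlt)
    exact hl0 (by simpa using this)
  refine ⟨∑ i, ‖b i‖, c, by positivity, hc, fun δ hδ =>
    ⟨L.toAddSubgroup.map (DistribSMul.toAddMonoidHom V δ),
      fun x => δ • (ZSpan.floor b (δ⁻¹ • x) : V), fun x => ⟨_, (ZSpan.floor b (δ⁻¹ • x)).2, rfl⟩,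
      fun x => ?_, ?_⟩⟩
  · have := ZSpan.norm_fract_le (K := ℝ) b (δ⁻¹ • x)
    rw [ZSpan.fract_apply] at this
    have e : x - δ • (ZSpan.floor b (δ⁻¹ • x) : V) = δ • (δ⁻¹ • x - ZSpan.floor b (δ⁻¹ • x)) := by
      rw [smul_sub, smul_inv_smul₀ hδ.ne']
    rw [e, norm_smul, Real.norm_of_nonneg hδ.le, mul_comm]
    gcongr
  · rintro _ ⟨l, hl, rfl⟩ hne
    have hl0 : l ≠ 0 := fun h => hne (by simp [h])
    simp only [DistribSMul.toAddMonoidHom_apply, norm_smul, Real.norm_of_nonneg hδ.le]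
    rw [mul_comm]
    have := hcL l hl hl0
    gcongr

variable (V) in
/-- The Plünnecke inequality at scale `δ`. -/
lemma pluennecke_covBy : ∃ C : ℝ, 0 ≤ C ∧ ∀ (δ R K L N : ℝ) (A : Set V), 0 < δ → 0 ≤ R → 0 < L →
    A.Nonempty → (∀ a ∈ A, ‖a‖ ≤ R) → CovBy K (A + A) (closedBall 0 δ) →
    (∀ K', CovBy K' A (closedBall 0 δ) → L ≤ K') → CovBy N A (closedBall 0 δ) →
    CovBy (C * (K / L) ^ 5 * N) (A + A + A - (A + A)) (closedBall 0 δ) := by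
  classical
  obtain ⟨C, c, hC, hc, hround⟩ := exists_rounding V
  set d := Module.finrank ℝ V
  let C₁ : ℝ := (1 + 2 * (C + 1)) ^ d
  let C₂ : ℝ := (1 + 2 * (1 + 2 * C) / (c / 3)) ^ d
  let C₃ : ℝ := (1 + 2 * (5 * (C + 1))) ^ d
  have hC₁ : 0 ≤ C₁ := by positivity
  have hC₂ : 0 ≤ C₂ := by positivity
  have hC₃ : 0 ≤ C₃ := by positivity
  refine ⟨(C₁ * C₂) ^ 5 * C₂ * C₃, by positivity, fun δ R K L N A hδ hR hL hne hAR hK hLA hN => ?_⟩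
  obtain ⟨Λ, r, hrΛ, hr, hΛ⟩ := hround δ hδ
  obtain ⟨A', hA', -, hcov⟩ := exists_separated_cover hδ hR hAR
  let S := A'.image r
  have hAS : A ⊆ (S : Set V) + closedBall 0 ((C + 1) * δ) := by
    intro a ha
    obtain ⟨a', ha', b, hb, rfl⟩ := hcov ha
    refine ⟨r a', Finset.mem_coe.2 (Finset.mem_image_of_mem _ ha'), (a' - r a') + b, ?_, by dsimp only; abel⟩
    have h1 := hr a'
    have h2 : ‖b‖ ≤ δ := by simpa using hb
    have := norm_add_le (a' - r a') b
    simp only [mem_closedBall, dist_zero_right]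
    linarith
  have hSA : (S : Set V) ⊆ A + closedBall 0 (C * δ) := by
    intro s hs
    obtain ⟨a, ha, rfl⟩ := Finset.mem_image.1 (Finset.mem_coe.1 hs)
    refine ⟨a, hA' ha, r a - a, ?_, by dsimp only; abel⟩
    simpa [norm_sub_rev] using hr a
  have hSΛ : ∀ s ∈ S, s ∈ Λ := by
    intro s hs
    obtain ⟨a, ha, rfl⟩ := Finset.mem_image.1 hs
    exact hrΛ a
  have hLS : L ≤ S.card * C₁ :=
    hLA _ ((CovBy.of_subset_add S hAS).rescale hδ (by positivity))
  have hSpos : (0 : ℝ) < S.card := by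
    by_contra hcon
    have : (S.card : ℝ) = 0 := le_antisymm (not_lt.1 hcon) (Nat.cast_nonneg _)
    rw [this] at hLS; linarith
  have hcard : ∀ (M ρ : ℝ) (T : Set V) (Y : Finset V), 0 ≤ ρ → ρ ≤ 2 * C →
      CovBy M T (closedBall 0 δ) → (∀ y ∈ Y, y ∈ Λ) → (Y : Set V) ⊆ T + closedBall 0 (ρ * δ) →
      (Y.card : ℝ) ≤ M * C₂ := by
    intro M ρ T Y hρ hρC hM hYΛ hYT
    have h1 : CovBy M (T + closedBall 0 (ρ * δ)) (closedBall 0 ((1 + 2 * C) * δ)) := by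
      refine (hM.add (CovBy.of_subset (S := closedBall (0 : V) (ρ * δ)) subset_rfl)).mono
        (by rw [mul_one]) subset_rfl (closedBall_add_closedBall_subset.trans
          (closedBall_subset_closedBall ?_))
      nlinarith
    have h2 := h1.trans (covBy_closedBall (V := V) (δ := c / 3 * δ) (by positivity)
      (by positivity : 0 ≤ (1 + 2 * C) * δ))
    have h3 := h2.card_le hYT fun x hx y hy hxy => by
      have := hΛ (x - y) (Λ.sub_mem (hYΛ x hx) (hYΛ y hy)) (sub_ne_zero.2 hxy)
      change _ < dist x y
      rw [dist_eq_norm]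
      nlinarith [mul_pos hc hδ]
    convert h3 using 3
    field_simp
  have hSN : (S.card : ℝ) ≤ N * C₂ := hcard N C A S hC (by linarith) hN hSΛ hSA
  have hSSK : ((S + S).card : ℝ) ≤ K * C₂ := by
    refine hcard K (2 * C) (A + A) (S + S) (by positivity) le_rfl hK ?_ ?_
    · intro y hy
      obtain ⟨s, hs, t, ht, rfl⟩ := Finset.mem_add.1 hy
      exact Λ.add_mem (hSΛ s hs) (hSΛ t ht)
    · push_cast
      refine (Set.add_subset_add hSA hSA).trans ?_
      rw [add_add_add_comm]
      refine Set.add_subset_add_left (closedBall_add_closedBall_subset.trans ?_)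
      rw [← two_mul, mul_assoc]
  have hSne : S.Nonempty := Finset.card_pos.1 (by exact_mod_cast hSpos)
  have hP := Finset.pluennecke_ruzsa_inequality_nsmul_sub_nsmul_add hSne S 3 2
  have hP' : ((3 • S - 2 • S).card : ℝ) ≤ ((S + S).card / S.card : ℝ) ^ 5 * S.card := by
    have := (NNRat.cast_le (K := ℝ)).2 hP
    push_cast at this
    exact this
  have e3 : 3 • S = S + S + S := by rw [succ_nsmul, two_nsmul]
  rw [e3, two_nsmul] at hP'
  have hfin : CovBy (S + S + S - (S + S)).card (A + A + A - (A + A))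
      (closedBall 0 (5 * (C + 1) * δ)) := by
    refine CovBy.of_subset_add _ ?_
    have h2 : A + A ⊆ (S : Set V) + (S : Set V) + closedBall 0 (2 * (C + 1) * δ) := by
      refine (Set.add_subset_add hAS hAS).trans ?_
      rw [add_add_add_comm]
      refine Set.add_subset_add_left (closedBall_add_closedBall_subset.trans ?_)
      rw [← two_mul, mul_assoc]
    have h3 : A + A + A ⊆ (S : Set V) + (S : Set V) + (S : Set V) + closedBall 0 (3 * (C + 1) * δ) := by
      refine (Set.add_subset_add h2 hAS).trans ?_
      rw [add_add_add_comm]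
      refine Set.add_subset_add_left (closedBall_add_closedBall_subset.trans ?_)
      exact closedBall_subset_closedBall (by linarith)
    rintro _ ⟨x, hx, y, hy, rfl⟩
    obtain ⟨s, hs, b, hb, rfl⟩ := h3 hx
    obtain ⟨t, ht, b', hb', rfl⟩ := h2 hy
    refine ⟨s - t, by push_cast; exact Set.sub_mem_sub hs ht, b - b', ?_, ?_⟩
    · simp only [mem_closedBall, dist_zero_right] at *
      exact (norm_sub_le _ _).trans (by linarith)
    · simp only; abel
  refine (hfin.rescale hδ (by positivity)).mono ?_ subset_rfl subset_rfl
  have hKC : 0 ≤ K := hK.nonneg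
  have hratio : ((S + S).card / S.card : ℝ) ≤ K / L * (C₁ * C₂) := by
    rw [div_le_iff₀ hSpos]
    calc ((S + S).card : ℝ) ≤ K * C₂ := hSSK
      _ = K / L * L * C₂ := by field_simp
      _ ≤ K / L * (S.card * C₁) * C₂ := by gcongr
      _ = _ := by ring
  calc ((S + S + S - (S + S)).card : ℝ) * C₃
      ≤ ((S + S).card / S.card : ℝ) ^ 5 * S.card * C₃ := by gcongr
    _ ≤ (K / L * (C₁ * C₂)) ^ 5 * (N * C₂) * C₃ := by gcongr
    _ = _ := by ring

end SumProduct

namespace SumProduct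

set_option linter.unusedSectionVars false

open Filter Topology Pointwise Metric

section

variable {δ : ℕ → ℝ} [hδ : IsScale δ]

lemma eventually_const_mul_pow_le (C : ℝ) (k : ℕ) {η : ℝ} (hη : 0 < η) :
    ∃ η' : ℝ, 0 < η' ∧ ∀ᶠ n in hyp, C * (δ n ^ (-η')) ^ k ≤ δ n ^ (-η) := by
  refine ⟨η / (k + 1), by positivity, ?_⟩
  have h : -η < -(η / (k + 1)) * k := by
    have : η / (k + 1) * k < η := by
      rw [div_mul_eq_mul_div, div_lt_iff₀ (by positivity)]; nlinarith
    linarith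
  filter_upwards [eventually_const_mul_rpow_le (δ := δ) C h] with n hn
  rwa [← Real.rpow_natCast, ← Real.rpow_mul (hδ.pos n).le]

lemma TCov.of_forall {V : Type*} [AddCommGroup V] {S T : ℕ → Set V} (C : ℝ) (k : ℕ)
    (h : ∀ η : ℝ, 0 < η → ∀ᶠ n in hyp, CovBy (C * (δ n ^ (-η)) ^ k) (S n) (T n)) :
    TCov δ S T := fun η hη => by
  obtain ⟨η', hη', h1⟩ := eventually_const_mul_pow_le (δ := δ) C k hη
  filter_upwards [h1, h η' hη'] with n h2 h3 using h3.mono h2 subset_rfl subset_rfl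

end

/-- A sequence of sets `A n` at scales `δ n` violating the sum-product estimate, with covering
numbers `N n`. -/
structure Setup {E : Type*} [NormedRing E] [NormedAlgebra ℝ E] (δ : ℕ → ℝ) (κ σ : ℝ)
    (A : ℕ → Set E) (N : ℕ → ℝ) : Prop where
  nonempty : ∀ n, (A n).Nonempty
  cov : ∀ n, IsCov (δ n) (N n) (A n)
  norm_le : ∀ η : ℝ, 0 < η → ∀ᶠ n in hyp, ∀ a ∈ A n, ‖a‖ ≤ δ n ^ (-η)
  lower : ∀ η : ℝ, 0 < η → ∀ᶠ n in hyp, ∀ ρ, δ n ≤ ρ → ∀ K, CovBy K (A n) (closedBall 0 ρ) →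
    δ n ^ η * ρ ^ (-κ) ≤ K
  upper : ∀ η : ℝ, 0 < η → ∀ᶠ n in hyp, N n ≤ δ n ^ (-(σ + η))
  away : ∀ η : ℝ, 0 < η → ∀ᶠ n in hyp, ∀ W : Subalgebra ℝ E, W ≠ ⊤ →
    ∃ a ∈ A n, ∀ w ∈ W, δ n ^ η ≤ ‖a - w‖
  add : ∀ η : ℝ, 0 < η → ∀ᶠ n in hyp,
    CovBy (δ n ^ (-η) * N n) (A n + A n) (closedBall 0 (δ n))
  mul : ∀ η : ℝ, 0 < η → ∀ᶠ n in hyp,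
    CovBy (δ n ^ (-η) * N n) (A n + A n * A n) (closedBall 0 (δ n))

/-- The difference set of `A n`, thickened at scale `δ n`. -/
def diffSet {E : Type*} [NormedAddCommGroup E] (δ : ℕ → ℝ) (A : ℕ → Set E) (n : ℕ) : Set E :=
  (A n - A n) + closedBall 0 (δ n)

/-- Additive maps sending the difference set into tamely many of its translates. -/
def Good {E : Type*} [NormedAddCommGroup E] (δ : ℕ → ℝ) (A : ℕ → Set E) (f : ℕ → E →+ E) : Prop :=
  TCov δ (fun n => f n '' diffSet δ A n) (diffSet δ A)

/-- Sequences of elements acting well on the difference set from both sides. -/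
structure IsGood {E : Type*} [NormedRing E] (δ : ℕ → ℝ) (A : ℕ → Set E) (x : ℕ → E) : Prop where
  tame : Tame δ x
  left : Good δ A fun n => AddMonoidHom.mulLeft (x n)
  right : Good δ A fun n => AddMonoidHom.mulRight (x n)

section

variable {E : Type*} [NormedRing E] [NormedAlgebra ℝ E] [FiniteDimensional ℝ E]
  {δ : ℕ → ℝ} [hδ : IsScale δ] {κ σ : ℝ} {A : ℕ → Set E} {N : ℕ → ℝ}

namespace Setup

variable (hA : Setup δ κ σ A N)
include hA

omit hδ [FiniteDimensional ℝ E] in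
lemma one_le (n : ℕ) : 1 ≤ N n := (hA.cov n).one_le (hA.nonempty n)

omit hδ [FiniteDimensional ℝ E] in
lemma pos (n : ℕ) : 0 < N n := one_pos.trans_le (hA.one_le n)

omit hδ [FiniteDimensional ℝ E] in
lemma ball_subset (n : ℕ) : closedBall 0 (δ n) ⊆ diffSet δ A n := by
  intro b hb
  obtain ⟨a, ha⟩ := hA.nonempty n
  exact ⟨0, ⟨a, ha, a, ha, sub_self a⟩, b, hb, zero_add b⟩

omit hA in
lemma ball_cov_ball {R : ℕ → ℝ} (hR : Tame δ R) :
    TCov δ (fun n => closedBall (0 : E) (R n * δ n)) (fun n => closedBall (0 : E) (δ n)) := by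
  refine TCov.of_tame (K := fun n => (1 + 2 * |R n|) ^ Module.finrank ℝ E) (Tame.pow
    ((tame_const (1 : ℝ)).add ((tame_const (2 : ℝ)).mul (hR.of_le (by simp)))) _) ?_
  refine Eventually.of_forall fun n => ?_
  have := hδ.pos n
  refine (covBy_closedBall (V := E) this (by positivity : 0 ≤ |R n| * δ n)).mono ?_ ?_ subset_rfl
  · apply le_of_eq; congr 1; field_simp
  · exact closedBall_subset_closedBall (by gcongr; exact le_abs_self _)

lemma ball_cov {R : ℕ → ℝ} (hR : Tame δ R) :
    TCov δ (fun n => closedBall (0 : E) (R n * δ n)) (diffSet δ A) :=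
  (ball_cov_ball hR).mono (Eventually.of_forall fun _ => subset_rfl)
    (Eventually.of_forall hA.ball_subset)

omit hA in
lemma thick_cov {S T : ℕ → Set E} (h : TCov δ S T) {R : ℕ → ℝ} (hR : Tame δ R) :
    TCov δ (fun n => S n + closedBall 0 (R n * δ n)) (fun n => T n + closedBall 0 (δ n)) :=
  h.add (ball_cov_ball hR)

omit hδ [FiniteDimensional ℝ E] hA in
lemma neg_diffSet (n : ℕ) : -diffSet δ A n = diffSet δ A n := by
  simp only [diffSet, neg_add, neg_sub]
  congr 1
  ext x; simp

omit hδ [FiniteDimensional ℝ E] hA in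
lemma neg_cov {S : ℕ → Set E} (h : TCov δ S (diffSet δ A)) :
    TCov δ (fun n => -S n) (diffSet δ A) := by
  have := h.image fun _ => (-AddMonoidHom.id E)
  refine this.mono (Eventually.of_forall fun n => ?_) (Eventually.of_forall fun n => ?_)
  · intro x hx; exact ⟨-x, hx, by simp⟩
  · rintro _ ⟨x, hx, rfl⟩
    rw [← neg_diffSet]; simpa using hx

lemma ruzsa {B : ℕ → Set E} (C : ℝ) (k : ℕ) (hB : ∀ η : ℝ, 0 < η → ∀ᶠ n in hyp,
    CovBy (C * (δ n ^ (-η)) ^ k * N n) (A n + B n) (closedBall 0 (δ n))) :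
    TCov δ B (diffSet δ A) := by
  refine TCov.of_forall (C * 9 ^ Module.finrank ℝ E * 9 ^ Module.finrank ℝ E) k fun η hη => ?_
  filter_upwards [hB η hη, hA.norm_le 1 one_pos] with n h1 h2
  have h3 := ruzsa_covering (hδ.pos n) (Real.rpow_nonneg (hδ.pos n).le _) h2 h1 (hA.pos n)
    (hA.cov n).2
  refine h3.mono (le_of_eq ?_) subset_rfl subset_rfl
  have := (hA.pos n).ne'
  field_simp

lemma exists_iterated_cov : ∃ C : ℝ, ∀ η : ℝ, 0 < η → ∀ᶠ n in hyp,
    CovBy (C * (δ n ^ (-η)) ^ 5 * N n) (A n + A n + A n - (A n + A n)) (closedBall 0 (δ n)) := by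
  obtain ⟨C, hC, h⟩ := pluennecke_covBy E
  refine ⟨C, fun η hη => ?_⟩
  filter_upwards [hA.add η hη, hA.norm_le 1 one_pos] with n h1 h2
  have h3 := h _ _ _ _ _ _ (hδ.pos n) (Real.rpow_nonneg (hδ.pos n).le _) (hA.pos n)
    (hA.nonempty n) h2 h1 (hA.cov n).2 (hA.cov n).1
  rwa [mul_div_assoc, div_self (hA.pos n).ne', mul_one] at h3

lemma diff_cov : TCov δ (fun n => A n - A n) (diffSet δ A) :=
  TCov.of_subset (Eventually.of_forall fun n x hx => ⟨x, hx, 0, by simp [(hδ.pos n).le], by simp⟩)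

/-- The difference set is an approximate group. -/
lemma add_cov : TCov δ (fun n => diffSet δ A n + diffSet δ A n) (diffSet δ A) := by
  obtain ⟨C, hC⟩ := hA.exists_iterated_cov
  have h1 : TCov δ (fun n => A n + A n - (A n + A n)) (diffSet δ A) := by
    refine hA.ruzsa C 5 fun η hη => ?_
    filter_upwards [hC η hη] with n hn
    rwa [← add_sub_assoc, ← add_assoc]
  have h2 := thick_cov h1 (tame_const (2 : ℝ))
  have h3 := thick_cov hA.diff_cov (tame_const (2 : ℝ))
  have h4 := thick_cov (δ := δ) (TCov.of_subset (T := fun n => A n - A n)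
    (Eventually.of_forall fun _ => subset_rfl)) (tame_const (2 : ℝ)) (S := fun n => A n - A n)
  refine ((h2.mono (Eventually.of_forall fun n => ?_) (Eventually.of_forall fun n => ?_)).trans h4)
  · rintro _ ⟨_, ⟨x, ⟨a, ha, a', ha', rfl⟩, b, hb, rfl⟩, _, ⟨y, ⟨c, hc, c', hc', rfl⟩, b', hb', rfl⟩,
      rfl⟩
    refine ⟨(a + c) - (a' + c'), ⟨_, ⟨a, ha, c, hc, rfl⟩, _, ⟨a', ha', c', hc', rfl⟩, rfl⟩,
      b + b', ?_, by dsimp only; abel⟩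
    have := closedBall_add_closedBall_subset (Set.add_mem_add hb hb')
    rwa [← two_mul] at this
  · dsimp only [diffSet]
    rw [add_assoc]
    refine Set.add_subset_add_left (closedBall_add_closedBall_subset.trans ?_)
    rw [← two_mul]

lemma diffSet_bound (η : ℝ) (hη : 0 < η) : ∀ᶠ n in hyp, ∀ x ∈ diffSet δ A n, ‖x‖ ≤ δ n ^ (-η) := by
  obtain ⟨η', hη', h1⟩ := eventually_const_mul_pow_le (δ := δ) 3 1 hη
  filter_upwards [hA.norm_le η' hη', h1, eventually_const_le (δ := δ) 1 hη'] with n h2 h3 h4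
  rintro _ ⟨_, ⟨a, ha, a', ha', rfl⟩, b, hb, rfl⟩
  have hb : ‖b‖ ≤ δ n := by simpa using hb
  have := norm_add_le (a - a') b
  have := norm_sub_le a a'
  have := h2 a ha
  have := h2 a' ha'
  have := hδ.lt_one n
  rw [pow_one] at h3
  dsimp only
  linarith

/-- The covering number of the difference set is comparable to that of `A`. -/
lemma diffSet_cov (η : ℝ) (hη : 0 < η) : ∀ᶠ n in hyp,
    CovBy (δ n ^ (-η) * N n) (diffSet δ A n) (closedBall 0 (δ n)) := by
  obtain ⟨C, hC⟩ := hA.exists_iterated_cov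
  obtain ⟨η', hη', h1⟩ := eventually_const_mul_pow_le (δ := δ) (C * 5 ^ Module.finrank ℝ E) 5 hη
  filter_upwards [h1, hC η' hη'] with n h2 h3
  obtain ⟨a, ha⟩ := hA.nonempty n
  have h4 : CovBy (C * (δ n ^ (-η')) ^ 5 * N n) (A n - A n) (closedBall 0 (δ n)) := by
    refine (h3.translate (-a)).mono le_rfl ?_ subset_rfl
    rintro _ ⟨x, hx, y, hy, rfl⟩
    refine ⟨(x + a + a) - (y + a), ⟨_, ⟨_, ⟨x, hx, a, ha, rfl⟩, a, ha, rfl⟩, _, ⟨y, hy, a, ha, rfl⟩,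
      rfl⟩, ?_⟩
    simp only [vadd_eq_add]; abel
  have h5 := (h4.add (CovBy.of_subset (S := closedBall (0 : E) (δ n)) subset_rfl)).mono le_rfl
    subset_rfl closedBall_add_closedBall_subset
  rw [← two_mul] at h5
  refine (h5.rescale (hδ.pos n) (by norm_num)).mono ?_ subset_rfl subset_rfl
  have := mul_le_mul_of_nonneg_right h2 (hA.pos n).le
  norm_num
  linarith

omit hδ [FiniteDimensional ℝ E] in
lemma le_of_diffSet_cov {n : ℕ} {K : ℝ} (h : CovBy K (diffSet δ A n) (closedBall 0 (δ n)))
    (hδ0 : 0 ≤ δ n) : N n ≤ K := by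
  obtain ⟨a, ha⟩ := hA.nonempty n
  refine (hA.cov n).2 K ((h.translate a).mono le_rfl ?_ subset_rfl)
  intro x hx
  exact ⟨x - a, ⟨x - a, ⟨x, hx, a, ha, rfl⟩, 0, by simpa using hδ0, add_zero _⟩, by simp⟩

end Setup

namespace Good

omit [FiniteDimensional ℝ E] [NormedAlgebra ℝ E] in
lemma comp {f g : ℕ → E →+ E} (hf : Good δ A f) (hg : Good δ A g) :
    Good δ A fun n => (f n).comp (g n) := by
  have := (TCov.image hg f).trans hf
  refine this.mono (Eventually.of_forall fun n => ?_) (Eventually.of_forall fun n => subset_rfl)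
  rintro _ ⟨x, hx, rfl⟩
  exact ⟨_, ⟨x, hx, rfl⟩, rfl⟩

lemma add (hA : Setup δ κ σ A N) {f g : ℕ → E →+ E} (hf : Good δ A f) (hg : Good δ A g) :
    Good δ A fun n => f n + g n := by
  refine ((TCov.add hf hg).mono (Eventually.of_forall fun n => ?_)
    (Eventually.of_forall fun n => subset_rfl)).trans hA.add_cov
  rintro _ ⟨x, hx, rfl⟩
  exact ⟨_, ⟨x, hx, rfl⟩, _, ⟨x, hx, rfl⟩, rfl⟩

omit [FiniteDimensional ℝ E] hδ in
lemma neg {f : ℕ → E →+ E} (hf : Good δ A f) : Good δ A fun n => -f n := by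
  refine (Setup.neg_cov hf).mono (Eventually.of_forall fun n => ?_)
    (Eventually.of_forall fun n => subset_rfl)
  rintro _ ⟨x, hx, rfl⟩
  exact ⟨x, hx, by simp⟩

omit [FiniteDimensional ℝ E] [NormedAlgebra ℝ E] in
lemma id : Good δ A fun _ => AddMonoidHom.id E :=
  TCov.of_subset (Eventually.of_forall fun n => by simp)

omit [FiniteDimensional ℝ E] [NormedAlgebra ℝ E] hδ in
lemma congr {f g : ℕ → E →+ E} (hf : Good δ A f) (h : ∀ᶠ n in hyp, f n = g n) : Good δ A g :=
  TCov.mono hf (by filter_upwards [h] with n hn using by rw [hn])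
    (Eventually.of_forall fun n => subset_rfl)

/-- A map moving `A` well is good. -/
lemma of_image (hA : Setup δ κ σ A N) {f : ℕ → E →+ E} {R : ℕ → ℝ} (hR : Tame δ R)
    (hf : ∀ n x, ‖f n x‖ ≤ R n * ‖x‖) (h : TCov δ (fun n => f n '' A n) (diffSet δ A)) :
    Good δ A f := by
  have h1 := (((TCov.add h (Setup.neg_cov h)).trans hA.add_cov).add
    (hA.ball_cov (R := fun n => |R n|) (hR.of_le (by simp)))).trans hA.add_cov
  refine h1.mono (Eventually.of_forall fun n => ?_) (Eventually.of_forall fun n => subset_rfl)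
  rintro _ ⟨_, ⟨_, ⟨a, ha, a', ha', rfl⟩, b, hb, rfl⟩, rfl⟩
  refine ⟨_, ⟨_, ⟨a, ha, rfl⟩, -f n a', by simpa using ⟨a', ha', rfl⟩, rfl⟩, f n b, ?_, ?_⟩
  · have hb : ‖b‖ ≤ δ n := by simpa using hb
    simp only [mem_closedBall, dist_zero_right]
    calc ‖f n b‖ ≤ R n * ‖b‖ := hf n b
      _ ≤ |R n| * δ n := by
        gcongr
        exact le_abs_self _
  · simp [sub_eq_add_neg]

/-- Inverses of good maps are good, provided they are tame. -/
lemma inv (hA : Setup δ κ σ A N) {f g : ℕ → E →+ E} (hf : Good δ A f) {R : ℕ → ℝ} (hR : Tame δ R)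
    (hg : ∀ᶠ n in hyp, ∀ x, ‖g n x‖ ≤ R n * ‖x‖) (hgf : ∀ᶠ n in hyp, ∀ x, g n (f n x) = x) :
    Good δ A g := by
  set d := Module.finrank ℝ E
  have hRη : ∀ η : ℝ, 0 < η → ∀ᶠ n in hyp, (1 + 2 * |R n|) ^ d ≤ δ n ^ (-η) := by
    intro η hη
    have : Tame δ (fun n => (1 + 2 * |R n|) ^ d) :=
      ((tame_const (1 : ℝ)).add ((tame_const (2 : ℝ)).mul (hR.of_le (by simp)))).pow d
    filter_upwards [this η hη] with n hn using (le_abs_self _).trans hn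
  have key : TCov δ (fun n => g n '' diffSet δ A n)
      (fun n => (diffSet δ A n + diffSet δ A n) + closedBall 0 (|R n| * δ n)) := by
    refine TCov.of_forall (2 * 9 ^ d * 9 ^ d) 4 fun η hη => ?_
    filter_upwards [hf η hη, hg, hgf, hRη η hη, hA.diffSet_bound 1 one_pos,
      hA.add_cov η hη, hA.diffSet_cov η hη]
      with n h1 h2 h3 h4 h5 h6 h7
    obtain ⟨X, hX, hsub⟩ := h1
    have hδn := hδ.pos n
    set q := δ n ^ (-η) with hq
    have hq0 : 0 < q := Real.rpow_pos_of_pos hδn _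
    have hR1 : 0 < (1 + 2 * |R n|) ^ d := by positivity
    let D : E → Set E := fun x => {h | h ∈ diffSet δ A n ∧ f n h ∈ (x +ᵥ diffSet δ A n : Set E)}
    set L := N n / (q * q * 2) with hL
    have hNpos := hA.pos n
    have hLpos : 0 < L := by positivity
    obtain ⟨x, hx⟩ : ∃ x, ∀ K', CovBy K' (f n '' D x) (closedBall 0 (δ n)) → L ≤ K' := by
      by_contra! hcon
      choose K hK hKL using hcon
      have hDx : ∀ x, CovBy (L * (1 + 2 * |R n|) ^ d) (D x) (closedBall 0 (δ n)) := by
        intro x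
        have e1 := ((hK x).mono (hKL x).le subset_rfl subset_rfl).image (g n)
        refine (e1.mono le_rfl ?_ ?_).rescale (r := |R n|) hδn (abs_nonneg _)
        · intro y hy
          exact ⟨f n y, ⟨y, hy, rfl⟩, h3 y⟩
        · rintro _ ⟨b, hb, rfl⟩
          have hb : ‖b‖ ≤ δ n := by simpa using hb
          simp only [mem_closedBall, dist_zero_right]
          calc ‖g n b‖ ≤ R n * ‖b‖ := h2 b
            _ ≤ |R n| * δ n := by
              gcongr
              exact le_abs_self _
      classical
      choose Y hY hYc using hDx
      have hcovH : CovBy (q * L * (1 + 2 * |R n|) ^ d) (diffSet δ A n) (closedBall 0 (δ n)) := by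
        refine ⟨X.biUnion Y, ?_, ?_⟩
        · calc ((X.biUnion Y).card : ℝ) ≤ ∑ x ∈ X, ((Y x).card : ℝ) := by
                exact_mod_cast Finset.card_biUnion_le
            _ ≤ ∑ x ∈ X, L * (1 + 2 * |R n|) ^ d := Finset.sum_le_sum fun x _ => hY x
            _ = X.card * (L * (1 + 2 * |R n|) ^ d) := by rw [Finset.sum_const, nsmul_eq_mul]
            _ ≤ q * (L * (1 + 2 * |R n|) ^ d) := by gcongr
            _ = _ := by ring
        · intro h hh
          obtain ⟨x, hx, z, hz, hxz⟩ := hsub ⟨h, hh, rfl⟩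
          obtain ⟨y, hy, b, hb, rfl⟩ := hYc x ⟨hh, ⟨z, hz, hxz⟩⟩
          exact ⟨y, by simpa using ⟨x, hx, hy⟩, b, hb, rfl⟩
      have e2 := hA.le_of_diffSet_cov hcovH hδn.le
      have e3 : q * L * (1 + 2 * |R n|) ^ d ≤ q * L * q := by gcongr
      have e4 : q * L * q = N n / 2 := by rw [hL]; field_simp
      linarith
    have hDH : f n '' D x + diffSet δ A n ⊆ (x +ᵥ (diffSet δ A n + diffSet δ A n) : Set E) := by
      rintro _ ⟨_, ⟨h, hh, rfl⟩, z, hz, rfl⟩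
      obtain ⟨y, hy, hyx⟩ := hh.2
      exact ⟨y + z, ⟨y, hy, z, hz, rfl⟩, by simp only [vadd_eq_add, ← hyx, add_assoc]⟩
    have hbound : ∀ a ∈ f n '' D x, ‖a‖ ≤ ‖x‖ + δ n ^ (-1 : ℝ) := by
      rintro _ ⟨h, hh, rfl⟩
      obtain ⟨y, hy, hyx⟩ := hh.2
      rw [← hyx]
      exact (norm_add_le _ _).trans (by have := h5 y hy; linarith)
    have hcov := ((h6.trans h7).translate x).mono le_rfl hDH subset_rfl
    have hR0 : 0 ≤ ‖x‖ + δ n ^ (-1 : ℝ) :=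
      add_nonneg (norm_nonneg _) (Real.rpow_nonneg hδn.le _)
    have e5 := (ruzsa_covering hδn hR0 hbound hcov hLpos hx).image (g n)
    refine e5.mono (le_of_eq ?_) subset_rfl ?_
    · rw [hL]; field_simp; rfl
    · rintro _ ⟨_, ⟨_, ⟨_, ⟨h, hh, rfl⟩, _, ⟨h', hh', rfl⟩, rfl⟩, b, hb, rfl⟩, rfl⟩
      refine ⟨h - h', ⟨h, hh.1, -h', ?_, (sub_eq_add_neg _ _).symm⟩, g n b, ?_, ?_⟩
      · rw [← Setup.neg_diffSet]; simpa using hh'.1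
      · have hb : ‖b‖ ≤ δ n := by simpa using hb
        simp only [mem_closedBall, dist_zero_right]
        calc ‖g n b‖ ≤ R n * ‖b‖ := h2 b
          _ ≤ |R n| * δ n := by
            gcongr
            exact le_abs_self _
      · simp [h3]
  refine key.trans ?_
  exact ((hA.add_cov.add (hA.ball_cov (hR.of_le (x := fun n => |R n|) (by simp)))).trans hA.add_cov)

end Good

namespace IsGood

lemma mul {x y : ℕ → E} (hx : IsGood δ A x) (hy : IsGood δ A y) :
    IsGood δ A fun n => x n * y n :=
  ⟨hx.tame.mul hy.tame,
    (hx.left.comp hy.left).congr (Eventually.of_forall fun n => by ext; simp [mul_assoc]),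
    (hy.right.comp hx.right).congr (Eventually.of_forall fun n => by ext; simp [mul_assoc])⟩

lemma neg {x : ℕ → E} (hx : IsGood δ A x) : IsGood δ A fun n => -x n :=
  ⟨hx.tame.neg,
    hx.left.neg.congr (Eventually.of_forall fun n => by ext; simp),
    hx.right.neg.congr (Eventually.of_forall fun n => by ext; simp)⟩

lemma one : IsGood δ A fun _ => (1 : E) :=
  ⟨tame_const 1, Good.id.congr (Eventually.of_forall fun n => by ext; simp),
    Good.id.congr (Eventually.of_forall fun n => by ext; simp)⟩

section

variable (hA : Setup δ κ σ A N)
include hA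

lemma add {x y : ℕ → E} (hx : IsGood δ A x) (hy : IsGood δ A y) :
    IsGood δ A fun n => x n + y n :=
  ⟨hx.tame.add hy.tame,
    (hx.left.add hA hy.left).congr (Eventually.of_forall fun n => by ext; simp [add_mul]),
    (hx.right.add hA hy.right).congr (Eventually.of_forall fun n => by ext; simp [mul_add])⟩

lemma sub {x y : ℕ → E} (hx : IsGood δ A x) (hy : IsGood δ A y) :
    IsGood δ A fun n => x n - y n := by
  simpa [sub_eq_add_neg] using hx.add hA hy.neg

/-- Sequences of size `O(δ)` are good. -/
lemma of_norm_le {x : ℕ → E} (hx : ∀ᶠ n in hyp, ‖x n‖ ≤ δ n) : IsGood δ A x := by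
  have ht : Tame δ x := tame_of_bounded 1 (by
    filter_upwards [hx] with n hn using hn.trans (hδ.lt_one n).le)
  have hb : ∀ η : ℝ, 0 < η → ∀ᶠ n in hyp, ∀ y ∈ diffSet δ A n, ‖y‖ ≤ δ n ^ (-η) :=
    fun η hη => hA.diffSet_bound η hη
  have hcov : ∀ f : ℕ → E →+ E, (∀ n y, ‖f n y‖ ≤ ‖x n‖ * ‖y‖) → Good δ A f := by
    intro f hf η hη
    obtain ⟨η', hη', h1⟩ := eventually_const_mul_pow_le (δ := δ)
      (5 ^ Module.finrank ℝ E) (Module.finrank ℝ E) hη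
    filter_upwards [hx, hb η' hη', h1, eventually_const_le (δ := δ) 1 hη'] with n h2 h3 h4 h5
    have hδn := hδ.pos n
    have e := (covBy_closedBall (V := E) (R := δ n ^ (-η') * δ n) hδn (by positivity)).mono le_rfl
      (S' := f n '' diffSet δ A n) ?_ (hA.ball_subset n)
    · refine e.mono (le_trans ?_ h4) subset_rfl subset_rfl
      rw [← mul_pow]
      gcongr
      have : 2 * (δ n ^ (-η') * δ n) / δ n = 2 * δ n ^ (-η') := by field_simp
      linarith
    · rintro _ ⟨y, hy, rfl⟩
      simp only [mem_closedBall, dist_zero_right]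
      calc ‖f n y‖ ≤ ‖x n‖ * ‖y‖ := hf n y
        _ ≤ δ n * δ n ^ (-η') := by gcongr; exact h3 y hy
        _ = _ := mul_comm _ _
  exact ⟨ht, hcov _ fun n y => norm_mul_le _ _, hcov _ fun n y => by
    simpa [mul_comm] using norm_mul_le y (x n)⟩

lemma zero : IsGood δ A fun _ => (0 : E) :=
  of_norm_le hA (Eventually.of_forall fun n => by simpa using (hδ.pos n).le)

lemma sum {ι : Type*} (s : Finset ι) {x : ι → ℕ → E} (hx : ∀ i ∈ s, IsGood δ A (x i)) :
    IsGood δ A fun n => ∑ i ∈ s, x i n := by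
  classical
  induction s using Finset.induction_on with
  | empty => simpa using zero hA
  | insert a s ha ih =>
    simp only [Finset.sum_insert ha]
    exact (hx a (by simp)).add hA (ih fun i hi => hx i (by simp [hi]))

lemma natCast_smul (k : ℕ) {x : ℕ → E} (hx : IsGood δ A x) : IsGood δ A fun n => (k : ℝ) • x n := by
  induction k with
  | zero => simpa using zero hA
  | succ k ih => simpa [add_smul] using ih.add hA hx

lemma of_mem {a : ℕ → E} (ha : ∀ᶠ n in hyp, a n ∈ A n) : IsGood δ A a := by
  have ht : Tame δ a := fun η hη => by
    filter_upwards [ha, hA.norm_le η hη] with n h1 h2 using h2 _ h1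
  have ht' : Tame δ fun n => ‖a n‖ := ht.of_le (by simp)
  have hl : TCov δ (fun n => AddMonoidHom.mulLeft (a n) '' A n) (diffSet δ A) := by
    refine hA.ruzsa 1 1 fun η hη => ?_
    filter_upwards [ha, hA.mul η hη] with n h1 h2
    rw [pow_one, one_mul]
    refine h2.mono le_rfl (Set.add_subset_add_left ?_) subset_rfl
    rintro _ ⟨x, hx, rfl⟩
    exact ⟨_, h1, x, hx, rfl⟩
  have hr : TCov δ (fun n => AddMonoidHom.mulRight (a n) '' A n) (diffSet δ A) := by
    refine hA.ruzsa 1 1 fun η hη => ?_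
    filter_upwards [ha, hA.mul η hη] with n h1 h2
    rw [pow_one, one_mul]
    refine h2.mono le_rfl (Set.add_subset_add_left ?_) subset_rfl
    rintro _ ⟨x, hx, rfl⟩
    exact ⟨x, hx, _, h1, rfl⟩
  exact ⟨ht, .of_image hA ht' (fun n x => norm_mul_le _ _) hl,
    .of_image hA ht' (fun n x => by simpa [mul_comm] using norm_mul_le x (a n)) hr⟩

lemma inv {x y : ℕ → E} (hx : IsGood δ A x) (hy : Tame δ y)
    (hxy : ∀ᶠ n in hyp, x n * y n = 1) (hyx : ∀ᶠ n in hyp, y n * x n = 1) : IsGood δ A y :=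
  ⟨hy, hx.left.inv hA (R := fun n => ‖y n‖) (hy.of_le (by simp))
      (Eventually.of_forall fun n z => norm_mul_le _ _)
      (by filter_upwards [hyx] with n hn z; simp [← mul_assoc, hn]),
    hx.right.inv hA (R := fun n => ‖y n‖) (hy.of_le (by simp))
      (Eventually.of_forall fun n z => by simpa [mul_comm] using norm_mul_le z (y n))
      (by filter_upwards [hxy] with n hn z; simp [mul_assoc, hn])⟩

end

end IsGood

end

end SumProduct

namespace SumProduct

open Filter Topology Pointwise Metric Polynomial

section Hyper

open Hyperreal

lemma ofSeq_eq_iff {x y : ℕ → ℝ} : ofSeq x = ofSeq y ↔ ∀ᶠ n in hyp, x n = y n := Germ.coe_eq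

lemma ofSeq_add (x y : ℕ → ℝ) : ofSeq (fun n => x n + y n) = ofSeq x + ofSeq y := rfl

lemma ofSeq_mul (x y : ℕ → ℝ) : ofSeq (fun n => x n * y n) = ofSeq x * ofSeq y := rfl

lemma ofSeq_sub (x y : ℕ → ℝ) : ofSeq (fun n => x n - y n) = ofSeq x - ofSeq y := rfl

lemma ofSeq_neg (x : ℕ → ℝ) : ofSeq (fun n => -x n) = -ofSeq x := rfl

lemma ofSeq_const (x : ℝ) : ofSeq (fun _ => x) = (x : ℝ*) := rfl

lemma ofSeq_zero : ofSeq (fun _ => 0) = 0 := rfl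

lemma ofSeq_one : ofSeq (fun _ => 1) = 1 := rfl

lemma ofSeq_inv (x : ℕ → ℝ) : ofSeq (fun n => (x n)⁻¹) = (ofSeq x)⁻¹ := rfl

lemma ofSeq_sum {ι : Type*} (s : Finset ι) (x : ι → ℕ → ℝ) :
    ofSeq (fun n => ∑ i ∈ s, x i n) = ∑ i ∈ s, ofSeq (x i) := by
  classical
  induction s using Finset.induction_on with
  | empty => simp [ofSeq_zero]
  | insert a s ha ih => simp only [Finset.sum_insert ha, ofSeq_add, ih]

lemma exists_eval_ofSeq (p : ℝ*[X]) :
    ∃ P : ℕ → ℝ[X], ∀ x, p.eval (ofSeq x) = ofSeq fun n => (P n).eval (x n) := by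
  induction p using Polynomial.induction_on' with
  | add p q hp hq =>
    obtain ⟨P, hP⟩ := hp
    obtain ⟨Q, hQ⟩ := hq
    exact ⟨fun n => P n + Q n, fun x => by simp [hP, hQ, ofSeq_add]⟩
  | monomial k a =>
    obtain ⟨a, rfl⟩ := ofSeq_surjective a
    refine ⟨fun n => monomial k (a n), fun x => ?_⟩
    simp only [eval_monomial]
    rfl

lemma exists_isRoot_of_nonpos_of_nonneg (p : ℝ*[X]) {a b : ℝ*} (hab : a ≤ b)
    (ha : p.eval a ≤ 0) (hb : 0 ≤ p.eval b) : ∃ y, a ≤ y ∧ y ≤ b ∧ p.eval y = 0 := by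
  obtain ⟨P, hP⟩ := exists_eval_ofSeq p
  obtain ⟨a, rfl⟩ := ofSeq_surjective a
  obtain ⟨b, rfl⟩ := ofSeq_surjective b
  rw [hP, ← ofSeq_zero, ofSeq_le_ofSeq] at ha hb
  rw [ofSeq_le_ofSeq] at hab
  have h : ∀ᶠ n in hyp, ∃ y, a n ≤ y ∧ y ≤ b n ∧ (P n).eval y = 0 := by
    filter_upwards [ha, hb, hab] with n h1 h2 h3
    obtain ⟨y, hy, hy'⟩ := intermediate_value_Icc h3 (P n).continuous.continuousOn ⟨h1, h2⟩
    exact ⟨y, hy.1, hy.2, hy'⟩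
  obtain ⟨y, hy⟩ := h.choice
  refine ⟨ofSeq y, ofSeq_le_ofSeq.2 (hy.mono fun n h => h.1),
    ofSeq_le_ofSeq.2 (hy.mono fun n h => h.2.1), ?_⟩
  rw [hP, ← ofSeq_zero, ofSeq_eq_iff]
  exact hy.mono fun n h => h.2.2

lemma exists_isRoot_of_nonneg_of_nonpos (p : ℝ*[X]) {a b : ℝ*} (hab : a ≤ b)
    (ha : 0 ≤ p.eval a) (hb : p.eval b ≤ 0) : ∃ y, a ≤ y ∧ y ≤ b ∧ p.eval y = 0 := by
  obtain ⟨y, h1, h2, h3⟩ := exists_isRoot_of_nonpos_of_nonneg (-p) hab (by simpa) (by simpa)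
  exact ⟨y, h1, h2, by simpa using h3⟩

variable (δ : ℕ → ℝ) [hδ : IsScale δ]

/-- Hyperreals represented by tame sequences. -/
def tameRing : Subring ℝ* where
  carrier := {g | ∃ x, ofSeq x = g ∧ Tame δ x}
  mul_mem' := by
    rintro _ _ ⟨x, rfl, hx⟩ ⟨y, rfl, hy⟩
    exact ⟨_, ofSeq_mul x y, hx.mul hy⟩
  one_mem' := ⟨_, ofSeq_one, tame_const 1⟩
  add_mem' := by
    rintro _ _ ⟨x, rfl, hx⟩ ⟨y, rfl, hy⟩
    exact ⟨_, ofSeq_add x y, hx.add hy⟩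
  zero_mem' := ⟨_, ofSeq_zero, tame_const 0⟩
  neg_mem' := by
    rintro _ ⟨x, rfl, hx⟩
    exact ⟨_, ofSeq_neg x, hx.neg⟩

/-- Hyperreals represented by small sequences, as an ideal of the tame ones. -/
def smallIdeal : Ideal (tameRing δ) where
  carrier := {g | ∃ x, ofSeq x = (g : ℝ*) ∧ Small δ x}
  add_mem' := by
    rintro _ _ ⟨x, hx', hx⟩ ⟨y, hy', hy⟩
    exact ⟨_, by rw [ofSeq_add x y, hx', hy']; rfl, hx.add hy⟩
  zero_mem' := ⟨_, ofSeq_zero, small_zero⟩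
  smul_mem' := by
    rintro ⟨_, x, rfl, hx⟩ _ ⟨y, hy', hy⟩
    exact ⟨_, by rw [ofSeq_mul x y, hy']; rfl, hx.mul_small hy⟩

variable {δ}

omit hδ in
lemma Tame.congr {X : Type*} [Norm X] {x y : ℕ → X} (hx : Tame δ x) (h : ∀ᶠ n in hyp, y n = x n) :
    Tame δ y := hx.of_le (h.mono fun n hn => by rw [hn])

omit hδ in
lemma Small.congr {X : Type*} [Norm X] {x y : ℕ → X} (hx : Small δ x)
    (h : ∀ᶠ n in hyp, y n = x n) : Small δ y := hx.of_le (h.mono fun n hn => by rw [hn])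

lemma mem_tameRing {x : ℕ → ℝ} : ofSeq x ∈ tameRing δ ↔ Tame δ x := by
  refine ⟨?_, fun h => ⟨x, rfl, h⟩⟩
  rintro ⟨y, hy, h⟩
  exact h.congr (ofSeq_eq_iff.1 hy.symm)

lemma mem_smallIdeal {x : ℕ → ℝ} (hx : ofSeq x ∈ tameRing δ) :
    (⟨ofSeq x, hx⟩ : tameRing δ) ∈ smallIdeal δ ↔ Small δ x := by
  refine ⟨?_, fun h => ⟨x, rfl, h⟩⟩
  rintro ⟨y, hy, h⟩
  exact h.congr (ofSeq_eq_iff.1 hy.symm)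

lemma coe_mem_tameRing (x : ℝ) : (x : ℝ*) ∈ tameRing δ := ⟨_, ofSeq_const x, tame_const x⟩

lemma inv_mem_tameRing {g : tameRing δ} (hg : g ∉ smallIdeal δ) : (g : ℝ*)⁻¹ ∈ tameRing δ := by
  obtain ⟨g, hgO⟩ := g
  obtain ⟨x, rfl⟩ := ofSeq_surjective g
  rw [mem_smallIdeal] at hg
  refine ⟨_, ofSeq_inv x, (tame_inv_of_not_small hg).of_le (Eventually.of_forall fun n => ?_)⟩
  simp

lemma one_notMem_smallIdeal : (1 : tameRing δ) ∉ smallIdeal δ := by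
  intro h
  have h1 : ofSeq (fun _ => 1) ∈ tameRing δ := mem_tameRing.2 (tame_const 1)
  exact not_small_const one_ne_zero ((mem_smallIdeal h1).1 h)

lemma notMem_smallIdeal_of_mul_eq_one {g h : tameRing δ} (hgh : g * h = 1) :
    g ∉ smallIdeal δ := fun hg =>
  one_notMem_smallIdeal (hgh ▸ (smallIdeal δ).mul_mem_right h hg)

/-- Approximate simple roots of tame polynomials are close to roots. -/
lemma exists_isRoot_of_eval_mem (q : (tameRing δ)[X]) (x : tameRing δ)
    (h0 : q.eval x ∈ smallIdeal δ) (h1 : q.derivative.eval x ∉ smallIdeal δ) :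
    ∃ y : tameRing δ, q.eval y = 0 ∧ y - x ∈ smallIdeal δ := by
  set p : ℝ*[X] := q.map (tameRing δ).subtype with hp
  obtain ⟨u, hu, c, hc, hc'⟩ := h0
  set d : ℝ* := ((q.derivative.eval x : tameRing δ) : ℝ*) with hd
  obtain ⟨e, he, hde⟩ : ∃ e ∈ tameRing δ, d * e = 1 :=
    ⟨_, inv_mem_tameRing h1, mul_inv_cancel₀ fun h => h1 (by
      have : q.derivative.eval x = 0 := Subtype.ext h
      rw [this]; exact zero_mem _)⟩
  set s : ℝ* := ofSeq fun n => δ n ^ (c / 2) with hs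
  have hs_small : ∀ n, ‖δ n ^ (c / 2)‖ = δ n ^ (c / 2) := fun n =>
    Real.norm_of_nonneg (Real.rpow_nonneg (hδ.pos n).le _)
  have hs_mem : Small δ fun n => δ n ^ (c / 2) :=
    ⟨c / 2, by positivity, Eventually.of_forall fun n => (hs_small n).le⟩
  have hs0 : 0 < s := by
    rw [hs, ← ofSeq_zero, ofSeq_lt_ofSeq]
    exact Eventually.of_forall fun n => Real.rpow_pos_of_pos (hδ.pos n) _
  have hsO : s ∈ tameRing δ := mem_tameRing.2 hs_mem.tame
  have hus : |ofSeq u| ≤ s * s := by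
    rw [abs_le, hs, ← ofSeq_mul, ← ofSeq_neg, ofSeq_le_ofSeq, ofSeq_le_ofSeq]
    have : ∀ n, δ n ^ (c / 2) * δ n ^ (c / 2) = δ n ^ c := fun n => by
      rw [← Real.rpow_add (hδ.pos n), add_halves]
    constructor <;> filter_upwards [hc'] with n hn <;> rw [this] <;>
      [exact neg_le_of_abs_le hn; exact le_of_abs_le hn]
  -- values at nearby points
  have key : ∀ t : tameRing δ, |(t : ℝ*)| = s →
      |p.eval ((x : ℝ*) + t) - d * t| < |d| * s := by
    intro t ht
    have h2 := (Polynomial.binomExpansion q x t).2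
    set k : tameRing δ := (Polynomial.binomExpansion q x t).1
    have h3 : p.eval ((x : ℝ*) + t) = q.eval (x + t) := by
      rw [hp]; exact (Polynomial.eval_map_apply (tameRing δ).subtype (x + t))
    have h4 : p.eval ((x : ℝ*) + t) = ofSeq u + d * t + k * t ^ 2 := by
      rw [h3, h2, hu]; rfl
    rw [h4]
    have h5 : |ofSeq u + d * t + k * t ^ 2 - d * t| ≤ s * s + |(k : ℝ*)| * (s * s) := by
      have : ofSeq u + d * t + k * t ^ 2 - d * t = ofSeq u + k * (t * t) := by ring
      rw [this]
      refine (abs_add_le _ _).trans (add_le_add hus ?_)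
      rw [abs_mul, abs_mul, ht]
    refine h5.trans_lt ?_
    -- `(1 + |k|) s |e| < 1`
    have h6 : (1 + |(k : ℝ*)|) * s * |e| < 1 := by
      obtain ⟨k', hk', hk⟩ := k.2
      obtain ⟨e', rfl, he'⟩ := he
      have hsm : Small δ fun n => (1 + |k' n|) * δ n ^ (c / 2) * |e' n| := by
        have ha : Tame δ fun n => 1 + |k' n| :=
          (tame_const (1 : ℝ)).add (hk.of_le (Eventually.of_forall fun n => by simp))
        exact (ha.mul_small hs_mem).mul_tame (he'.of_le (Eventually.of_forall fun n => by simp))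
      obtain ⟨c₂, hc₂, hev⟩ := hsm
      rw [← hk', hs]
      change ofSeq (fun n => (1 + |k' n|) * δ n ^ (c / 2) * |e' n|) < ofSeq fun _ => 1
      rw [ofSeq_lt_ofSeq]
      filter_upwards [hev] with n hn
      exact (le_abs_self _).trans_lt (hn.trans_lt
        (Real.rpow_lt_one (hδ.pos n).le (hδ.lt_one n) hc₂))
    have h7 : |d| * |e| = 1 := by rw [← abs_mul, hde, abs_one]
    have he0 : 0 < |e| := by
      rcases (abs_nonneg e).eq_or_lt with h | h
      · rw [← h, mul_zero] at h7; exact absurd h7 zero_ne_one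
      · exact h
    have : (s * s + |(k : ℝ*)| * (s * s)) * |e| < |d| * s * |e| := by
      calc (s * s + |(k : ℝ*)| * (s * s)) * |e| = ((1 + |(k : ℝ*)|) * s * |e|) * s := by ring
        _ < 1 * s := by gcongr
        _ = |d| * s * |e| := by rw [← h7]; ring
    exact lt_of_mul_lt_mul_right this he0.le
  have kp := key ⟨s, hsO⟩ (abs_of_pos hs0)
  have km := key (-⟨s, hsO⟩) (by change |-s| = s; rw [abs_neg, abs_of_pos hs0])
  change |p.eval ((x : ℝ*) + s) - d * s| < |d| * s at kp
  change |p.eval ((x : ℝ*) + -s) - d * -s| < |d| * s at km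
  rw [abs_lt] at kp km
  have hle : (x : ℝ*) + -s ≤ x + s := by linarith
  obtain ⟨y, hy1, hy2, hy3⟩ : ∃ y, (x : ℝ*) + -s ≤ y ∧ y ≤ x + s ∧ p.eval y = 0 := by
    rcases le_total 0 d with h | h
    · rw [abs_of_nonneg h] at kp km
      exact exists_isRoot_of_nonpos_of_nonneg p hle (by linarith [km.2]) (by linarith [kp.1])
    · rw [abs_of_nonpos h] at kp km
      exact exists_isRoot_of_nonneg_of_nonpos p hle (by linarith [km.1]) (by linarith [kp.2])
  have hyx : ∃ z, ofSeq z = y - x ∧ Small δ z := by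
    obtain ⟨z, hz⟩ := ofSeq_surjective (y - x)
    refine ⟨z, hz, hs_mem.of_le ?_⟩
    have h1 : ofSeq z ≤ s := by rw [hz]; linarith
    have h2 : -s ≤ ofSeq z := by rw [hz]; linarith
    rw [hs, ofSeq_le_ofSeq] at h1
    rw [hs, ← ofSeq_neg, ofSeq_le_ofSeq] at h2
    filter_upwards [h1, h2] with n h3 h4
    rw [hs_small]
    exact abs_le.2 ⟨h4, h3⟩
  obtain ⟨z, hz, hzs⟩ := hyx
  have hyO : y ∈ tameRing δ := by
    have : y = ofSeq z + x := by rw [hz]; ring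
    rw [this]
    exact add_mem (mem_tameRing.2 hzs.tame) x.2
  refine ⟨⟨y, hyO⟩, Subtype.ext ?_, z, hz, hzs⟩
  refine Eq.trans ?_ hy3
  rw [hp]
  exact (Polynomial.eval_map_apply (tameRing δ).subtype (⟨y, hyO⟩ : tameRing δ)).symm

end Hyper

end SumProduct

namespace SumProduct

open Filter Topology Pointwise Metric Polynomial Hyperreal

section CoefficientField

variable {δ : ℕ → ℝ} [hδ : IsScale δ]

/-- The inclusion of a subfield of tame hyperreals in the ring of all of them. -/
noncomputable def tameInclusion (L : Subfield ℝ*) (hL : ∀ l ∈ L, l ∈ tameRing δ) : L →+* tameRing δ :=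
  (L.subtype).codRestrict (tameRing δ) fun l => hL l l.2

lemma aeval_coe_eq (L : Subfield ℝ*) (hL : ∀ l ∈ L, l ∈ tameRing δ) (q : L[X])
    (x : tameRing δ) : aeval (x : ℝ*) q = ((q.map (tameInclusion L hL)).eval x : tameRing δ) := by
  rw [eval_map, aeval_def]
  exact (hom_eval₂ q (tameInclusion L hL) (tameRing δ).subtype x).symm

lemma exists_maximal_subfield : ∃ L : Subfield ℝ*, Maximal
    (fun L : Subfield ℝ* => coeRingHom.toRingHom.fieldRange ≤ L ∧ ∀ l ∈ L, l ∈ tameRing δ) L := by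
  have key := zorn_le_nonempty₀
    {L : Subfield ℝ* | coeRingHom.toRingHom.fieldRange ≤ L ∧ ∀ l ∈ L, l ∈ tameRing δ}
    (fun c hc hchain y hy => ⟨sSup c, ⟨(hc hy).1.trans (le_sSup hy), fun l hl => by
      obtain ⟨z, hz, hlz⟩ := (Subfield.mem_sSup_of_directedOn ⟨y, hy⟩ hchain.directedOn).1 hl
      exact (hc hz).2 l hlz⟩, fun z hz => le_sSup hz⟩)
    coeRingHom.toRingHom.fieldRange ⟨le_rfl, by
      rintro _ ⟨r, rfl⟩
      exact coe_mem_tameRing r⟩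
  obtain ⟨L, -, hL⟩ := key
  exact ⟨L, hL⟩

variable (δ) in
/-- The ring of tame hyperreals modulo small ones has a field of representatives containing the
real numbers. -/
theorem exists_coefficientField : ∃ L : Subfield ℝ*, (∀ r : ℝ, (r : ℝ*) ∈ L) ∧
    (∀ l ∈ L, l ∈ tameRing δ) ∧
    ∀ x ∈ tameRing δ, ∃ l ∈ L, ∃ s, ofSeq s = x - l ∧ Small δ s := by
  obtain ⟨L, hmax⟩ := exists_maximal_subfield (δ := δ)
  obtain ⟨hR, hL⟩ := hmax.prop
  refine ⟨L, fun r => hR ⟨r, rfl⟩, hL, fun x hx => ?_⟩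
  have hadj : ∀ y, (∀ z ∈ IntermediateField.adjoin L {y}, z ∈ tameRing δ) → y ∈ L := by
    intro y hy
    have hle : L ≤ (IntermediateField.adjoin L {y}).toSubfield := fun l hl =>
      (IntermediateField.adjoin L {y}).algebraMap_mem ⟨l, hl⟩
    exact hmax.2 (y := (IntermediateField.adjoin L {y}).toSubfield) ⟨hR.trans hle, hy⟩ hle
      (IntermediateField.mem_adjoin_simple_self L y)
  set ι := tameInclusion L hL
  have hnz : ∀ l : L, l ≠ 0 → ι l ∉ smallIdeal δ := fun l hl =>
    notMem_smallIdeal_of_mul_eq_one (h := ι l⁻¹) (by rw [← map_mul, mul_inv_cancel₀ hl, map_one])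
  let X : tameRing δ := ⟨x, hx⟩
  by_cases hq : ∃ q : L[X], q ≠ 0 ∧ (q.map ι).eval X ∈ smallIdeal δ
  · obtain ⟨q, ⟨hq0, hq⟩, hmin⟩ := WellFounded.has_min
      (InvImage.wf (fun q : L[X] => q.natDegree) Nat.lt_wfRel.wf)
      {q : L[X] | q ≠ 0 ∧ (q.map ι).eval X ∈ smallIdeal δ} hq
    have hdeg : q.natDegree ≠ 0 := by
      intro h
      rw [natDegree_eq_zero] at h
      obtain ⟨c, rfl⟩ := h
      rw [map_C, eval_C] at hq
      exact hnz c (fun h => hq0 (by rw [h, C_0])) hq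
    have hder : (q.map ι).derivative.eval X ∉ smallIdeal δ := by
      intro h
      rw [derivative_map] at h
      refine hmin q.derivative ⟨fun h0 => hdeg (derivative_eq_zero.1 h0), h⟩ ?_
      exact natDegree_derivative_lt hdeg
    obtain ⟨y, hy0, s, hs, hsmall⟩ := exists_isRoot_of_eval_mem (q.map ι) X hq hder
    refine ⟨y, hadj y ?_, fun n => -s n, ?_, hsmall.neg⟩
    · have halg : IsAlgebraic L (y : ℝ*) := ⟨q, hq0, by rw [aeval_coe_eq L hL, hy0]; rfl⟩
      intro z hz
      rw [← IntermediateField.mem_toSubalgebra,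
        IntermediateField.adjoin_simple_toSubalgebra_of_isAlgebraic halg,
        Algebra.adjoin_singleton_eq_range_aeval] at hz
      obtain ⟨r, rfl⟩ := hz
      change aeval (y : ℝ*) r ∈ tameRing δ
      rw [aeval_coe_eq L hL]
      exact Subtype.prop _
    · rw [ofSeq_neg, hs]
      change -((y : ℝ*) - x) = _
      ring
  · push Not at hq
    refine ⟨x, hadj x fun z hz => ?_, fun _ => 0, by rw [sub_self, ofSeq_zero], small_zero⟩
    obtain ⟨r, s, rfl⟩ := (IntermediateField.mem_adjoin_simple_iff L z).1 hz
    rcases eq_or_ne s 0 with rfl | hs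
    · simp
    · rw [aeval_coe_eq L hL r X, aeval_coe_eq L hL s X, div_eq_mul_inv]
      exact mul_mem (Subtype.prop _) (inv_mem_tameRing (hq s hs))

end CoefficientField

end SumProduct

namespace SumProduct

open Filter Topology Pointwise Metric Hyperreal

set_option linter.unusedSectionVars false

section Coordinates

variable {E : Type*} [NormedRing E] [NormedAlgebra ℝ E] [FiniteDimensional ℝ E]
  {δ : ℕ → ℝ} [hδ : IsScale δ] {ι : Type*} [Fintype ι]

lemma repr_mul_apply (b : Module.Basis ι ℝ E) (x y : E) (k : ι) :
    b.repr (x * y) k = ∑ i, ∑ j, b.repr x i * b.repr y j * b.repr (b i * b j) k := by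
  conv_lhs => rw [← b.sum_repr x, ← b.sum_repr y]
  simp only [Finset.sum_mul_sum, smul_mul_smul_comm, map_sum, map_smul, Finsupp.coe_finsetSum,
    Finset.sum_apply, Finsupp.smul_apply, smul_eq_mul]

lemma exists_abs_repr_le (b : Module.Basis ι ℝ E) :
    ∃ C : ℝ, 0 ≤ C ∧ ∀ x i, |b.repr x i| ≤ C * ‖x‖ := by
  refine ⟨∑ i, ‖LinearMap.toContinuousLinearMap (b.coord i)‖,
    Finset.sum_nonneg fun _ _ => norm_nonneg _, fun x i => ?_⟩
  refine ((LinearMap.toContinuousLinearMap (b.coord i)).le_opNorm x).trans ?_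
  gcongr
  exact Finset.single_le_sum (f := fun i => ‖LinearMap.toContinuousLinearMap (b.coord i)‖)
    (fun _ _ => norm_nonneg _) (Finset.mem_univ i)

lemma Tame.repr {x : ℕ → E} (hx : Tame δ x) (b : Module.Basis ι ℝ E) (i : ι) :
    Tame δ fun n => b.repr (x n) i := by
  obtain ⟨C, hC, h⟩ := exists_abs_repr_le b
  refine ((tame_const C).mul (x := fun _ => C) (y := fun n => ‖x n‖)
    (hx.of_le (Eventually.of_forall fun n => by simp))).of_le (Eventually.of_forall fun n => ?_)
  exact (h (x n) i).trans (le_abs_self _)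

lemma Small.of_repr {x : ℕ → E} (b : Module.Basis ι ℝ E)
    (h : ∀ i, Small δ fun n => b.repr (x n) i) : Small δ x := by
  have : Small δ fun n => ∑ i, b.repr (x n) i • b i :=
    Small.sum _ fun i _ => (h i).smul_tame (tame_const (b i))
  simpa only [b.sum_repr] using this

/-- The coordinates of `x` agree with `v` up to small errors. -/
def Approx (δ : ℕ → ℝ) (b : Module.Basis ι ℝ E) (x : ℕ → E) (v : ι → ℝ*) : Prop :=
  ∀ i, ∃ s, ofSeq s = (ofSeq fun n => b.repr (x n) i) - v i ∧ Small δ s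

lemma Approx.mul {b : Module.Basis ι ℝ E} {x y : ℕ → E} {u v : ι → ℝ*} (hx : Approx δ b x u)
    (hy : Approx δ b y v) (hxt : Tame δ x) (hv : ∀ i, v i ∈ tameRing δ) :
    Approx δ b (fun n => x n * y n)
      fun k => ∑ i, ∑ j, u i * v j * (b.repr (b i * b j) k : ℝ) := by
  choose s hs hs' using hx
  choose t ht ht' using hy
  choose v' hv1 hv2 using hv
  intro k
  refine ⟨fun n => ∑ i, ∑ j, (b.repr (x n) i * t j n + s i n * v' j n) * b.repr (b i * b j) k,
    ?_, ?_⟩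
  · simp only [repr_mul_apply b (x _)]
    rw [ofSeq_sum, ofSeq_sum, ← Finset.sum_sub_distrib]
    refine Finset.sum_congr rfl fun i _ => ?_
    rw [ofSeq_sum, ofSeq_sum, ← Finset.sum_sub_distrib]
    refine Finset.sum_congr rfl fun j _ => ?_
    rw [ofSeq_mul, ofSeq_mul, ofSeq_mul, ofSeq_add, ofSeq_mul, ofSeq_mul, ht, hs, hv1, ofSeq_const]
    ring
  · refine Small.sum _ fun i _ => Small.sum _ fun j _ => ?_
    exact (((hxt.repr b i).mul_small (ht' j)).add ((hs' i).mul_tame (hv2 j))).mul_tame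
      (tame_const _)

end Coordinates

section Spanning

variable {E : Type*} [NormedRing E] [NormedAlgebra ℝ E] [FiniteDimensional ℝ E]
  {δ : ℕ → ℝ} [hδ : IsScale δ] {κ σ : ℝ} {A : ℕ → Set E} {N : ℕ → ℝ} {ι : Type*} [Fintype ι]

/-- Sets `A n` come close to no sequence of proper subalgebras. -/
lemma Setup.exists_away (hA : Setup δ κ σ A N) (W : ℕ → Subalgebra ℝ E)
    (hW : ∀ᶠ n in hyp, W n ≠ ⊤) :
    ∃ a : ℕ → E, (∀ᶠ n in hyp, a n ∈ A n) ∧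
      ∀ w : ℕ → E, (∀ᶠ n in hyp, w n ∈ W n) → ¬ Small δ fun n => a n - w n := by
  obtain ⟨a, ha⟩ := exists_diagonal (Y := Unit) (Z := E)
    (P := fun n m _ a => a ∈ A n ∧ ∀ w ∈ W n, δ n ^ (1 / ((m : ℝ) + 1)) ≤ ‖a - w‖)
    fun n m m' _ z hm hz => ⟨hz.1, fun w hw => (scale_rpow_le (by
      have : (m : ℝ) ≤ m' := by exact_mod_cast hm
      gcongr) n).trans (hz.2 w hw)⟩
  have h := ha (fun _ => ()) fun m => by
    filter_upwards [hW, hA.away (1 / ((m : ℝ) + 1)) (by positivity)] with n h1 h2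
    exact h2 _ h1
  refine ⟨fun n => a n (), (h 0).mono fun n hn => hn.1, fun w hw hs => ?_⟩
  obtain ⟨c, hc, hs⟩ := hs
  obtain ⟨m, hm⟩ := exists_nat_one_div_lt hc
  obtain ⟨n, h1, h2, h3⟩ := ((h m).and (hw.and hs)).exists
  have h4 := (h1.2 _ h2).trans h3
  exact absurd h4 (not_le.2 (Real.rpow_lt_rpow_of_exponent_gt (hδ.pos n) (hδ.lt_one n) hm))

lemma exists_seq_of_subfield (L : Subfield ℝ*) : ∃ r : L → ℕ → ℝ, ∀ l, ofSeq (r l) = l :=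
  ⟨fun l => (ofSeq_surjective (l : ℝ*)).choose, fun l => (ofSeq_surjective (l : ℝ*)).choose_spec⟩

/-- Proper subalgebras over a field of hyperreals come from sequences of proper subalgebras. -/
lemma exists_subalgebra_seq (b : Module.Basis ι ℝ E) (L : Subfield ℝ*)
    (hR : ∀ r : ℝ, (r : ℝ*) ∈ L) (U : Submodule L (ι → L)) (hU : U ≠ ⊤)
    (hone : (fun k => (⟨(b.repr 1 k : ℝ), hR _⟩ : L)) ∈ U)
    (hmul : ∀ u ∈ U, ∀ v ∈ U,
      (fun k => ∑ i, ∑ j, u i * v j * (⟨(b.repr (b i * b j) k : ℝ), hR _⟩ : L)) ∈ U) :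
    ∃ W : ℕ → Subalgebra ℝ E, (∀ᶠ n in hyp, W n ≠ ⊤) ∧ ∀ v ∈ U, ∃ w : ℕ → E,
      (∀ᶠ n in hyp, w n ∈ W n) ∧ ∀ i, (ofSeq fun n => b.repr (w n) i) = v i := by
  classical
  obtain ⟨r, hr⟩ := exists_seq_of_subfield L
  let B := Module.finBasis L U
  set u : Fin (Module.finrank L U) → ι → L := fun p => (B p : ι → L) with hu
  have hexp : ∀ v ∈ U, ∃ l : Fin (Module.finrank L U) → L, ∀ k, v k = ∑ s, l s * u s k := by
    intro v hv
    refine ⟨fun s => B.repr ⟨v, hv⟩ s, fun k => ?_⟩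
    have h1 := congrArg (fun x : U => (x : ι → L) k) (B.sum_repr ⟨v, hv⟩)
    simp only [Submodule.coe_sum, Submodule.coe_smul, Finset.sum_apply, Pi.smul_apply,
      smul_eq_mul] at h1
    exact h1.symm
  have hexp' : ∀ v ∈ U, ∃ l : Fin (Module.finrank L U) → L, ∀ k,
      (v k : ℝ*) = ofSeq fun n => ∑ s, r (l s) n * r (u s k) n := by
    intro v hv
    obtain ⟨l, hl⟩ := hexp v hv
    refine ⟨l, fun k => ?_⟩
    rw [hl, ofSeq_sum]
    simp only [ofSeq_mul, hr]
    push_cast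
    rfl
  let e : Fin (Module.finrank L U) → ℕ → E := fun p n => ∑ i, r (u p i) n • b i
  have hrepr : ∀ (c : Fin (Module.finrank L U) → ℝ) n k,
      b.repr (∑ s, c s • e s n) k = ∑ s, c s * r (u s k) n := by
    intro c n k
    simp only [map_sum, map_smul, Finsupp.coe_finsetSum, Finset.sum_apply, Finsupp.smul_apply,
      smul_eq_mul]
    refine Finset.sum_congr rfl fun s _ => ?_
    simp only [e, map_sum, map_smul, Finsupp.coe_finsetSum, Finset.sum_apply, Finsupp.smul_apply,
      Module.Basis.repr_self, smul_eq_mul, Finsupp.single_apply]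
    simp
  have hrepr' : ∀ p n k, b.repr (e p n) k = r (u p k) n := by
    intro p n k
    have := hrepr (fun s => if s = p then 1 else 0) n k
    simpa using this
  let V : ℕ → Submodule ℝ E := fun n => Submodule.span ℝ (Set.range fun p => e p n)
  have hsumV : ∀ (c : Fin (Module.finrank L U) → ℝ) n, ∑ s, c s • e s n ∈ V n := fun c n =>
    sum_mem fun s _ => Submodule.smul_mem _ _ (Submodule.subset_span ⟨s, rfl⟩)
  have h1 : ∀ᶠ n in hyp, (1 : E) ∈ V n := by
    obtain ⟨l, hl⟩ := hexp' _ hone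
    have : ∀ᶠ n in hyp, ∀ k, b.repr 1 k = ∑ s, r (l s) n * r (u s k) n :=
      eventually_all.2 fun k => by
        have h1 : ofSeq (fun _ => b.repr 1 k) = _ := hl k
        rwa [ofSeq_eq_iff] at h1
    filter_upwards [this] with n hn
    have : (1 : E) = ∑ s, r (l s) n • e s n := b.ext_elem fun k => by rw [hrepr, hn]
    rw [this]
    exact hsumV _ _
  have h2 : ∀ᶠ n in hyp, ∀ p q, e p n * e q n ∈ V n := by
    refine eventually_all.2 fun p => eventually_all.2 fun q => ?_
    obtain ⟨l, hl⟩ := hexp' _ (hmul _ (B p).2 _ (B q).2)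
    have : ∀ᶠ n in hyp, ∀ k, b.repr (e p n * e q n) k = ∑ s, r (l s) n * r (u s k) n :=
      eventually_all.2 fun k => by
        have := hl k
        rw [← ofSeq_eq_iff, ← this]
        simp only [repr_mul_apply b (e p _), hrepr']
        rw [ofSeq_sum]
        push_cast
        refine Finset.sum_congr rfl fun i _ => ?_
        rw [ofSeq_sum]
        refine Finset.sum_congr rfl fun j _ => ?_
        rw [ofSeq_mul, ofSeq_mul, hr, hr, ofSeq_const]
    filter_upwards [this] with n hn
    have : e p n * e q n = ∑ s, r (l s) n • e s n := b.ext_elem fun k => by rw [hrepr, hn]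
    rw [this]
    exact hsumV _ _
  have hVtop : ∀ n, V n ≠ ⊤ := by
    intro n hn
    have h3 : Module.finrank ℝ (V n) ≤ Module.finrank L U :=
      (finrank_range_le_card (R := ℝ) fun p => e p n).trans (by simp)
    have h4 : Module.finrank L U < Fintype.card ι :=
      (Submodule.finrank_lt hU).trans_eq (Module.finrank_fintype_fun_eq_card L)
    rw [hn, finrank_top, Module.finrank_eq_card_basis b] at h3
    omega
  have h5 : ∀ᶠ n in hyp, ∃ W : Subalgebra ℝ E, Subalgebra.toSubmodule W = V n := by
    filter_upwards [h1, h2] with n h1 h2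
    refine ⟨(V n).toSubalgebra h1 fun x y hx hy => ?_, Submodule.toSubalgebra_toSubmodule _ _ _⟩
    have := Submodule.mul_mem_mul hx hy
    rw [Submodule.span_mul_span] at this
    refine Submodule.span_le.2 ?_ this
    rintro _ ⟨_, ⟨p, rfl⟩, _, ⟨q, rfl⟩, rfl⟩
    exact h2 p q
  obtain ⟨W, hW⟩ := h5.choice
  refine ⟨W, ?_, fun v hv => ?_⟩
  · filter_upwards [hW] with n hn htop
    rw [htop] at hn
    exact hVtop n (hn.symm.trans Algebra.top_toSubmodule)
  · obtain ⟨l, hl⟩ := hexp' v hv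
    refine ⟨fun n => ∑ s, r (l s) n • e s n, ?_, fun i => ?_⟩
    · filter_upwards [hW] with n hn
      rw [← Subalgebra.mem_toSubmodule, hn]
      exact hsumV _ _
    · simp only [hrepr]
      exact (hl i).symm

end Spanning

section

variable {E : Type*} [NormedRing E] [NormedAlgebra ℝ E] [FiniteDimensional ℝ E]
  {δ : ℕ → ℝ} [hδ : IsScale δ] {κ σ : ℝ} {A : ℕ → Set E} {N : ℕ → ℝ} {ι : Type*} [Fintype ι]

lemma Setup.span_approx_eq_top (hA : Setup δ κ σ A N) (b : Module.Basis ι ℝ E)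
    (L : Subfield ℝ*) (hR : ∀ r : ℝ, (r : ℝ*) ∈ L) (hL : ∀ l ∈ L, l ∈ tameRing δ)
    (hlift : ∀ x ∈ tameRing δ, ∃ l ∈ L, ∃ s, ofSeq s = x - l ∧ Small δ s) :
    Submodule.span L {v : ι → L | ∃ g, IsGood δ A g ∧ Approx δ b g fun i => (v i : ℝ*)} = ⊤ := by
  set S := {v : ι → L | ∃ g, IsGood δ A g ∧ Approx δ b g fun i => (v i : ℝ*)} with hS
  by_contra hU
  let m : (ι → L) →ₗ[L] (ι → L) →ₗ[L] (ι → L) := LinearMap.mk₂ L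
    (fun u v k => ∑ i, ∑ j, u i * v j * (⟨(b.repr (b i * b j) k : ℝ), hR _⟩ : L))
    (fun u u' v => by ext k; simp [add_mul, Finset.sum_add_distrib])
    (fun c u v => by ext k; simp [Finset.mul_sum, mul_assoc])
    (fun u v v' => by ext k; simp [mul_add, add_mul, Finset.sum_add_distrib])
    (fun c u v => by ext k; simp [Finset.mul_sum, mul_left_comm, mul_assoc])
  have hm : Submodule.map₂ m (Submodule.span L S) (Submodule.span L S) ≤ Submodule.span L S := by
    rw [Submodule.map₂_span_span]
    refine Submodule.span_mono ?_
    rintro _ ⟨u, ⟨g, hg, hgu⟩, v, ⟨h, hh, hhv⟩, rfl⟩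
    refine ⟨_, hg.mul hh, ?_⟩
    convert hgu.mul hhv hg.tame fun i => hL _ (v i).2 using 1
    ext k
    simp only [m, LinearMap.mk₂_apply]
    push_cast
    rfl
  obtain ⟨W, hW, hWU⟩ := exists_subalgebra_seq b L hR (Submodule.span L S) hU
    (Submodule.subset_span ⟨_, IsGood.one, fun i => ⟨fun _ => 0, (sub_self _).symm, small_zero⟩⟩)
    fun u hu v hv => hm (Submodule.apply_mem_map₂ m hu hv)
  obtain ⟨a, ha, haW⟩ := hA.exists_away W hW
  have hga := IsGood.of_mem hA ha
  choose v hv s hs hs' using fun i => hlift _ (mem_tameRing.2 (hga.tame.repr b i))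
  obtain ⟨w, hw, hwv⟩ := hWU (fun i => ⟨v i, hv i⟩) (Submodule.subset_span
    ⟨a, hga, fun i => ⟨s i, hs i, hs' i⟩⟩)
  refine haW w hw (Small.of_repr b fun i => (hs' i).congr (ofSeq_eq_iff.1 ?_))
  simp only [map_sub, Finsupp.sub_apply]
  rw [ofSeq_sub, hwv, hs]

/-- Finitely many good sequences span all tame sequences over the tame scalars. -/
theorem Setup.exists_good_spanning (hA : Setup δ κ σ A N) (b : Module.Basis ι ℝ E) :
    ∃ w : ι → ℕ → E, (∀ p, IsGood δ A (w p)) ∧ ∀ x, Tame δ x →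
      ∃ τ : ι → ℕ → ℝ, (∀ p, Tame δ (τ p)) ∧ ∀ᶠ n in hyp, x n = ∑ p, τ p n • w p n := by
  classical
  obtain ⟨L, hR, hL, hlift⟩ := exists_coefficientField δ
  have htop := hA.span_approx_eq_top b L hR hL hlift
  set S := {v : ι → L | ∃ g, IsGood δ A g ∧ Approx δ b g fun i => (v i : ℝ*)} with hS
  let B₀ := Module.Basis.ofSpan htop.ge
  let e := B₀.indexEquiv (Pi.basisFun L ι)
  let B := B₀.reindex e
  have hB : ∀ p, B p ∈ S := fun p =>
    Module.Basis.ofSpan_subset htop.ge ⟨e.symm p, (B₀.reindex_apply e p).symm⟩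
  choose w hw hwB using hB
  refine ⟨w, hw, fun x hx => ?_⟩
  let φ := tameInclusion L hL
  let V : Matrix ι ι L := Matrix.of fun p i => B p i
  have hVdet : V.det ≠ 0 := by
    have h1 : V = ((Pi.basisFun L ι).toMatrix B).transpose := by
      ext p i
      simp [V, Module.Basis.toMatrix_apply]
    have h2 := (Pi.basisFun L ι).isUnit_det B
    rw [Module.Basis.det_apply, ← Matrix.det_transpose, ← h1] at h2
    exact h2.ne_zero
  let M : Matrix ι ι (tameRing δ) := Matrix.of fun p i =>
    ⟨ofSeq fun n => b.repr (w p n) i, mem_tameRing.2 ((hw p).tame.repr b i)⟩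
  have hM : M.det ∉ smallIdeal δ := by
    have h1 : (Ideal.Quotient.mk (smallIdeal δ)).mapMatrix M =
        (Ideal.Quotient.mk (smallIdeal δ)).mapMatrix (φ.mapMatrix V) := by
      ext p i
      simp only [RingHom.mapMatrix_apply, Matrix.map_apply]
      exact Ideal.Quotient.eq.2 (hwB p i)
    have h2 : M.det - φ V.det ∈ smallIdeal δ := by
      rw [← Ideal.Quotient.eq, RingHom.map_det, RingHom.map_det, RingHom.map_det, h1]
    intro h3
    have h4 : φ V.det ∈ smallIdeal δ := by
      have := (smallIdeal δ).sub_mem h3 h2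
      rwa [sub_sub_cancel] at this
    exact notMem_smallIdeal_of_mul_eq_one (h := φ V.det⁻¹)
      (by rw [← map_mul, mul_inv_cancel₀ hVdet, map_one]) h4
  let D : tameRing δ := ⟨_, inv_mem_tameRing hM⟩
  have hD : M.det * D = 1 := Subtype.ext (mul_inv_cancel₀ fun h => hM (by
    have h0 : M.det = 0 := Subtype.ext h
    rw [h0]; exact zero_mem _))
  let X : ι → tameRing δ := fun i => ⟨ofSeq fun n => b.repr (x n) i, mem_tameRing.2 (hx.repr b i)⟩
  let T : ι → tameRing δ := D • Matrix.vecMul X M.adjugate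
  have hT : Matrix.vecMul T M = X := by
    rw [Matrix.smul_vecMul, Matrix.vecMul_vecMul, Matrix.adjugate_mul, Matrix.vecMul_smul,
      Matrix.vecMul_one, smul_smul, mul_comm, hD, one_smul]
  choose τ hτ hτ' using fun p => (T p).2
  refine ⟨τ, hτ', ?_⟩
  have h : ∀ᶠ n in hyp, ∀ i, b.repr (x n) i = ∑ p, τ p n * b.repr (w p n) i := by
    refine eventually_all.2 fun i => ?_
    rw [← ofSeq_eq_iff, ofSeq_sum]
    have := congrArg (fun y : ι → tameRing δ => ((y i : tameRing δ) : ℝ*)) hT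
    simp only [Matrix.vecMul, dotProduct] at this
    push_cast at this
    rw [← show ((X i : tameRing δ) : ℝ*) = ofSeq fun n => b.repr (x n) i from rfl, ← this]
    refine Finset.sum_congr rfl fun p _ => ?_
    rw [ofSeq_mul, hτ]
    rfl
  filter_upwards [h] with n hn
  refine b.ext_elem fun i => ?_
  rw [hn]
  simp

end

end SumProduct

namespace SumProduct

open Filter Topology Pointwise Metric Polynomial

set_option linter.unusedSectionVars false

section

variable {E : Type*} [NormedRing E] [NormedAlgebra ℝ E] [FiniteDimensional ℝ E]
  {δ : ℕ → ℝ} [hδ : IsScale δ] {κ σ : ℝ} {A : ℕ → Set E} {N : ℕ → ℝ} {ι : Type*} [Fintype ι]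
  [DecidableEq ι]

omit [FiniteDimensional ℝ E] in
lemma exists_sum_mul_mul_eq_one [IsSimpleRing E] (b : Module.Basis ι ℝ E) {h : E} (hh : h ≠ 0) :
    ∃ x : ι → E, ∑ l, x l * h * b l = 1 := by
  have htop : TwoSidedIdeal.span {h} = ⊤ := by
    rcases eq_bot_or_eq_top (TwoSidedIdeal.span {h}) with h1 | h1
    · have : h ∈ TwoSidedIdeal.span {h} := TwoSidedIdeal.subset_span rfl
      rw [h1, TwoSidedIdeal.mem_bot] at this
      exact absurd this hh
    · exact h1
  have h1 : (1 : E) ∈ TwoSidedIdeal.span {h} := by rw [htop]; trivial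
  rw [TwoSidedIdeal.mem_span_iff_mem_addSubgroup_closure] at h1
  generalize (1 : E) = z at h1 ⊢
  induction h1 using AddSubgroup.closure_induction with
  | mem x hx =>
    obtain ⟨_, ⟨u, -, _, rfl, rfl⟩, v, -, rfl⟩ := hx
    refine ⟨fun l => b.repr v l • u, ?_⟩
    change _ = u * _ * v
    conv_rhs => rw [← b.sum_repr v, Finset.mul_sum]
    simp
  | zero => exact ⟨0, by simp⟩
  | add x y _ _ hx hy =>
    obtain ⟨x, rfl⟩ := hx
    obtain ⟨y, rfl⟩ := hy
    exact ⟨x + y, by simp [add_mul, Finset.sum_add_distrib]⟩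
  | neg x _ hx =>
    obtain ⟨x, rfl⟩ := hx
    exact ⟨-x, by simp⟩

lemma exists_tame_sum_mul_mul_eq_one [IsSimpleRing E] (b : Module.Basis ι ℝ E) {g : ℕ → E}
    (hg : ¬ Small δ g) :
    ∃ x : ι → ℕ → E, (∀ l, Tame δ (x l)) ∧ ∀ᶠ n in hyp, ∑ l, x l n * g n * b l = 1 := by
  have := FiniteDimensional.complete ℝ E
  have := FiniteDimensional.proper ℝ E
  have hne : ∀ᶠ n in hyp, g n ≠ 0 := by
    filter_upwards [not_small_iff.1 hg 1 one_pos] with n hn h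
    rw [h, norm_zero] at hn
    exact absurd hn (not_lt.2 (Real.rpow_nonneg (hδ.pos n).le _))
  obtain ⟨h, hh, hlim⟩ := (isCompact_sphere (0 : E) 1).ultrafilter_le_nhds
    ((hyperfilter ℕ).map fun n => ‖g n‖⁻¹ • g n) (by
      rw [le_principal_iff]
      change ∀ᶠ n in hyp, _
      filter_upwards [hne] with n hn
      simp [norm_smul, hn])
  have hh0 : h ≠ 0 := by
    rintro rfl
    simp at hh
  have hlim' : Tendsto (fun n => ‖g n‖⁻¹ • g n) hyp (𝓝 h) := hlim
  obtain ⟨x, hx⟩ := exists_sum_mul_mul_eq_one b hh0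
  let y : ℕ → E := fun n => ∑ l, x l * (‖g n‖⁻¹ • g n) * b l
  have hy : Tendsto y hyp (𝓝 ((1 : Eˣ) : E)) := by
    rw [Units.val_one, ← hx]
    exact tendsto_finsetSum _ fun l _ => (hlim'.const_mul _).mul_const _
  have hinv := (NormedRing.inverse_continuousAt (1 : Eˣ)).tendsto.comp hy
  have hbd : ∀ᶠ n in hyp, ‖Ring.inverse (y n)‖ ≤ ‖Ring.inverse ((1 : Eˣ) : E)‖ + 1 :=
    (hinv.norm.eventually_lt_const (lt_add_one _)).mono fun n hn => hn.le
  have hunit : ∀ᶠ n in hyp, IsUnit (y n) := hy.eventually (Units.nhds 1)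
  refine ⟨fun l n => ‖g n‖⁻¹ • (Ring.inverse (y n) * x l), fun l => ?_, ?_⟩
  · exact (tame_inv_of_not_small hg).smul ((tame_of_bounded _ hbd).mul (tame_const _))
  · filter_upwards [hunit] with n hn
    calc _ = Ring.inverse (y n) * y n := by
          simp only [y, Finset.mul_sum]
          refine Finset.sum_congr rfl fun l _ => ?_
          simp only [smul_mul_assoc, mul_smul_comm, mul_assoc]
      _ = 1 := Ring.inverse_mul_cancel _ hn

lemma Tame.det {M : ℕ → Matrix ι ι ℝ} (h : ∀ i j, Tame δ fun n => M n i j) :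
    Tame δ fun n => (M n).det := by
  simp only [Matrix.det_apply']
  exact Tame.sum _ fun s _ => (tame_const _).mul (Tame.prod _ fun i _ => h _ _)

omit [FiniteDimensional ℝ E] in
lemma exists_det_polynomial (M M' : Matrix ι ι ℝ) : ∃ p : ℝ[X],
    p.degree < (Fintype.card ι + 1 : ℕ) ∧ ∀ t, p.eval t = (M + t • M').det := by
  refine ⟨((X : ℝ[X]) • M'.map C + M.map C).det, ?_, fun t => ?_⟩
  · refine degree_le_natDegree.trans_lt ?_
    have := natDegree_det_X_add_C_le M' M
    exact_mod_cast Nat.lt_succ_of_le this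
  · rw [← coe_evalRingHom, RingHom.map_det]
    congr 1
    ext i j
    simp [add_comm, mul_comm t]

lemma exists_not_small_det {M M' : ℕ → Matrix ι ι ℝ} {c : ℕ → ℝ} (hc : Tame δ c)
    (h : ¬ Small δ fun n => (M n + c n • M' n).det) :
    ∃ s : ℕ, ¬ Small δ fun n => (M n + (s : ℝ) • M' n).det := by
  by_contra! hs
  refine h ?_
  choose p hp hp' using fun n => exists_det_polynomial (M n) (M' n)
  have key : ∀ n, (M n + c n • M' n).det = ∑ s ∈ Finset.range (Fintype.card ι + 1),
      (M n + (s : ℝ) • M' n).det *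
        (Lagrange.basis (Finset.range (Fintype.card ι + 1)) (fun s : ℕ => (s : ℝ)) s).eval (c n) := by
    intro n
    rw [← hp', Lagrange.eq_interpolate (f := p n) (s := Finset.range (Fintype.card ι + 1))
      (v := fun s : ℕ => (s : ℝ)) (Nat.cast_injective.injOn) (by simpa using hp n),
      Lagrange.interpolate_apply, eval_finsetSum]
    simp [hp']
  simp only [key]
  refine Small.sum _ fun s _ => (hs s).mul_tame ?_
  simp only [eval_eq_sum_range]
  exact Tame.sum _ fun i _ => (tame_const _).mul (hc.pow i)

lemma exists_nat_not_small_det {J : Type*} (T : Finset J) {M : ℕ → Matrix ι ι ℝ}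
    {u : J → ℕ → Matrix ι ι ℝ} {c : J → ℕ → ℝ} (hc : ∀ j, Tame δ (c j))
    (h : ¬ Small δ fun n => (M n + ∑ j ∈ T, c j n • u j n).det) :
    ∃ s : J → ℕ, ¬ Small δ fun n => (M n + ∑ j ∈ T, (s j : ℝ) • u j n).det := by
  classical
  induction T using Finset.induction_on generalizing M with
  | empty => exact ⟨fun _ => 0, by simpa using h⟩
  | insert a T ha ih =>
    have h1 : ¬ Small δ fun n => ((M n + ∑ j ∈ T, c j n • u j n) + c a n • u a n).det := by
      convert h using 4 with n
      rw [Finset.sum_insert ha]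
      abel
    obtain ⟨k, hk⟩ := exists_not_small_det (hc a) h1
    have h2 : ¬ Small δ fun n => ((M n + (k : ℝ) • u a n) + ∑ j ∈ T, c j n • u j n).det := by
      convert hk using 4 with n
      abel
    obtain ⟨s, hs⟩ := ih h2
    refine ⟨Function.update s a k, ?_⟩
    convert hs using 4 with n
    rw [Finset.sum_insert ha, Function.update_self, add_assoc]
    congr 2
    exact Finset.sum_congr rfl fun j hj => by
      rw [Function.update_of_ne (ne_of_mem_of_not_mem hj ha)]

lemma exists_tame_inverse (b : Module.Basis ι ℝ E) {u : ℕ → E} (hu : Tame δ u)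
    (h : ¬ Small δ fun n => (Algebra.leftMulMatrix b (u n)).det) :
    ∃ y : ℕ → E, Tame δ y ∧ (∀ᶠ n in hyp, u n * y n = 1) ∧ ∀ᶠ n in hyp, y n * u n = 1 := by
  set M := fun n => Algebra.leftMulMatrix b (u n) with hM
  have hMt : ∀ i j, Tame δ fun n => M n i j := fun i j => by
    simp only [hM, Algebra.leftMulMatrix_eq_repr_mul]
    exact (hu.mul (tame_const _)).repr b i
  have hadj : ∀ i j, Tame δ fun n => (M n).adjugate i j := fun i j => by
    simp only [Matrix.adjugate_apply]
    refine Tame.det fun k l => ?_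
    simp only [Matrix.updateRow_apply]
    split_ifs
    · exact tame_const _
    · exact hMt _ _
  have hdet : ∀ᶠ n in hyp, IsUnit (M n).det := by
    filter_upwards [not_small_iff.1 h 1 one_pos] with n hn
    refine isUnit_iff_ne_zero.2 fun h0 => ?_
    rw [show (Algebra.leftMulMatrix b (u n)).det = 0 from h0, norm_zero] at hn
    exact absurd hn (not_lt.2 (Real.rpow_nonneg (hδ.pos n).le _))
  let y : ℕ → E := fun n => ∑ i, ((M n).det⁻¹ * ∑ j, (M n).adjugate i j * b.repr 1 j) • b i
  have hy : ∀ n, ⇑(b.repr (y n)) = (M n)⁻¹.mulVec (b.repr 1) := by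
    intro n
    ext i
    rw [Matrix.inv_def, Matrix.smul_mulVec, Ring.inverse_eq_inv']
    simp only [y, map_sum, map_smul, Finsupp.coe_finsetSum, Finset.sum_apply, Finsupp.smul_apply,
      Module.Basis.repr_self, smul_eq_mul, Finsupp.single_apply, mul_ite, mul_one, mul_zero,
      Finset.sum_ite_eq', Finset.mem_univ, if_true, Pi.smul_apply, Matrix.mulVec, dotProduct]
  have h1 : ∀ᶠ n in hyp, u n * y n = 1 := by
    filter_upwards [hdet] with n hn
    refine b.repr.injective (DFunLike.coe_injective ?_)
    rw [← Algebra.leftMulMatrix_mulVec_repr, hy, Matrix.mulVec_mulVec]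
    change (M n * (M n)⁻¹).mulVec _ = _
    rw [Matrix.mul_nonsing_inv _ hn, Matrix.one_mulVec]
  refine ⟨y, Tame.sum _ fun i _ => ?_, h1, ?_⟩
  · refine Tame.smul (Tame.mul ?_ (Tame.sum _ fun j _ => (hadj i j).mul (tame_const _)))
      (tame_const _)
    exact (tame_inv_of_not_small h).of_le (Eventually.of_forall fun n => by simp [hM])
  · filter_upwards [hdet, h1] with n hn h2
    refine b.repr.injective (DFunLike.coe_injective ?_)
    have h3 : (M n).mulVec (b.repr (y n * u n)) = (M n).mulVec (b.repr 1) := by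
      simp only [hM, Algebra.leftMulMatrix_mulVec_repr]
      rw [← mul_assoc, h2, one_mul, mul_one]
    have h4 := congrArg (M n)⁻¹.mulVec h3
    simpa [Matrix.mulVec_mulVec, Matrix.nonsing_inv_mul _ hn] using h4

/-- The good sequences form a simple ring, modulo small sequences. -/
theorem Setup.exists_good_sum_eq_one [IsSimpleRing E] (hA : Setup δ κ σ A N)
    (b : Module.Basis ι ℝ E) {g : ℕ → E} (hg : IsGood δ A g) (hgs : ¬ Small δ g) :
    ∃ p q : ι × ι → ℕ → E, (∀ j, IsGood δ A (p j)) ∧ (∀ j, IsGood δ A (q j)) ∧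
      ∀ᶠ n in hyp, ∑ j, p j n * g n * q j n = 1 := by
  obtain ⟨x, hx, hx1⟩ := exists_tame_sum_mul_mul_eq_one b hgs
  obtain ⟨w, hw, hspan⟩ := hA.exists_good_spanning b
  choose τ hτ hτx using fun l => hspan (x l) (hx l)
  choose τ' hτ' hτb using fun l => hspan (fun _ => b l) (tame_const _)
  let c : ι × ι → ℕ → ℝ := fun j n => ∑ l, τ l j.1 n * τ' l j.2 n
  have hc : ∀ j, Tame δ (c j) := fun j => Tame.sum _ fun l _ => (hτ _ _).mul (hτ' _ _)
  let v : ι × ι → ℕ → E := fun j n => w j.1 n * g n * w j.2 n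
  have hv : ∀ j, IsGood δ A (v j) := fun j => ((hw _).mul hg).mul (hw _)
  have hcv : ∀ᶠ n in hyp, ∑ j, c j n • v j n = 1 := by
    filter_upwards [hx1, eventually_all.2 hτx, eventually_all.2 hτb] with n h1 h2 h3
    rw [← h1]
    simp only [c, Finset.sum_smul]
    rw [Finset.sum_comm]
    refine Finset.sum_congr rfl fun l _ => ?_
    rw [h2, h3, Fintype.sum_prod_type, Finset.sum_mul, Finset.sum_mul_sum]
    refine Finset.sum_congr rfl fun p _ => Finset.sum_congr rfl fun q _ => ?_
    simp only [v, smul_mul_assoc, mul_smul_comm, mul_assoc, smul_smul]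
    rw [mul_comm (τ' l q n)]
  have hdet : ¬ Small δ fun n =>
      ((0 : Matrix ι ι ℝ) + ∑ j, c j n • Algebra.leftMulMatrix b (v j n)).det := by
    intro hs
    refine not_small_const (δ := δ) one_ne_zero (hs.congr ?_)
    filter_upwards [hcv] with n hn
    have : ∑ j, c j n • Algebra.leftMulMatrix b (v j n) = 1 := by
      rw [← map_one (Algebra.leftMulMatrix b), ← hn, map_sum]
      simp
    rw [this, zero_add, Matrix.det_one]
  obtain ⟨s, hs⟩ := exists_nat_not_small_det Finset.univ (M := fun _ => 0) hc hdet
  let u : ℕ → E := fun n => ∑ j, (s j : ℝ) • v j n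
  have hu : IsGood δ A u := IsGood.sum hA _ fun j _ => (hv j).natCast_smul hA _
  have hdet' : ¬ Small δ fun n => (Algebra.leftMulMatrix b (u n)).det := by
    convert hs using 4 with n
    simp [u]
  obtain ⟨y, hy, h1, h2⟩ := exists_tame_inverse b hu.tame hdet'
  have hyg := IsGood.inv hA hu hy h1 h2
  refine ⟨fun j n => y n * ((s j : ℝ) • w j.1 n), fun j => w j.2,
    fun j => hyg.mul ((hw _).natCast_smul hA _), fun j => hw _, ?_⟩
  filter_upwards [h2] with n hn
  rw [← hn]
  simp only [u, Finset.mul_sum]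
  refine Finset.sum_congr rfl fun j _ => ?_
  simp only [v, smul_mul_assoc, mul_smul_comm, mul_assoc]

end

end SumProduct

namespace SumProduct

open Filter Topology Pointwise Metric

set_option linter.unusedSectionVars false

section

variable {V E : Type*} [NormedAddCommGroup V] [NormedSpace ℝ V] [FiniteDimensional ℝ V]
  [NormedAddCommGroup E] [NormedSpace ℝ E] [FiniteDimensional ℝ E]

open MeasureTheory in
/-- Most parameters are not mapped close to the origin by a surjective linear map. -/
lemma measure_setOf_norm_map_le [MeasurableSpace V] [BorelSpace V] (μ : Measure V)
    [μ.IsAddHaarMeasure] (T : V →ₗ[ℝ] E) {L δ : ℝ} (hL : 0 < L) (hδ : 0 < δ)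
    (hT : ∀ y, ∃ v, T v = y ∧ ‖v‖ ≤ L * ‖y‖) :
    μ {v ∈ closedBall (0 : V) 1 | ‖T v‖ ≤ δ} ≤
      ENNReal.ofReal (2 ^ Module.finrank ℝ V * (2 * δ * L) ^ Module.finrank ℝ E) *
        μ (closedBall (0 : V) 1) := by
  have hTc : Continuous T := T.continuous_of_finiteDimensional
  set bad : Set V := {v ∈ closedBall (0 : V) 1 | ‖T v‖ ≤ δ} with hbad
  have hbm : MeasurableSet bad :=
    (isClosed_closedBall.inter (isClosed_le hTc.norm continuous_const)).measurableSet
  obtain ⟨Y, h1, h2, h3⟩ := exists_separated_ball (V := E) (δ := 2 * δ) (R := L⁻¹)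
    (by positivity) (by positivity)
  choose v hv hvn using hT
  have hdisj : (Y : Set E).PairwiseDisjoint fun y => v y +ᵥ bad := by
    intro x hx y hy hxy
    refine Set.disjoint_left.2 ?_
    rintro _ ⟨u, hu, rfl⟩ ⟨u', hu', h⟩
    have h4 := congrArg T h
    simp only [vadd_eq_add, map_add, hv] at h4
    have h5 := h2 hx hy hxy
    have h6 : x - y = T u' - T u := by rw [sub_eq_sub_iff_add_eq_add, ← h4, add_comm]
    simp only [dist_eq_norm, h6] at h5
    have := norm_sub_le (T u') (T u)
    have := hu.2
    have := hu'.2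
    linarith
  have hsub : (⋃ y ∈ Y, (v y +ᵥ bad)) ⊆ closedBall (0 : V) 2 := by
    refine Set.iUnion₂_subset fun y hy => ?_
    rintro _ ⟨u, hu, rfl⟩
    have hu1 : ‖u‖ ≤ 1 := by simpa using hu.1
    have : ‖v y‖ ≤ 1 := (hvn y).trans <| by
      calc L * ‖y‖ ≤ L * L⁻¹ := by gcongr; exact h1 y hy
        _ = 1 := mul_inv_cancel₀ hL.ne'
    rw [mem_closedBall_zero_iff]
    refine (norm_add_le _ _).trans ?_
    linarith
  have hm : μ (⋃ y ∈ Y, (v y +ᵥ bad)) = Y.card * μ bad := by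
    rw [measure_biUnion_finset hdisj fun _ _ => hbm.const_vadd _]
    simp [measure_vadd]
  have hle : (Y.card : ENNReal) * μ bad ≤ ENNReal.ofReal (2 ^ Module.finrank ℝ V) *
      μ (closedBall (0 : V) 1) := by
    rw [← hm]
    refine (measure_mono hsub).trans ?_
    rw [Measure.addHaar_closedBall' μ _ zero_le_two]
  have hq : (0 : ℝ) < (2 * δ * L) ^ Module.finrank ℝ E := by positivity
  have h4 : 1 ≤ ENNReal.ofReal ((2 * δ * L) ^ Module.finrank ℝ E) * Y.card := by
    rw [← ENNReal.ofReal_natCast, ← ENNReal.ofReal_mul hq.le, ← ENNReal.ofReal_one]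
    refine ENNReal.ofReal_le_ofReal ?_
    calc (1 : ℝ) = (2 * δ * L) ^ Module.finrank ℝ E * (L⁻¹ / (2 * δ)) ^ Module.finrank ℝ E := by
          rw [← mul_pow]
          rw [show 2 * δ * L * (L⁻¹ / (2 * δ)) = 1 by field_simp, one_pow]
      _ ≤ _ := by gcongr
  calc μ bad ≤ (ENNReal.ofReal ((2 * δ * L) ^ Module.finrank ℝ E) * Y.card) * μ bad :=
        le_mul_of_one_le_left zero_le h4
    _ = ENNReal.ofReal ((2 * δ * L) ^ Module.finrank ℝ E) * (Y.card * μ bad) := mul_assoc _ _ _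
    _ ≤ ENNReal.ofReal ((2 * δ * L) ^ Module.finrank ℝ E) *
        (ENNReal.ofReal (2 ^ Module.finrank ℝ V) * μ (closedBall (0 : V) 1)) := by gcongr
    _ = _ := by
        rw [← mul_assoc, ← ENNReal.ofReal_mul hq.le, mul_comm (2 ^ Module.finrank ℝ V : ℝ)]

open MeasureTheory in
/-- First moment method for the number of linear maps sending a parameter close to the origin. -/
lemma exists_card_filter_norm_le {α : Type*} (P : Finset α) (T : α → V →ₗ[ℝ] E) (w : α → ℝ)
    {δ C : ℝ} (hδ : 0 < δ) (hC : 1 ≤ C) (hw : ∀ p ∈ P, 0 ≤ w p) (hT : ∀ p ∈ P, 1 ≤ w p ∨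
      ∃ L > 0, (∀ y, ∃ v, T p v = y ∧ ‖v‖ ≤ L * ‖y‖) ∧
        2 ^ Module.finrank ℝ V * (2 * δ * L) ^ Module.finrank ℝ E ≤ C * w p) :
    ∃ v : V, ‖v‖ ≤ 1 ∧ ((P.filter fun p => ‖T p v‖ ≤ δ).card : ℝ) ≤ C * ∑ p ∈ P, w p := by
  classical
  borelize V
  set μ : Measure V := Measure.addHaar
  set B : Set V := closedBall (0 : V) 1
  have hB0 : μ B ≠ 0 := (measure_closedBall_pos μ _ one_pos).ne'
  have hB1 : μ B ≠ ⊤ := measure_closedBall_lt_top.ne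
  have hcl : ∀ p, MeasurableSet {v | ‖T p v‖ ≤ δ} := fun p =>
    (isClosed_le (T p).continuous_of_finiteDimensional.norm continuous_const).measurableSet
  have hbad : ∀ p ∈ P, μ {v ∈ B | ‖T p v‖ ≤ δ} ≤ ENNReal.ofReal (C * w p) * μ B := by
    intro p hp
    rcases hT p hp with h | ⟨L, hL, h1, h2⟩
    · refine (measure_mono fun v hv => hv.1).trans (le_mul_of_one_le_left zero_le ?_)
      rw [← ENNReal.ofReal_one]
      exact ENNReal.ofReal_le_ofReal (by nlinarith)
    · exact (measure_setOf_norm_map_le μ (T p) hL hδ h1).trans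
        (by gcongr)
  let f : V → ENNReal := fun v => ∑ p ∈ P, Set.indicator {v | ‖T p v‖ ≤ δ} (fun _ => 1) v
  have hfm : Measurable f := Finset.measurable_sum _ fun p _ => measurable_const.indicator (hcl p)
  have hBf : ∫⁻ v in B, f v ∂μ ≤ ENNReal.ofReal (C * ∑ p ∈ P, w p) * μ B := by
    rw [lintegral_finsetSum _ fun p _ => measurable_const.indicator (hcl p), Finset.mul_sum,
      ENNReal.ofReal_sum_of_nonneg fun p hp => mul_nonneg (by linarith) (hw p hp), Finset.sum_mul]
    refine Finset.sum_le_sum fun p hp => ?_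
    rw [lintegral_indicator_const (hcl p), one_mul, Measure.restrict_apply (hcl p), Set.inter_comm]
    exact hbad p hp
  obtain ⟨v, hv, hle⟩ := exists_le_setLAverage (μ := μ) (s := B) hB0 hB1 hfm.aemeasurable
  refine ⟨v, by simpa [B] using hv, ?_⟩
  have h1 : f v = ((P.filter fun p => ‖T p v‖ ≤ δ).card : ENNReal) := by
    simp [f, Set.indicator_apply, Finset.sum_boole]
  rw [setLAverage_eq, h1] at hle
  have h2 := hle.trans (ENNReal.div_le_of_le_mul hBf)
  rwa [← ENNReal.ofReal_natCast, ENNReal.ofReal_le_ofReal_iff] at h2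
  exact mul_nonneg (by linarith) (Finset.sum_nonneg hw)

end

section

variable {E : Type*} [NormedRing E] [NormedAlgebra ℝ E] [FiniteDimensional ℝ E]
  {ι : Type*} [Fintype ι] [DecidableEq ι]

lemma exists_sum_mul_mul_eq_one_norm_le [IsSimpleRing E] (b : Module.Basis ι ℝ E) :
    ∃ C > 0, ∀ h : E, h ≠ 0 → ∃ x : ι → E, ∑ l, x l * h * b l = 1 ∧ ∀ l, ‖x l‖ ≤ C / ‖h‖ := by
  have := FiniteDimensional.complete ℝ E
  have := FiniteDimensional.proper ℝ E
  obtain ⟨C, hC⟩ : ∃ C, ∀ h ∈ sphere (0 : E) 1, ∃ x : ι → E, ∑ l, x l * h * b l = 1 ∧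
      ∀ l, ‖x l‖ ≤ C := by
    refine (isCompact_sphere (0 : E) 1).induction_on (p := fun s => ∃ C, ∀ h ∈ s, ∃ x : ι → E,
      ∑ l, x l * h * b l = 1 ∧ ∀ l, ‖x l‖ ≤ C) ⟨0, by simp⟩ ?_ ?_ ?_
    · rintro s t hst ⟨C, hC⟩
      exact ⟨C, fun h hh => hC h (hst hh)⟩
    · rintro s t ⟨C, hC⟩ ⟨C', hC'⟩
      refine ⟨max C C', fun h hh => ?_⟩
      rcases hh with hh | hh
      · obtain ⟨x, h1, h2⟩ := hC h hh
        exact ⟨x, h1, fun l => (h2 l).trans (le_max_left _ _)⟩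
      · obtain ⟨x, h1, h2⟩ := hC' h hh
        exact ⟨x, h1, fun l => (h2 l).trans (le_max_right _ _)⟩
    · intro h hh
      have hh0 : h ≠ 0 := by
        rintro rfl
        simp at hh
      obtain ⟨x, hx⟩ := exists_sum_mul_mul_eq_one b hh0
      let y : E → E := fun g => ∑ l, x l * g * b l
      have hy : Tendsto y (𝓝 h) (𝓝 ((1 : Eˣ) : E)) := by
        rw [Units.val_one, ← hx]
        exact (by fun_prop : Continuous y).tendsto h
      have hbd := ((NormedRing.inverse_continuousAt (1 : Eˣ)).tendsto.comp hy).norm.eventually_lt_const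
        (lt_add_one _)
      have hunit : ∀ᶠ g in 𝓝 h, IsUnit (y g) := hy.eventually (Units.nhds 1)
      refine ⟨_, mem_nhdsWithin_of_mem_nhds (hbd.and hunit),
        (‖Ring.inverse ((1 : Eˣ) : E)‖ + 1) * ∑ l, ‖x l‖, ?_⟩
      rintro g ⟨h1, h2⟩
      refine ⟨fun l => Ring.inverse (y g) * x l, ?_, fun l => ?_⟩
      · calc _ = Ring.inverse (y g) * y g := by simp only [y, Finset.mul_sum, mul_assoc]
          _ = 1 := Ring.inverse_mul_cancel _ h2
      · refine (norm_mul_le _ _).trans ?_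
        gcongr
        · exact h1.le
        · exact Finset.single_le_sum (f := fun l => ‖x l‖) (fun _ _ => norm_nonneg _)
            (Finset.mem_univ l)
  refine ⟨max C 1, by positivity, fun h hh => ?_⟩
  have hh' := norm_pos_iff.2 hh
  obtain ⟨x, h1, h2⟩ := hC (‖h‖⁻¹ • h) (by simp [norm_smul, hh'.ne'])
  refine ⟨fun l => ‖h‖⁻¹ • x l, ?_, fun l => ?_⟩
  · rw [← h1]
    simp only [smul_mul_assoc, mul_smul_comm]
  · rw [norm_smul, norm_inv, norm_norm, div_eq_inv_mul]
    gcongr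
    exact (h2 l).trans (le_max_left _ _)

/-- Linear combinations of the entries of `s` with two-sided coefficients, as a function of the
left coefficients. -/
noncomputable def combMap (b : Module.Basis ι ℝ E) {k : ℕ} (s : Fin k → E) : (Fin k × ι → E) →ₗ[ℝ] E :=
  ∑ i, ∑ l, LinearMap.mulRight ℝ (s i * b l) ∘ₗ LinearMap.proj (i, l)

lemma combMap_apply (b : Module.Basis ι ℝ E) {k : ℕ} (s : Fin k → E) (θ : Fin k × ι → E) :
    combMap b s θ = ∑ i, ∑ l, θ (i, l) * (s i * b l) := by
  simp [combMap, mul_assoc]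

lemma combMap_sub (b : Module.Basis ι ℝ E) {k : ℕ} (s t : Fin k → E) (θ : Fin k × ι → E) :
    combMap b (s - t) θ = combMap b s θ - combMap b t θ := by
  simp only [combMap_apply, Pi.sub_apply, sub_mul, mul_sub, Finset.sum_sub_distrib]

lemma exists_combMap_eq [IsSimpleRing E] (b : Module.Basis ι ℝ E) :
    ∃ C > 0, ∀ (k : ℕ) (s : Fin k → E) (i : Fin k), s i ≠ 0 → ∀ y, ∃ θ,
      combMap b s θ = y ∧ ‖θ‖ ≤ C / ‖s i‖ * ‖y‖ := by
  obtain ⟨C, hC, h⟩ := exists_sum_mul_mul_eq_one_norm_le b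
  refine ⟨C, hC, fun k s i hi y => ?_⟩
  obtain ⟨x, h1, h2⟩ := h (s i) hi
  refine ⟨fun p => if p.1 = i then y * x p.2 else 0, ?_, ?_⟩
  · rw [combMap_apply, Finset.sum_eq_single i]
    · simp only [if_true, mul_assoc]
      rw [← Finset.mul_sum]
      simp only [← mul_assoc, h1, mul_one]
    · intro j _ hj
      simp [hj]
    · simp
  · have : 0 ≤ C / ‖s i‖ * ‖y‖ := by positivity
    refine (pi_norm_le_iff_of_nonneg this).2 fun p => ?_
    split_ifs
    · refine (norm_mul_le _ _).trans ?_
      rw [mul_comm]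
      gcongr
      exact h2 _
    · simpa using this

end

section

variable {V : Type*} [NormedAddCommGroup V]

lemma CovBy.exists_norm_le {K δ : ℝ} {S : Set V} (h : CovBy K S (closedBall 0 δ)) :
    ∃ R, 0 ≤ R ∧ ∀ s ∈ S, ‖s‖ ≤ R := by
  obtain ⟨X, -, h⟩ := h
  refine ⟨∑ x ∈ X, ‖x‖ + |δ|, by positivity, fun s hs => ?_⟩
  obtain ⟨x, hx, y, hy, rfl⟩ := h hs
  refine (norm_add_le _ _).trans (add_le_add ?_ ?_)
  · exact Finset.single_le_sum (f := fun x => ‖x‖) (fun _ _ => norm_nonneg _) hx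
  · exact (mem_closedBall_zero_iff.1 hy).trans (le_abs_self _)

end

section

variable {E : Type*} [NormedRing E] [NormedAlgebra ℝ E] [FiniteDimensional ℝ E]
  {δ : ℕ → ℝ} [hδ : IsScale δ] {κ σ : ℝ} {A : ℕ → Set E} {N : ℕ → ℝ}

/-- Separated subsets satisfy a Frostman condition. -/
lemma Setup.exists_frostman (hA : Setup δ κ σ A N) : ∃ S : ℕ → Finset E,
    (∀ n, (S n : Set E) ⊆ A n) ∧ (∀ n, (S n).Nonempty) ∧ ∀ η : ℝ, 0 < η → ∀ᶠ n in hyp,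
      ∀ x ρ, δ n ≤ ρ → (((S n).filter fun s => ‖x - s‖ ≤ ρ).card : ℝ) ≤
        δ n ^ (-η) * ρ ^ κ * (S n).card := by
  classical
  have hbd : ∀ n, ∃ R, 0 ≤ R ∧ ∀ a ∈ A n, ‖a‖ ≤ R := fun n => (hA.cov n).1.exists_norm_le
  choose R hR0 hR using hbd
  choose S hS1 hS2 hS3 using fun n => exists_separated_cover (δ := 2 * δ n) (S := A n)
    (mul_pos two_pos (hδ.pos n)) (hR0 n) (hR n)
  have hSN : ∀ n, N n ≤ (S n).card * 5 ^ Module.finrank ℝ E := fun n => by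
    have h1 : CovBy (S n).card (A n) (closedBall 0 (2 * δ n)) := ⟨S n, le_rfl, hS3 n⟩
    have h2 := (hA.cov n).2 _ (h1.rescale (hδ.pos n) zero_le_two)
    norm_num at h2
    exact h2
  refine ⟨S, hS1, fun n => ?_, fun η hη => ?_⟩
  · obtain ⟨a, ha⟩ := hA.nonempty n
    obtain ⟨s, hs, -⟩ := hS3 n ha
    exact ⟨s, hs⟩
  filter_upwards [hA.add (η / 3) (by positivity), hA.lower (η / 3) (by positivity),
    eventually_const_le (δ := δ) (5 ^ Module.finrank ℝ E * 4 ^ κ) (by positivity : 0 < η / 3)]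
    with n hadd hlow hC x ρ hρ
  have hδn := hδ.pos n
  have hρ0 : 0 < ρ := hδn.trans_le hρ
  obtain ⟨P, hP1, hP2, hP3⟩ := exists_separated_cover (δ := 4 * ρ) (S := A n)
    (by positivity) (hR0 n) (hR n)
  set F := (S n).filter fun s => ‖x - s‖ ≤ ρ with hF
  have hP4 := hlow (4 * ρ) (by linarith) P.card ⟨P, le_rfl, hP3⟩
  have hFs : ∀ f ∈ F, f ∈ S n ∧ ‖x - f‖ ≤ ρ := fun f hf => Finset.mem_filter.1 hf
  have hsep : ∀ p ∈ P, ∀ f ∈ F, ∀ p' ∈ P, ∀ f' ∈ F, (p, f) ≠ (p', f') →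
      2 * δ n < dist (p + f) (p' + f') := by
    intro p hp f hf p' hp' f' hf' hne
    by_cases hpp : p = p'
    · subst hpp
      rw [dist_add_left]
      exact hS2 n (hFs f hf).1 (hFs f' hf').1 fun h => hne (by rw [h])
    · have h1 : 4 * ρ < ‖p - p'‖ := by
        rw [← dist_eq_norm]
        exact hP2 hp hp' hpp
      have h2 := (hFs f hf).2
      have h3 := (hFs f' hf').2
      rw [dist_eq_norm]
      have h4 : p - p' = (p + f - (p' + f')) + (x - f) - (x - f') := by abel
      have h5 := norm_sub_le ((p + f - (p' + f')) + (x - f)) (x - f')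
      have h6 := norm_add_le (p + f - (p' + f')) (x - f)
      rw [← h4] at h5
      linarith
  let Y := (P ×ˢ F).image fun q => q.1 + q.2
  have hYc : Y.card = P.card * F.card := by
    rw [← Finset.card_product]
    refine Finset.card_image_of_injOn fun q hq q' hq' h => ?_
    by_contra hne
    obtain ⟨h1, h2⟩ := Finset.mem_product.1 hq
    obtain ⟨h3, h4⟩ := Finset.mem_product.1 hq'
    have := hsep q.1 h1 q.2 h2 q'.1 h3 q'.2 h4 hne
    rw [h, dist_self] at this
    linarith
  have hY := hadd.card_le (Y := Y) (by
    intro y hy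
    obtain ⟨q, hq, rfl⟩ := Finset.mem_image.1 (Finset.mem_coe.1 hy)
    obtain ⟨h1, h2⟩ := Finset.mem_product.1 hq
    exact ⟨q.1, hP1 h1, q.2, hS1 n (hFs _ h2).1, rfl⟩) (by
    intro y hy y' hy' hne
    obtain ⟨q, hq, rfl⟩ := Finset.mem_image.1 (Finset.mem_coe.1 hy)
    obtain ⟨q', hq', rfl⟩ := Finset.mem_image.1 (Finset.mem_coe.1 hy')
    obtain ⟨h1, h2⟩ := Finset.mem_product.1 hq
    obtain ⟨h3, h4⟩ := Finset.mem_product.1 hq'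
    exact hsep q.1 h1 q.2 h2 q'.1 h3 q'.2 h4 fun h => hne (by
      rw [(Prod.ext_iff.1 h).1, (Prod.ext_iff.1 h).2]))
  rw [hYc, Nat.cast_mul] at hY
  have e1 : δ n ^ (η / 3) * (4 * ρ) ^ (-κ) * F.card ≤
      δ n ^ (-(η / 3)) * ((S n).card * 5 ^ Module.finrank ℝ E) := by
    refine (mul_le_mul_of_nonneg_right hP4 (Nat.cast_nonneg _)).trans (hY.trans ?_)
    have := hSN n
    have := Real.rpow_nonneg hδn.le (-(η / 3))
    gcongr
  have e2 : δ n ^ (-(η / 3)) * (δ n ^ (η / 3)) = 1 := by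
    rw [← Real.rpow_add hδn]; simp
  have e3 : (4 * ρ) ^ κ * (4 * ρ) ^ (-κ) = 1 := by
    rw [← Real.rpow_add (by positivity)]; simp
  calc (F.card : ℝ) = δ n ^ (-(η / 3)) * (4 * ρ) ^ κ *
        (δ n ^ (η / 3) * (4 * ρ) ^ (-κ) * F.card) := by
        linear_combination (-(F.card : ℝ) * ((4 * ρ) ^ κ * (4 * ρ) ^ (-κ))) * e2 - F.card * e3
    _ ≤ δ n ^ (-(η / 3)) * (4 * ρ) ^ κ *
        (δ n ^ (-(η / 3)) * ((S n).card * 5 ^ Module.finrank ℝ E)) := by gcongr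
    _ = δ n ^ (-(η / 3)) * δ n ^ (-(η / 3)) * (5 ^ Module.finrank ℝ E * 4 ^ κ) *
        ρ ^ κ * (S n).card := by
        rw [Real.mul_rpow (by norm_num) hρ0.le]; ring
    _ ≤ δ n ^ (-(η / 3)) * δ n ^ (-(η / 3)) * δ n ^ (-(η / 3)) * ρ ^ κ * (S n).card := by gcongr
    _ = _ := by
        rw [← Real.rpow_add hδn, ← Real.rpow_add hδn]
        congr 3
        ring

end

section

lemma exists_dyadic_level {δ u : ℝ} (hδ : 0 < δ) (hδ1 : δ < 1) (hu : δ ≤ u) (hu1 : u < 1) {M : ℕ}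
    (hM : 0 < M) : ∃ m : ℕ, m ≤ M ∧ u ≤ δ ^ ((m : ℝ) / M) ∧ δ ^ (((m : ℝ) + 1) / M) ≤ u := by
  have hu0 : 0 < u := hδ.trans_le hu
  have hlog : Real.log δ < 0 := Real.log_neg hδ hδ1
  have hM' : (0 : ℝ) < M := by exact_mod_cast hM
  set v := Real.log u / Real.log δ with hv
  have hv0 : 0 ≤ v := div_nonneg_of_nonpos (Real.log_neg hu0 hu1).le hlog.le
  have hv1 : v ≤ 1 := by
    rw [hv, div_le_one_of_neg hlog]
    exact Real.log_le_log hδ hu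
  have huv : u = δ ^ v := by
    rw [Real.rpow_def_of_pos hδ, hv, mul_div_cancel₀ _ hlog.ne, Real.exp_log hu0]
  refine ⟨⌊v * M⌋₊, ?_, ?_, ?_⟩
  · refine Nat.floor_le_of_le ?_
    nlinarith
  · rw [huv]
    refine Real.rpow_le_rpow_of_exponent_ge hδ hδ1.le ?_
    rw [div_le_iff₀ hM']
    exact Nat.floor_le (by positivity)
  · rw [huv]
    refine Real.rpow_le_rpow_of_exponent_ge hδ hδ1.le ?_
    rw [le_div_iff₀ hM']
    exact (Nat.lt_floor_add_one _).le

variable {V : Type*} [NormedAddCommGroup V]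

/-- Riesz energy bound for sets satisfying a Frostman condition. -/
lemma sum_riesz_le {δ κ α K : ℝ} (hδ : 0 < δ) (hδ1 : δ < 1) (hα : 0 ≤ α) (hακ : α ≤ κ)
    (hK : 0 ≤ K) (S : Finset V) (x : V)
    (hS : ∀ ρ, δ ≤ ρ → ((S.filter fun s => ‖x - s‖ ≤ ρ).card : ℝ) ≤ K * ρ ^ κ * S.card)
    {M : ℕ} (hM : 0 < M) :
    ∑ s ∈ S, (δ / max ‖x - s‖ δ) ^ α ≤ (1 + (M + 1) * (K * δ ^ (-(α / M)))) * δ ^ α * S.card := by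
  have hM' : (0 : ℝ) < M := by exact_mod_cast hM
  have hpt : ∀ s ∈ S, (δ / max ‖x - s‖ δ) ^ α ≤ δ ^ α + ∑ m ∈ Finset.range (M + 1),
      if ‖x - s‖ ≤ δ ^ ((m : ℝ) / M) then (δ / δ ^ (((m : ℝ) + 1) / M)) ^ α else 0 := by
    intro s _
    have hnn : ∀ m ∈ Finset.range (M + 1), 0 ≤
        if ‖x - s‖ ≤ δ ^ ((m : ℝ) / M) then (δ / δ ^ (((m : ℝ) + 1) / M)) ^ α else 0 := by
      intro m _
      split_ifs <;> positivity
    have hm0 : 0 < max ‖x - s‖ δ := lt_max_of_lt_right hδ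
    rcases le_or_gt 1 (max ‖x - s‖ δ) with h | h
    · have : (δ / max ‖x - s‖ δ) ^ α ≤ δ ^ α := by
        refine Real.rpow_le_rpow (by positivity) (div_le_self hδ.le h) hα
      linarith [Finset.sum_nonneg hnn]
    · obtain ⟨m, h1, h2, h3⟩ := exists_dyadic_level hδ hδ1 (le_max_right _ _) h hM
      have h4 := Finset.single_le_sum hnn (Finset.mem_range.2 (Nat.lt_succ_of_le h1))
      rw [if_pos ((le_max_left _ _).trans h2)] at h4
      refine le_trans (Real.rpow_le_rpow (by positivity) ?_ hα) (h4.trans ?_)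
      · gcongr
      · have := Real.rpow_nonneg hδ.le α
        linarith
  refine (Finset.sum_le_sum hpt).trans ?_
  rw [Finset.sum_add_distrib, Finset.sum_comm, Finset.sum_const, nsmul_eq_mul]
  have hlev : ∀ m ∈ Finset.range (M + 1),
      (∑ s ∈ S, if ‖x - s‖ ≤ δ ^ ((m : ℝ) / M) then (δ / δ ^ (((m : ℝ) + 1) / M)) ^ α else 0) ≤
      K * δ ^ (-(α / M)) * δ ^ α * S.card := by
    intro m hm
    have hmM : (m : ℝ) ≤ M := by exact_mod_cast Nat.lt_succ_iff.1 (Finset.mem_range.1 hm)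
    rw [← Finset.sum_filter, Finset.sum_const, nsmul_eq_mul]
    have h1 : δ ≤ δ ^ ((m : ℝ) / M) := by
      conv_lhs => rw [← Real.rpow_one δ]
      exact Real.rpow_le_rpow_of_exponent_ge hδ hδ1.le (div_le_one_of_le₀ hmM hM'.le)
    have h2 : δ ^ ((m : ℝ) / M) ≤ 1 := Real.rpow_le_one hδ.le hδ1.le (by positivity)
    have h3 : (δ ^ ((m : ℝ) / M)) ^ κ ≤ (δ ^ ((m : ℝ) / M)) ^ α :=
      Real.rpow_le_rpow_of_exponent_ge (by positivity) h2 hακ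
    calc _ ≤ (K * (δ ^ ((m : ℝ) / M)) ^ α * S.card) * (δ / δ ^ (((m : ℝ) + 1) / M)) ^ α := by
          gcongr
          exact (hS _ h1).trans (by gcongr)
      _ = K * (δ ^ ((m : ℝ) / M) * (δ / δ ^ (((m : ℝ) + 1) / M))) ^ α * S.card := by
          rw [Real.mul_rpow (by positivity) (by positivity)]; ring
      _ = K * (δ ^ (-(1 / M : ℝ)) * δ) ^ α * S.card := by
          congr 3
          rw [div_eq_mul_inv δ, ← Real.rpow_neg hδ.le, mul_left_comm, ← Real.rpow_add hδ, mul_comm]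
          congr 2
          ring
      _ = _ := by
          rw [Real.mul_rpow (by positivity) hδ.le, ← Real.rpow_mul hδ.le]
          rw [show -(1 / (M : ℝ)) * α = -(α / M) by ring]
          ring
  refine (add_le_add le_rfl (Finset.sum_le_sum hlev)).trans (le_of_eq ?_)
  rw [Finset.sum_const, nsmul_eq_mul, Finset.card_range]
  push_cast
  ring

end

section

variable {E : Type*} [NormedRing E] [NormedAlgebra ℝ E] [FiniteDimensional ℝ E]
  {δ : ℕ → ℝ} [hδ : IsScale δ] {κ σ : ℝ} {A : ℕ → Set E} {N : ℕ → ℝ} {ι : Type*} [Fintype ι]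
  [DecidableEq ι]

/-- The words of length `k` over `S`. -/
def words {V : Type*} [DecidableEq V] (k : ℕ) (S : Finset V) : Finset (Fin k → V) :=
  Fintype.piFinset fun _ => S

open Classical in
/-- The number of pairs of words with nearby combinations. -/
noncomputable def energy (b : Module.Basis ι ℝ E) (k : ℕ) (S : Finset E) (θ : Fin k × ι → E)
    (δ : ℝ) : ℕ :=
  ((words k S ×ˢ words k S).filter fun p => ‖combMap b p.1 θ - combMap b p.2 θ‖ ≤ δ).card

open Classical in
lemma exists_energy_le [IsSimpleRing E] (b : Module.Basis ι ℝ E) {k : ℕ} (hk : 0 < k) :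
    ∃ C : ℝ, 1 ≤ C ∧ ∀ (S : Finset E) (δ B : ℝ), 0 < δ →
      (∀ x ∈ S, ∑ s ∈ S, (δ / max ‖x - s‖ δ) ^ ((Module.finrank ℝ E : ℝ) / k) ≤ B) →
      ∃ θ : Fin k × ι → E, ‖θ‖ ≤ 1 ∧ (energy b k S θ δ : ℝ) ≤ C * (S.card ^ k * B ^ k) := by
  obtain ⟨C, hC, hcomb⟩ := exists_combMap_eq b
  set d := Module.finrank ℝ E with hd
  set D := Module.finrank ℝ (Fin k × ι → E)
  have hk' : (0 : ℝ) < k := by exact_mod_cast hk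
  refine ⟨max 1 (2 ^ D * (2 * C) ^ d), le_max_left _ _, fun S δ B hδ hB => ?_⟩
  let w : (Fin k → E) × (Fin k → E) → ℝ :=
    fun p => ∏ i, (δ / max ‖p.1 i - p.2 i‖ δ) ^ ((d : ℝ) / k)
  have hpos : ∀ x : E, 0 < max ‖x‖ δ := fun x => lt_max_of_lt_right hδ
  obtain ⟨θ, h1, h2⟩ := exists_card_filter_norm_le (words k S ×ˢ words k S)
    (fun p => combMap b (p.1 - p.2)) w hδ (le_max_left 1 (2 ^ D * (2 * C) ^ d))
    (fun p _ => Finset.prod_nonneg fun i _ => Real.rpow_nonneg (div_nonneg hδ.le (hpos _).le) _)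
    (by
      intro p _
      by_cases hp : ∀ i, ‖p.1 i - p.2 i‖ ≤ δ
      · left
        simp [w, hp, hδ.ne']
      · right
        push Not at hp
        obtain ⟨i0, hi0⟩ := hp
        obtain ⟨i, -, hi⟩ := Finset.exists_max_image Finset.univ
          (fun i => ‖p.1 i - p.2 i‖) ⟨i0, Finset.mem_univ _⟩
        have hiδ : δ < ‖p.1 i - p.2 i‖ := hi0.trans_le (hi i0 (Finset.mem_univ _))
        have hi1 : 0 < ‖p.1 i - p.2 i‖ := hδ.trans hiδ
        refine ⟨C / ‖p.1 i - p.2 i‖, by positivity,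
          hcomb k (p.1 - p.2) i (norm_pos_iff.1 hi1), ?_⟩
        have hw : (δ / ‖p.1 i - p.2 i‖) ^ d ≤ w p := by
          calc (δ / ‖p.1 i - p.2 i‖) ^ d
              = ∏ _j : Fin k, (δ / ‖p.1 i - p.2 i‖) ^ ((d : ℝ) / k) := by
                rw [Finset.prod_const, Finset.card_univ, Fintype.card_fin, ← Real.rpow_natCast,
                  ← Real.rpow_natCast, ← Real.rpow_mul (by positivity)]
                congr 1
                field_simp
            _ ≤ w p := by
                refine Finset.prod_le_prod (fun _ _ => by positivity) fun j _ => ?_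
                have : max ‖p.1 j - p.2 j‖ δ ≤ ‖p.1 i - p.2 i‖ :=
                  max_le (hi j (Finset.mem_univ _)) hiδ.le
                have := hpos (p.1 j - p.2 j)
                gcongr
        calc 2 ^ D * (2 * δ * (C / ‖p.1 i - p.2 i‖)) ^ d
            = 2 ^ D * (2 * C) ^ d * (δ / ‖p.1 i - p.2 i‖) ^ d := by
              rw [mul_assoc (2 ^ D : ℝ), ← mul_pow]; congr 2; ring
          _ ≤ _ := by
              gcongr
              exact le_max_right _ _)
  refine ⟨θ, h1, ?_⟩
  have h3 : ∑ p ∈ words k S ×ˢ words k S, w p ≤ S.card ^ k * B ^ k := by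
    rw [Finset.sum_product]
    have : ∀ s ∈ words k S, ∑ t ∈ words k S, w (s, t) ≤ B ^ k := by
      intro s hs
      simp only [w, words]
      rw [← Finset.prod_univ_sum (fun _ => S)
        (fun i a => (δ / max ‖s i - a‖ δ) ^ ((d : ℝ) / k))]
      calc _ ≤ ∏ _i : Fin k, B := Finset.prod_le_prod
            (fun i _ => Finset.sum_nonneg fun a _ =>
              Real.rpow_nonneg (div_nonneg hδ.le (hpos _).le) _)
            fun i _ => hB (s i) (Fintype.mem_piFinset.1 hs i)
        _ = B ^ k := by simp
    refine (Finset.sum_le_sum this).trans (le_of_eq ?_)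
    simp [words]
  have h4 : energy b k S θ δ =
      ((words k S ×ˢ words k S).filter fun p => ‖combMap b (p.1 - p.2) θ‖ ≤ δ).card := by
    simp only [energy, combMap_sub]
  rw [h4]
  refine h2.trans ?_
  gcongr

/-- Combinations of many elements of `A n` have nearly maximal dimension. -/
theorem Setup.exists_energy_le [IsSimpleRing E] (hA : Setup δ κ σ A N) (hκ : 0 < κ)
    (b : Module.Basis ι ℝ E) :
    ∃ (k : ℕ) (S : ℕ → Finset E) (θ : ℕ → Fin k × ι → E), (∀ n, (S n : Set E) ⊆ A n) ∧
      (∀ n, (S n).Nonempty) ∧ (∀ n, ‖θ n‖ ≤ 1) ∧ ∀ η : ℝ, 0 < η → ∀ᶠ n in hyp,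
        (energy b k (S n) (θ n) (δ n) : ℝ) ≤
          δ n ^ ((Module.finrank ℝ E : ℝ) - η) * ((S n).card : ℝ) ^ (2 * k) := by
  set d := Module.finrank ℝ E with hd
  obtain ⟨k, hk⟩ := exists_nat_gt ((d : ℝ) / κ)
  have hk' : (0 : ℝ) < k := lt_of_le_of_lt (by positivity) hk
  have hk0 : 0 < k := by exact_mod_cast hk'
  have hακ : (d : ℝ) / k ≤ κ := by
    rw [div_lt_iff₀ hκ] at hk
    rw [div_le_iff₀ hk']
    linarith
  obtain ⟨S, hS1, hS2, hS3⟩ := hA.exists_frostman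
  obtain ⟨C, hC, hCe⟩ := SumProduct.exists_energy_le b hk0
  have hnn : ∀ n (x s : E), 0 ≤ (δ n / max ‖x - s‖ (δ n)) ^ ((d : ℝ) / k) := fun n x s =>
    Real.rpow_nonneg (div_nonneg (hδ.pos n).le ((hδ.pos n).le.trans (le_max_right _ _))) _
  obtain ⟨B, hB1, hB2⟩ : ∃ B : ℕ → ℝ, (∀ n, ∀ x ∈ S n,
      ∑ s ∈ S n, (δ n / max ‖x - s‖ (δ n)) ^ ((d : ℝ) / k) ≤ B n) ∧ ∀ n, ∃ x ∈ S n,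
      B n = ∑ s ∈ S n, (δ n / max ‖x - s‖ (δ n)) ^ ((d : ℝ) / k) := by
    choose x hx hxm using fun n => Finset.exists_max_image (S n)
      (fun x => ∑ s ∈ S n, (δ n / max ‖x - s‖ (δ n)) ^ ((d : ℝ) / k)) (hS2 n)
    exact ⟨_, fun n y hy => hxm n y hy, fun n => ⟨x n, hx n, rfl⟩⟩
  choose θ hθ1 hθ2 using fun n => hCe (S n) (δ n) (B n) (hδ.pos n) (hB1 n)
  refine ⟨k, S, θ, hS1, hS2, hθ1, fun η hη => ?_⟩
  obtain ⟨η', hη', hpow⟩ := eventually_const_mul_pow_le (δ := δ) C k hη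
  obtain ⟨M, hM⟩ := exists_nat_gt (((d : ℝ) / k) / (η' / 4))
  have hM' : (0 : ℝ) < M := lt_of_le_of_lt (by positivity) hM
  have hM4 : ((d : ℝ) / k) / M ≤ η' / 4 := by
    rw [div_lt_iff₀ (by positivity)] at hM
    rw [div_le_iff₀ hM']
    linarith
  filter_upwards [hpow, hS3 (η' / 4) (by positivity),
    eventually_const_le (δ := δ) ((M : ℝ) + 2) (by positivity : 0 < η' / 2)] with n h1 h2 h3
  have hδn := hδ.pos n
  have hBn : B n ≤ δ n ^ (-η') * δ n ^ ((d : ℝ) / k) * (S n).card := by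
    obtain ⟨x, -, hx⟩ := hB2 n
    rw [hx]
    refine (sum_riesz_le hδn (hδ.lt_one n) (by positivity) hακ (Real.rpow_nonneg hδn.le _) (S n) x
      (h2 x) (by exact_mod_cast hM' : 0 < M)).trans ?_
    gcongr
    have e1 : δ n ^ (-(η' / 4)) * δ n ^ (-(((d : ℝ) / k) / M)) ≤ δ n ^ (-(η' / 2)) := by
      rw [← Real.rpow_add hδn]
      refine scale_rpow_le (δ := δ) ?_ n
      linarith
    have e2 : 1 ≤ δ n ^ (-(η' / 2)) :=
      Real.one_le_rpow_of_pos_of_le_one_of_nonpos hδn (hδ.lt_one n).le (by linarith)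
    calc 1 + ((M : ℝ) + 1) * (δ n ^ (-(η' / 4)) * δ n ^ (-(((d : ℝ) / k) / M)))
        ≤ δ n ^ (-(η' / 2)) + (M + 1) * δ n ^ (-(η' / 2)) := by gcongr
      _ = (M + 2) * δ n ^ (-(η' / 2)) := by ring
      _ ≤ δ n ^ (-(η' / 2)) * δ n ^ (-(η' / 2)) := by gcongr
      _ = _ := by rw [← Real.rpow_add hδn]; congr 1; ring
  have hB0 : 0 ≤ B n := by
    obtain ⟨x, -, hx⟩ := hB2 n
    rw [hx]
    exact Finset.sum_nonneg fun s _ => hnn n x s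
  have e3 : (δ n ^ ((d : ℝ) / k)) ^ k = δ n ^ (d : ℝ) := by
    rw [← Real.rpow_natCast, ← Real.rpow_mul hδn.le]
    congr 1
    field_simp
  calc _ ≤ C * ((S n).card ^ k * B n ^ k) := hθ2 n
    _ ≤ C * ((S n).card ^ k * (δ n ^ (-η') * δ n ^ ((d : ℝ) / k) * (S n).card) ^ k) := by
        gcongr
    _ = (C * (δ n ^ (-η')) ^ k) * δ n ^ (d : ℝ) * ((S n).card : ℝ) ^ (2 * k) := by
        rw [mul_pow, mul_pow, e3]; ring
    _ ≤ δ n ^ (-η) * δ n ^ (d : ℝ) * ((S n).card : ℝ) ^ (2 * k) := by gcongr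
    _ = _ := by
        rw [← Real.rpow_add hδn]; congr 2; ring

end

open Classical in
/-- Cauchy–Schwarz inequality for the number of pairs of nearby points. -/
lemma card_sq_le_mul_card {α V : Type*} [NormedAddCommGroup V] (P : Finset α) (f : α → V)
    {K δ : ℝ} (h : CovBy K (f '' P) (closedBall 0 (δ / 2))) :
    (P.card : ℝ) ^ 2 ≤ K * ((P ×ˢ P).filter fun p => ‖f p.1 - f p.2‖ ≤ δ).card := by
  obtain ⟨X, hX, h⟩ := h
  have : ∀ p ∈ P, ∃ x ∈ X, ‖f p - x‖ ≤ δ / 2 := by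
    intro p hp
    obtain ⟨x, hx, y, hy, hxy⟩ := h ⟨p, hp, rfl⟩
    refine ⟨x, hx, ?_⟩
    rw [← hxy, add_sub_cancel_left]
    simpa using hy
  choose! g hg hgf using this
  set Q := (P ×ˢ P).filter fun p => ‖f p.1 - f p.2‖ ≤ δ
  have h1 : P.card = ∑ x ∈ X, (P.filter fun p => g p = x).card :=
    Finset.card_eq_sum_card_fiberwise hg
  have h2 : ∑ x ∈ X, (P.filter fun p => g p = x).card ^ 2 ≤ Q.card := by
    rw [Finset.card_eq_sum_card_fiberwise (f := fun p => g p.1) (t := X) (s := Q)]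
    · refine Finset.sum_le_sum fun x hx => ?_
      rw [sq, ← Finset.card_product]
      refine Finset.card_le_card fun p hp => ?_
      obtain ⟨hp1, hp2⟩ := Finset.mem_product.1 hp
      obtain ⟨hp1, hp1'⟩ := Finset.mem_filter.1 hp1
      obtain ⟨hp2, hp2'⟩ := Finset.mem_filter.1 hp2
      refine Finset.mem_filter.2 ⟨Finset.mem_filter.2 ⟨Finset.mem_product.2 ⟨hp1, hp2⟩, ?_⟩, hp1'⟩
      have e1 := hgf _ hp1
      have e2 := hgf _ hp2
      rw [hp1'] at e1
      rw [hp2', ← norm_neg, neg_sub] at e2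
      have := norm_add_le (f p.1 - x) (x - f p.2)
      rw [sub_add_sub_cancel] at this
      linarith
    · intro p hp
      exact hg _ (Finset.mem_product.1 (Finset.mem_filter.1 hp).1).1
  have h3 : (P.card : ℝ) ^ 2 ≤ X.card * Q.card := by
    have := sq_sum_le_card_mul_sum_sq (s := X)
      (f := fun x => ((P.filter fun p => g p = x).card : ℝ))
    rw [← Nat.cast_sum, ← h1] at this
    refine this.trans ?_
    gcongr
    exact_mod_cast h2
  refine h3.trans ?_
  gcongr

section

variable {E : Type*} [NormedRing E] [NormedAlgebra ℝ E] [FiniteDimensional ℝ E]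
  {ι : Type*} [Fintype ι] [DecidableEq ι]

lemma card_words {V : Type*} [DecidableEq V] (k : ℕ) (S : Finset V) :
    (words k S).card = S.card ^ k := by
  simp [words]

open Classical in
lemma exists_collision (b : Module.Basis ι ℝ E) {k : ℕ} {S G : Finset E} {θ : Fin k × ι → E}
    {t δ R c : ℝ} (hS : S.Nonempty) (hδ : 0 < δ) (hR : 0 ≤ R)
    (hRt : ∀ g ∈ G, ∀ s ∈ words k S, ‖t • g + combMap b s θ‖ ≤ R)
    (he : (energy b k S θ δ : ℝ) ≤ c * (S.card : ℝ) ^ (2 * k))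
    (hG : (1 + 4 * R / δ) ^ Module.finrank ℝ E * c < G.card) :
    ∃ g ∈ G, ∃ g' ∈ G, g ≠ g' ∧ ∃ s ∈ words k S, ∃ s' ∈ words k S,
      ‖t • (g - g') - combMap b (s' - s) θ‖ ≤ δ := by
  by_contra! hcon
  have h1 := card_sq_le_mul_card (δ := δ) (G ×ˢ words k S) (fun p => t • p.1 + combMap b p.2 θ)
    (((covBy_closedBall (V := E) (half_pos hδ) hR)).mono le_rfl (by
      rintro _ ⟨p, hp, rfl⟩
      obtain ⟨hp1, hp2⟩ := Finset.mem_product.1 (Finset.mem_coe.1 hp)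
      exact mem_closedBall_zero_iff.2 (hRt _ hp1 _ hp2)) subset_rfl)
  have h2 : (((G ×ˢ words k S) ×ˢ (G ×ˢ words k S)).filter fun p =>
      ‖t • p.1.1 + combMap b p.1.2 θ - (t • p.2.1 + combMap b p.2.2 θ)‖ ≤ δ).card ≤
      G.card * energy b k S θ δ := by
    rw [energy, ← Finset.card_product]
    refine Finset.card_le_card_of_injOn (fun p => (p.1.1, p.1.2, p.2.2)) ?_ ?_
    · intro p hp
      obtain ⟨hp, hle⟩ := Finset.mem_filter.1 (Finset.mem_coe.1 hp)
      simp only [Finset.mem_product] at hp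
      have : p.1.1 = p.2.1 := by
        by_contra hne
        refine absurd (hcon _ hp.1.1 _ hp.2.1 hne _ hp.1.2 _ hp.2.2) (not_lt.2 ?_)
        refine le_of_eq_of_le (congrArg norm ?_) hle
        rw [combMap_sub, smul_sub]
        abel
      rw [this, add_sub_add_left_eq_sub] at hle
      simpa [hp.1.1, hp.1.2, hp.2.2] using hle
    · intro p hp q hq hpq
      have key : ∀ p ∈ ((G ×ˢ words k S) ×ˢ (G ×ˢ words k S)).filter (fun p =>
          ‖t • p.1.1 + combMap b p.1.2 θ - (t • p.2.1 + combMap b p.2.2 θ)‖ ≤ δ),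
          p.2.1 = p.1.1 := by
        intro p hp
        obtain ⟨hp, hle⟩ := Finset.mem_filter.1 hp
        simp only [Finset.mem_product] at hp
        by_contra hne
        refine absurd (hcon _ hp.1.1 _ hp.2.1 (Ne.symm hne) _ hp.1.2 _ hp.2.2) (not_lt.2 ?_)
        refine le_of_eq_of_le (congrArg norm ?_) hle
        rw [combMap_sub, smul_sub]
        abel
      have e1 := key p (Finset.mem_coe.1 hp)
      have e2 := key q (Finset.mem_coe.1 hq)
      simp only [Prod.mk.injEq] at hpq
      obtain ⟨h1, h2, h3⟩ := hpq
      exact Prod.ext (Prod.ext h1 h2) (Prod.ext (by rw [e1, e2, h1]) h3)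
  have hSc : (0 : ℝ) < S.card := by exact_mod_cast hS.card_pos
  set K := (1 + 2 * R / (δ / 2)) ^ Module.finrank ℝ E with hK
  have hK' : K = (1 + 4 * R / δ) ^ Module.finrank ℝ E := by
    rw [hK]; congr 2; field_simp; ring
  rw [← hK'] at hG
  have hK0 : 0 ≤ K := by positivity
  rw [Finset.card_product, card_words] at h1
  push_cast at h1
  have hG0 : (0 : ℝ) < G.card := by
    by_contra hneg
    have h0 : (G.card : ℝ) = 0 := le_antisymm (not_lt.1 hneg) (Nat.cast_nonneg _)
    have : 0 ≤ c * (S.card : ℝ) ^ (2 * k) := le_trans (Nat.cast_nonneg _) he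
    have hc : 0 ≤ c := nonneg_of_mul_nonneg_left this (by positivity)
    rw [h0] at hG
    exact absurd hG (not_lt.2 (by positivity))
  have h3 : (G.card : ℝ) ^ 2 * (S.card : ℝ) ^ (2 * k) ≤
      G.card * (K * c) * (S.card : ℝ) ^ (2 * k) := by
    calc (G.card : ℝ) ^ 2 * (S.card : ℝ) ^ (2 * k) = (G.card * (S.card : ℝ) ^ k) ^ 2 := by ring
      _ ≤ K * (G.card * energy b k S θ δ : ℕ) := h1.trans (by gcongr)
      _ = K * (G.card * (energy b k S θ δ : ℝ)) := by push_cast; ring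
      _ ≤ K * (G.card * (c * (S.card : ℝ) ^ (2 * k))) := by gcongr
      _ = _ := by ring
  have h4 := le_of_mul_le_mul_right h3 (by positivity)
  rw [sq] at h4
  exact absurd (le_of_mul_le_mul_left h4 hG0) (not_le.2 hG)

end

section

variable {E : Type*} [NormedRing E] [NormedAlgebra ℝ E] [FiniteDimensional ℝ E]
  {ι : Type*} [Fintype ι] [DecidableEq ι]

lemma norm_combMap_le (b : Module.Basis ι ℝ E) {k : ℕ} (s : Fin k → E) {θ : Fin k × ι → E} {R : ℝ}
    (hθ : ‖θ‖ ≤ 1) (hs : ∀ i, ‖s i‖ ≤ R) :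
    ‖combMap b s θ‖ ≤ (k * ∑ l, ‖b l‖) * R := by
  rw [combMap_apply]
  refine (norm_sum_le _ _).trans ?_
  calc ∑ i, ‖∑ l, θ (i, l) * (s i * b l)‖ ≤ ∑ _i : Fin k, ∑ l, R * ‖b l‖ := by
        refine Finset.sum_le_sum fun i _ => (norm_sum_le _ _).trans (Finset.sum_le_sum fun l _ => ?_)
        have h1 : ‖θ (i, l)‖ ≤ 1 := (norm_le_pi_norm θ _).trans hθ
        calc ‖θ (i, l) * (s i * b l)‖ ≤ ‖θ (i, l)‖ * (‖s i‖ * ‖b l‖) :=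
              (norm_mul_le _ _).trans (by gcongr; exact norm_mul_le _ _)
          _ ≤ 1 * (R * ‖b l‖) := by gcongr; exact hs i
          _ = _ := one_mul _
    _ = _ := by simp [← Finset.mul_sum]; ring

variable {δ : ℕ → ℝ} [hδ : IsScale δ] {κ σ : ℝ} {A : ℕ → Set E} {N : ℕ → ℝ}

lemma Setup.eventually_exists_collision (hA : Setup δ κ σ A N) (hκ : 0 < κ)
    (b : Module.Basis ι ℝ E) {k : ℕ} {S : ℕ → Finset E} {θ : ℕ → Fin k × ι → E}
    (hSA : ∀ n, (S n : Set E) ⊆ A n) (hS : ∀ n, (S n).Nonempty) (hθ : ∀ n, ‖θ n‖ ≤ 1)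
    (he : ∀ η : ℝ, 0 < η → ∀ᶠ n in hyp, (energy b k (S n) (θ n) (δ n) : ℝ) ≤
      δ n ^ ((Module.finrank ℝ E : ℝ) - η) * ((S n).card : ℝ) ^ (2 * k))
    {t : ℕ → ℝ} (ht : ∀ n, |t n| ≤ 1) {s : ℝ} (hs0 : 0 < s) (hs1 : s ≤ 1) :
    ∀ᶠ n in hyp, ∃ g ∈ A n, ∃ g' ∈ A n, δ n ^ s ≤ ‖g - g'‖ ∧ ∃ u v : Fin k → E,
      (∀ i, u i ∈ A n) ∧ (∀ i, v i ∈ A n) ∧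
        ‖t n • (g - g') - combMap b (v - u) (θ n)‖ ≤ δ n := by
  classical
  set d := Module.finrank ℝ E with hd
  set M : ℝ := 1 + k * ∑ l, ‖b l‖ with hM
  have hM0 : 0 ≤ k * ∑ l, ‖b l‖ := by positivity
  set η := s * κ / 8 with hη
  have hη0 : 0 < η := by positivity
  set η' := η / (d + 1) with hη'
  have hη'0 : 0 < η' := by positivity
  have hdη : d * η' ≤ η := by
    rw [hη', mul_div_assoc', div_le_iff₀ (by positivity)]; nlinarith
  filter_upwards [he η hη0, hA.norm_le (η' / 2) (by positivity),
    hA.lower (4 * η) (by positivity),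
    eventually_const_mul_rpow_le (δ := δ) M (show -η' < -(η' / 2) by linarith),
    eventually_const_mul_rpow_le (δ := δ) (5 ^ d) (show -(3 * η) < -(2 * η) by linarith)]
    with n h1 h2 h3 h4 h5
  have hδn := hδ.pos n
  have hδ1 := hδ.lt_one n
  obtain ⟨G, hGA, hGs, hGc⟩ := exists_separated_cover (Real.rpow_pos_of_pos hδn s)
    (Real.rpow_nonneg hδn.le (-(η' / 2))) h2
  have hGcard : δ n ^ (-(4 * η)) ≤ G.card := by
    have := h3 (δ n ^ s) (by
      simpa using Real.rpow_le_rpow_of_exponent_ge hδn hδ1.le hs1) G.card ⟨G, le_rfl, hGc⟩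
    rw [← Real.rpow_mul hδn.le, ← Real.rpow_add hδn] at this
    convert this using 2
    rw [hη]; ring
  set R := δ n ^ (-η') with hR
  have hR1 : 1 ≤ R := Real.one_le_rpow_of_pos_of_le_one_of_nonpos hδn hδ1.le (by linarith)
  have hRt : ∀ g ∈ G, ∀ u ∈ words k (S n), ‖t n • g + combMap b u (θ n)‖ ≤ R := by
    intro g hg u hu
    have e1 : ‖t n • g‖ ≤ δ n ^ (-(η' / 2)) := by
      rw [norm_smul]
      calc ‖t n‖ * ‖g‖ ≤ 1 * ‖g‖ := by gcongr; exact ht n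
        _ ≤ _ := by rw [one_mul]; exact h2 g (hGA hg)
    have e2 := norm_combMap_le b u (hθ n)
      fun i => h2 _ (hSA n (Fintype.mem_piFinset.1 hu i))
    refine (norm_add_le _ _).trans (le_trans ?_ h4)
    rw [hM, add_mul, one_mul]
    exact add_le_add e1 e2
  have hG : (1 + 4 * R / δ n) ^ d * δ n ^ ((d : ℝ) - η) < G.card := by
    calc (1 + 4 * R / δ n) ^ d * δ n ^ ((d : ℝ) - η)
        ≤ (5 * (R / δ n)) ^ d * δ n ^ ((d : ℝ) - η) := by
          gcongr
          have : 1 ≤ R / δ n := by rw [le_div_iff₀ hδn]; linarith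
          rw [mul_div_assoc]; linarith
      _ = 5 ^ d * δ n ^ (-(d * η') - η) := by
          rw [mul_pow, mul_assoc, hR, ← Real.rpow_sub_one hδn.ne', ← Real.rpow_natCast (δ n ^ _),
            ← Real.rpow_mul hδn.le, ← Real.rpow_add hδn]
          congr 2; ring
      _ ≤ 5 ^ d * δ n ^ (-(2 * η)) := by
          gcongr 5 ^ d * ?_
          exact Real.rpow_le_rpow_of_exponent_ge hδn hδ1.le (by linarith)
      _ ≤ δ n ^ (-(3 * η)) := h5
      _ < δ n ^ (-(4 * η)) := Real.rpow_lt_rpow_of_exponent_gt hδn hδ1 (by linarith)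
      _ ≤ G.card := hGcard
  obtain ⟨g, hg, g', hg', hne, u, hu, v, hv, huv⟩ :=
    exists_collision b (hS n) hδn (zero_le_one.trans hR1) hRt h1 hG
  refine ⟨g, hGA hg, g', hGA hg', ?_, u, v, fun i => hSA n (Fintype.mem_piFinset.1 hu i),
    fun i => hSA n (Fintype.mem_piFinset.1 hv i), huv⟩
  rw [← dist_eq_norm]
  exact (hGs hg hg' hne).le

lemma Setup.exists_good_collision (hA : Setup δ κ σ A N) (hκ : 0 < κ)
    (b : Module.Basis ι ℝ E) {k : ℕ} {S : ℕ → Finset E} {θ : ℕ → Fin k × ι → E}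
    (hSA : ∀ n, (S n : Set E) ⊆ A n) (hS : ∀ n, (S n).Nonempty) (hθ : ∀ n, ‖θ n‖ ≤ 1)
    (he : ∀ η : ℝ, 0 < η → ∀ᶠ n in hyp, (energy b k (S n) (θ n) (δ n) : ℝ) ≤
      δ n ^ ((Module.finrank ℝ E : ℝ) - η) * ((S n).card : ℝ) ^ (2 * k))
    {t : ℕ → ℝ} (ht : ∀ n, |t n| ≤ 1) : ∃ (e : ℕ → E) (u : Fin k → ℕ → E) (r : ℕ → E),
      IsGood δ A e ∧ ¬ Small δ e ∧ (∀ i, IsGood δ A (u i)) ∧ IsGood δ A r ∧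
      ∀ n, t n • e n = combMap b (fun i => u i n) (θ n) + r n := by
  let P : ℕ → ℕ → Unit → (E × E) × (Fin k → E) × (Fin k → E) → Prop := fun n m _ z =>
    (z.1.1 ∈ A n ∧ z.1.2 ∈ A n ∧ (∀ i, z.2.1 i ∈ A n) ∧ (∀ i, z.2.2 i ∈ A n) ∧
      ‖t n • (z.1.1 - z.1.2) - combMap b (z.2.2 - z.2.1) (θ n)‖ ≤ δ n) ∧
      δ n ^ (1 / ((m : ℝ) + 1)) ≤ ‖z.1.1 - z.1.2‖
  obtain ⟨ψ, hψ⟩ := exists_diagonal (P := P) (by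
    rintro n m m' - z hm ⟨h1, h2⟩
    exact ⟨h1, (scale_rpow_le (by gcongr) n).trans h2⟩)
  have hP := hψ (fun _ => ()) fun m => by
    filter_upwards [hA.eventually_exists_collision hκ b hSA hS hθ he ht
      (s := 1 / ((m : ℝ) + 1)) (by positivity) (by
        rw [div_le_one (by positivity)]; linarith [(Nat.cast_nonneg m : (0 : ℝ) ≤ m)])] with n hn
    obtain ⟨g, hg, g', hg', hgg, u, v, hu, hv, huv⟩ := hn
    exact ⟨((g, g'), u, v), ⟨hg, hg', hu, hv, huv⟩, hgg⟩
  have h0 : ∀ᶠ n in hyp, _ := (hP 0).mono fun n hn => hn.1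
  set z := fun n => ψ n () with hz
  refine ⟨fun n => (z n).1.1 - (z n).1.2, fun i n => (z n).2.2 i - (z n).2.1 i,
    fun n => t n • ((z n).1.1 - (z n).1.2) - combMap b ((z n).2.2 - (z n).2.1) (θ n),
    (IsGood.of_mem hA (h0.mono fun n h => h.1)).sub hA (IsGood.of_mem hA (h0.mono fun n h => h.2.1)),
    ?_, fun i => (IsGood.of_mem hA (h0.mono fun n h => h.2.2.2.1 i)).sub hA
      (IsGood.of_mem hA (h0.mono fun n h => h.2.2.1 i)),
    IsGood.of_norm_le hA (h0.mono fun n h => h.2.2.2.2), fun n => ?_⟩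
  · rintro ⟨c, hc, h⟩
    obtain ⟨m, hm⟩ := exists_nat_one_div_lt hc
    have hlt : ∀ᶠ n in hyp, False := by
      filter_upwards [h, hP m] with n h1 h2
      exact absurd (h2.2.trans h1)
        (not_le.2 (Real.rpow_lt_rpow_of_exponent_gt (hδ.pos n) (hδ.lt_one n) hm))
    exact (hlt.exists).choose_spec
  · have : (fun i => (z n).2.2 i - (z n).2.1 i) = (z n).2.2 - (z n).2.1 := rfl
    rw [this, add_sub_cancel]

/-- Every scalar of size at most one is a combination of good elements, with a fixed finite set of
coefficients. -/
theorem Setup.exists_scalar_spanning [IsSimpleRing E] (hA : Setup δ κ σ A N) (hκ : 0 < κ)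
    (b : Module.Basis ι ℝ E) : ∃ (k : ℕ) (z : Option ((Fin k × ι) × (ι × ι)) → ℕ → ℝ),
      (∀ j, Tame δ (z j)) ∧ ∀ t : ℕ → ℝ, (∀ n, |t n| ≤ 1) →
        ∃ g : Option ((Fin k × ι) × (ι × ι)) → ℕ → E, (∀ j, IsGood δ A (g j)) ∧
          ∀ᶠ n in hyp, t n • (1 : E) = ∑ j, z j n • g j n := by
  obtain ⟨k, S, θ, hSA, hS, hθ, he⟩ := hA.exists_energy_le hκ b
  obtain ⟨w, hw, hspan⟩ := hA.exists_good_spanning b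
  have hθt : ∀ p, Tame δ fun n => θ n p := fun p => tame_of_bounded 1
    (Eventually.of_forall fun n => (norm_le_pi_norm (θ n) p).trans (hθ n))
  choose τ hτ hτθ using fun p => hspan (fun n => θ n p) (hθt p)
  choose τ' hτ' hτb using fun l => hspan (fun _ => b l) (tame_const _)
  refine ⟨k, fun j n => j.elim 1 fun j => τ j.1 j.2.1 n * τ' j.1.2 j.2.2 n, ?_, fun t ht => ?_⟩
  · rintro (_ | j)
    · exact tame_const (1 : ℝ)
    · exact (hτ _ _).mul (hτ' _ _)
  obtain ⟨e, u, r, heg, hes, hu, hr, h⟩ := hA.exists_good_collision hκ b hSA hS hθ he ht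
  obtain ⟨p, q, hp, hq, hpq⟩ := hA.exists_good_sum_eq_one b heg hes
  refine ⟨fun j n => j.elim (∑ i, p i n * r n * q i n) fun j =>
    ∑ i, p i n * (w j.2.1 n * (u j.1.1 n * w j.2.2 n)) * q i n, ?_, ?_⟩
  · rintro (_ | j)
    · exact IsGood.sum hA _ fun i _ => ((hp i).mul hr).mul (hq i)
    · exact IsGood.sum hA _ fun i _ => ((hp i).mul ((hw _).mul ((hu _).mul (hw _)))).mul (hq i)
  · filter_upwards [hpq, eventually_all.2 hτθ, eventually_all.2 hτb] with n h1 h2 h3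
    have e1 : ∀ i, t n • (p i n * e n * q i n) = ∑ x : Fin k × ι,
        p i n * (θ n x * (u x.1 n * b x.2)) * q i n + p i n * r n * q i n := by
      intro i
      rw [← smul_mul_assoc, ← mul_smul_comm, h n, combMap_apply, mul_add, add_mul]
      simp only [Finset.mul_sum, Finset.sum_mul, Fintype.sum_prod_type]
    rw [← h1, Finset.smul_sum, Fintype.sum_option]
    simp only [Option.elim, e1, Finset.sum_add_distrib]
    rw [add_comm]
    congr 1
    · simp
    · rw [Finset.sum_comm]
      refine Eq.trans (Fintype.sum_congr _ _ fun x => ?_) (Fintype.sum_prod_type _).symm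
      simp only [Finset.smul_sum]
      rw [Finset.sum_comm]
      refine Fintype.sum_congr _ _ fun i => ?_
      rw [Fintype.sum_prod_type, h2 x, h3 x.2]
      simp only [Finset.mul_sum, Finset.sum_mul]
      rw [Finset.sum_comm]
      refine Fintype.sum_congr _ _ fun y => Fintype.sum_congr _ _ fun y' => ?_
      simp only [smul_mul_assoc, mul_smul_comm, smul_smul, mul_comm]

end

section

variable {δ : ℕ → ℝ} [hδ : IsScale δ]

/-- Families which are small along all sequences of parameters are uniformly small. -/
lemma exists_uniform_small {Y V : Type*} [Nonempty Y] [Norm V] {x : ℕ → Y → V}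
    {D : ℕ → Y → Prop}
    (h : ∀ y : ℕ → Y, (∀ᶠ n in hyp, D n (y n)) → Small δ fun n => x n (y n)) :
    ∃ c : ℝ, 0 < c ∧ ∀ᶠ n in hyp, ∀ y, D n y → ‖x n y‖ ≤ δ n ^ c := by
  by_contra! h1
  obtain ⟨ψ, hψ⟩ := exists_diagonal (Y := Unit) (Z := Y)
    (P := fun n m _ y => D n y ∧ δ n ^ (1 / ((m : ℝ) + 1)) < ‖x n y‖) (by
      rintro n m m' - y hm ⟨h1, h2⟩
      exact ⟨h1, (scale_rpow_le (by gcongr) n).trans_lt h2⟩)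
  have hP := hψ (fun _ => ()) fun m => h1 _ (by positivity)
  obtain ⟨c, hc, h2⟩ := h (fun n => ψ n ()) ((hP 0).mono fun n h => h.1)
  obtain ⟨m, hm⟩ := exists_nat_one_div_lt hc
  have hlt : ∀ᶠ n in hyp, False := by
    filter_upwards [h2, hP m] with n h3 h4
    exact absurd (h4.2.trans_le h3)
      (not_lt.2 (Real.rpow_le_rpow_of_exponent_ge (hδ.pos n) (hδ.lt_one n).le hm.le))
  exact hlt.exists.choose_spec

/-- Stability of additivity on the unit interval. -/
lemma norm_sub_smul_one_le {V : Type*} [NormedAddCommGroup V] [NormedSpace ℝ V] {f : ℝ → V}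
    {B ε : ℝ} (hB : ∀ t, 0 ≤ t → t ≤ 1 → ‖f t‖ ≤ B)
    (hf : ∀ s t, 0 ≤ s → 0 ≤ t → s + t ≤ 1 → ‖f (s + t) - f s - f t‖ ≤ ε)
    {t : ℝ} (ht0 : 0 ≤ t) (ht1 : t ≤ 1) : ‖f t - t • f 1‖ ≤ 3 * ε := by
  set F : ℝ → V := fun t => f t - t • f 1 with hF
  have hF1 : F 1 = 0 := by simp [hF]
  have hFadd : ∀ s t, 0 ≤ s → 0 ≤ t → s + t ≤ 1 → ‖F (s + t) - F s - F t‖ ≤ ε := by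
    intro s t hs ht hst
    convert hf s t hs ht hst using 2
    simp only [hF, add_smul]; abel
  have hbdd : BddAbove (Set.range fun t : Set.Icc (0 : ℝ) 1 => ‖F t‖) := by
    refine ⟨B + B, ?_⟩
    rintro _ ⟨⟨t, h0, h1⟩, rfl⟩
    refine (norm_sub_le _ _).trans (add_le_add (hB t h0 h1) ?_)
    rw [norm_smul, Real.norm_of_nonneg h0]
    have := hB 1 zero_le_one le_rfl
    nlinarith [norm_nonneg (f 1)]
  set M := ⨆ t : Set.Icc (0 : ℝ) 1, ‖F t‖
  have hM : ∀ t, 0 ≤ t → t ≤ 1 → ‖F t‖ ≤ M := fun t h0 h1 => le_ciSup hbdd ⟨t, h0, h1⟩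
  have hhalf : ∀ t, 0 ≤ t → t ≤ 1 / 2 → ‖F t‖ ≤ (M + ε) / 2 := by
    intro t h0 h1
    have e1 := hFadd t t h0 h0 (by linarith)
    have e2 := hM (t + t) (by linarith) (by linarith)
    have e3 : ‖F t + F t‖ ≤ ‖F (t + t)‖ + ‖F (t + t) - F t - F t‖ := by
      have := norm_sub_le (F (t + t)) (F (t + t) - F t - F t)
      rwa [show F (t + t) - (F (t + t) - F t - F t) = F t + F t by abel] at this
    rw [← two_smul ℝ, norm_smul, Real.norm_ofNat] at e3
    linarith
  have : Nonempty (Set.Icc (0 : ℝ) 1) := ⟨⟨0, by simp⟩⟩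
  have hε : 0 ≤ ε := (norm_nonneg _).trans (hf 0 0 le_rfl le_rfl (by norm_num))
  have hMle : M ≤ (M + ε) / 2 + ε := by
    refine ciSup_le ?_
    rintro ⟨t, h0, h1⟩
    rcases le_total t (1 / 2) with h | h
    · exact (hhalf t h0 h).trans (by linarith)
    · have e1 := hFadd t (1 - t) h0 (by linarith) (by linarith)
      rw [add_sub_cancel, hF1, zero_sub] at e1
      have e2 := hhalf (1 - t) (by linarith) (by linarith)
      have e3 := norm_sub_le (-F t - F (1 - t)) (-F (1 - t))
      rw [sub_neg_eq_add, sub_add_cancel, norm_neg, norm_neg] at e3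
      dsimp only
      linarith
  linarith [hM t ht0 ht1]

end

section

variable {E : Type*} [NormedRing E] [NormedAlgebra ℝ E] [FiniteDimensional ℝ E]
  {δ : ℕ → ℝ} [hδ : IsScale δ] {κ σ : ℝ} {A : ℕ → Set E} {N : ℕ → ℝ}

/-- Quantitative form of `IsGood` at level `m`. -/
def GoodAt (δ : ℕ → ℝ) (A : ℕ → Set E) (n m : ℕ) (x : E) : Prop :=
  ‖x‖ ≤ δ n ^ (-(1 / ((m : ℝ) + 1))) ∧
    CovBy (δ n ^ (-(1 / ((m : ℝ) + 1)))) (AddMonoidHom.mulLeft x '' diffSet δ A n)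
      (diffSet δ A n) ∧
    CovBy (δ n ^ (-(1 / ((m : ℝ) + 1)))) (AddMonoidHom.mulRight x '' diffSet δ A n)
      (diffSet δ A n)

omit [NormedAlgebra ℝ E] [FiniteDimensional ℝ E] in
lemma GoodAt.mono {n m m' : ℕ} (hm : m ≤ m') {x : E} (h : GoodAt δ A n m' x) :
    GoodAt δ A n m x := by
  have : δ n ^ (-(1 / ((m' : ℝ) + 1))) ≤ δ n ^ (-(1 / ((m : ℝ) + 1))) :=
    scale_rpow_le (by gcongr) n
  exact ⟨h.1.trans this, h.2.1.mono this subset_rfl subset_rfl,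
    h.2.2.mono this subset_rfl subset_rfl⟩

omit [NormedAlgebra ℝ E] [FiniteDimensional ℝ E] in
lemma isGood_iff {x : ℕ → E} : IsGood δ A x ↔ ∀ m, ∀ᶠ n in hyp, GoodAt δ A n m (x n) := by
  refine ⟨fun h m => ?_, fun h => ?_⟩
  · have hm : (0 : ℝ) < 1 / ((m : ℝ) + 1) := by positivity
    filter_upwards [h.tame _ hm, h.left _ hm, h.right _ hm] with n h1 h2 h3 using ⟨h1, h2, h3⟩
  · have key : ∀ η : ℝ, 0 < η → ∃ m : ℕ, ∀ n,
        δ n ^ (-(1 / ((m : ℝ) + 1))) ≤ δ n ^ (-η) := by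
      intro η hη
      obtain ⟨m, hm⟩ := exists_nat_one_div_lt hη
      exact ⟨m, fun n => scale_rpow_le (by linarith) n⟩
    refine ⟨fun η hη => ?_, fun η hη => ?_, fun η hη => ?_⟩
    all_goals
      obtain ⟨m, hm⟩ := key η hη
      filter_upwards [h m] with n hn
    · exact hn.1.trans (hm n)
    · exact hn.2.1.mono (hm n) subset_rfl subset_rfl
    · exact hn.2.2.mono (hm n) subset_rfl subset_rfl

/-- The coefficients `z` represent all scalars of size at most one. -/
def SpansScalars (δ : ℕ → ℝ) (A : ℕ → Set E) {m : ℕ} (z : Fin m → ℕ → ℝ) : Prop :=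
  (∀ j, Tame δ (z j)) ∧ ∀ t : ℕ → ℝ, (∀ᶠ n in hyp, |t n| ≤ 1) →
    ∃ g : Fin m → ℕ → E, (∀ j, IsGood δ A (g j)) ∧
      ∀ᶠ n in hyp, t n • (1 : E) = ∑ j, z j n • g j n

lemma Setup.exists_spansScalars [IsSimpleRing E] (hA : Setup δ κ σ A N) (hκ : 0 < κ) :
    ∃ (m : ℕ) (z : Fin m → ℕ → ℝ), SpansScalars δ A z := by
  obtain ⟨k, z, hz, h⟩ := hA.exists_scalar_spanning hκ (Module.finBasis ℝ E)
  set e := Fintype.equivFin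
    (Option ((Fin k × Fin (Module.finrank ℝ E)) ×
      (Fin (Module.finrank ℝ E) × Fin (Module.finrank ℝ E))))
  refine ⟨_, fun j => z (e.symm j), fun j => hz _, fun t ht => ?_⟩
  obtain ⟨g, hg, hgt⟩ := h (fun n => max (-1) (min 1 (t n))) fun n =>
    abs_le.2 ⟨le_max_left _ _, max_le (by norm_num) (min_le_left _ _)⟩
  refine ⟨fun j => g (e.symm j), fun j => hg _, ?_⟩
  filter_upwards [hgt, ht] with n h1 h2
  rw [abs_le] at h2
  rw [min_eq_right h2.2, max_eq_right h2.1] at h1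
  rw [h1, e.symm.sum_comp fun j => z j n • g j n]

/-- A minimal family of coefficients representing scalars has no nontrivial relation. -/
lemma Setup.exists_minimal_spansScalars [IsSimpleRing E] (hA : Setup δ κ σ A N) (hκ : 0 < κ) :
    ∃ (m : ℕ) (z : Fin m → ℕ → ℝ), SpansScalars δ A z ∧ ∀ g : Fin m → ℕ → E,
      (∀ j, IsGood δ A (g j)) → (∀ᶠ n in hyp, ∑ j, z j n • g j n = 0) → ∀ j, Small δ (g j) := by
  classical
  have hex := hA.exists_spansScalars hκ
  obtain ⟨z, hz⟩ := Nat.find_spec hex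
  have hmin : ∀ {m}, m < Nat.find hex → ∀ z : Fin m → ℕ → ℝ, ¬ SpansScalars δ A z :=
    fun hm z hz => Nat.find_min hex hm ⟨z, hz⟩
  generalize Nat.find hex = m at z hz hmin
  refine ⟨m, z, hz, fun g hg hg0 j₀ => ?_⟩
  by_contra hs
  obtain _ | m := m
  · exact j₀.elim0
  obtain ⟨p, q, hp, hq, hpq⟩ := hA.exists_good_sum_eq_one (Module.finBasis ℝ E) (hg j₀) hs
  have hg' : ∀ j, IsGood δ A fun n => ∑ i, p i n * g j n * q i n := fun j =>
    IsGood.sum hA _ fun i _ => ((hp i).mul (hg j)).mul (hq i)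
  refine hmin (Nat.lt_succ_self m) (fun i => z (j₀.succAbove i)) ⟨fun i => hz.1 _, fun t ht => ?_⟩
  obtain ⟨f, hf, hft⟩ := hz.2 t ht
  have hf' : ∀ j, IsGood δ A fun n => f j n - (∑ i, p i n * g j n * q i n) * f j₀ n := fun j =>
    (hf j).sub hA ((hg' j).mul (hf j₀))
  refine ⟨_, fun i => hf' (j₀.succAbove i), ?_⟩
  filter_upwards [hft, hg0, hpq] with n h1 h2 h3
  have e1 : ∑ j, z j n • (f j n - (∑ i, p i n * g j n * q i n) * f j₀ n) = t n • (1 : E) := by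
    have e2 : ∑ j, z j n • (∑ i, p i n * g j n * q i n) = 0 := by
      calc ∑ j, z j n • (∑ i, p i n * g j n * q i n)
          = ∑ i, p i n * (∑ j, z j n • g j n) * q i n := by
            simp only [Finset.smul_sum, Finset.mul_sum, Finset.sum_mul, mul_smul_comm,
              smul_mul_assoc]
            exact Finset.sum_comm
        _ = 0 := by simp [h2]
    simp only [smul_sub, Finset.sum_sub_distrib, ← smul_mul_assoc, ← Finset.sum_mul]
    rw [e2, zero_mul, sub_zero, h1]
  rw [Fin.sum_univ_succAbove _ j₀, h3, one_mul, sub_self, smul_zero, zero_add] at e1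
  exact e1.symm

/-- There is an approximately additive function from scalars to good elements. -/
lemma Setup.exists_almost_additive [IsSimpleRing E] (hA : Setup δ κ σ A N) (hκ : 0 < κ) :
    ∃ f : ℕ → ℝ → E, (∀ t : ℕ → ℝ, (∀ᶠ n in hyp, |t n| ≤ 1) → IsGood δ A fun n => f n (t n)) ∧
      (∀ s t : ℕ → ℝ, (∀ᶠ n in hyp, |s n| ≤ 1) → (∀ᶠ n in hyp, |t n| ≤ 1) →
        (∀ᶠ n in hyp, |s n + t n| ≤ 1) →
        Small δ fun n => f n (s n + t n) - f n (s n) - f n (t n)) ∧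
      ¬ Small δ fun n => f n 1 := by
  obtain ⟨m, z, ⟨hz, hspan⟩, hrel⟩ := hA.exists_minimal_spansScalars hκ
  obtain ⟨ψ, hψ⟩ := exists_diagonal (Y := ℝ) (Z := Fin m → E)
    (P := fun n l t g => (∀ j, GoodAt δ A n l (g j)) ∧ t • (1 : E) = ∑ j, z j n • g j) (by
      rintro n l l' t g hl ⟨h1, h2⟩
      exact ⟨fun j => (h1 j).mono hl, h2⟩)
  have hP : ∀ t : ℕ → ℝ, (∀ᶠ n in hyp, |t n| ≤ 1) →
      (∀ j, IsGood δ A fun n => ψ n (t n) j) ∧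
        ∀ᶠ n in hyp, t n • (1 : E) = ∑ j, z j n • ψ n (t n) j := by
    intro t ht
    obtain ⟨g, hg, hgt⟩ := hspan t ht
    have := hψ t fun l => by
      filter_upwards [eventually_all.2 fun j => isGood_iff.1 (hg j) l, hgt] with n h1 h2
      exact ⟨fun j => g j n, h1, h2⟩
    exact ⟨fun j => isGood_iff.2 fun l => (this l).mono fun n h => h.1 j,
      (this 0).mono fun n h => h.2⟩
  have h1 : ∀ᶠ n : ℕ in hyp, |(1 : ℝ)| ≤ 1 := Eventually.of_forall fun _ => by simp
  obtain ⟨hg1, hs1⟩ := hP (fun _ => 1) h1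
  obtain ⟨j, hj⟩ : ∃ j, ¬ Small δ fun n => ψ n 1 j := by
    by_contra! hcon
    have h2 : Small δ fun n => ∑ j, z j n • ψ n 1 j :=
      Small.sum _ fun j _ => (hz j).smul_small (hcon j)
    refine not_small_const (δ := δ) (norm_ne_zero_iff.2 (one_ne_zero (α := E))) (h2.of_le ?_)
    filter_upwards [hs1] with n hn
    rw [← hn, one_smul, norm_norm]
  refine ⟨fun n t => ψ n t j, fun t ht => (hP t ht).1 j, fun s t hs ht hst => ?_, hj⟩
  obtain ⟨a1, a2⟩ := hP s hs
  obtain ⟨b1, b2⟩ := hP t ht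
  obtain ⟨c1, c2⟩ := hP (fun n => s n + t n) hst
  refine hrel (fun j n => ψ n (s n + t n) j - ψ n (s n) j - ψ n (t n) j)
    (fun j => ((c1 j).sub hA (a1 j)).sub hA (b1 j)) ?_ j
  filter_upwards [a2, b2, c2] with n h1 h2 h3
  simp only [smul_sub, Finset.sum_sub_distrib]
  rw [← h1, ← h2, ← h3, add_smul]
  abel

/-- Scalars of size at most one are uniformly close to good elements. -/
lemma Setup.exists_good_near_scalar [IsSimpleRing E] (hA : Setup δ κ σ A N) (hκ : 0 < κ) :
    ∃ c : ℝ, 0 < c ∧ ∀ t : ℕ → ℝ, (∀ᶠ n in hyp, |t n| ≤ 1) →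
      ∃ g, IsGood δ A g ∧ ∀ᶠ n in hyp, ‖t n • (1 : E) - g n‖ ≤ δ n ^ c := by
  obtain ⟨f, hf, hadd, hf1⟩ := hA.exists_almost_additive hκ
  obtain ⟨c, hc, hfc⟩ := exists_uniform_small (δ := δ) (Y := ℝ × ℝ)
    (x := fun n y => f n (y.1 + y.2) - f n y.1 - f n y.2)
    (D := fun n y => |y.1| ≤ 1 ∧ |y.2| ≤ 1 ∧ |y.1 + y.2| ≤ 1) fun y hy =>
      hadd _ _ (hy.mono fun n h => h.1) (hy.mono fun n h => h.2.1) (hy.mono fun n h => h.2.2)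
  have hbd : ∀ᶠ n in hyp, ∀ t, |t| ≤ 1 → ‖f n t‖ ≤ δ n ^ (-1 : ℝ) := by
    refine eventually_forall_of_seq fun t => ?_
    by_cases ht : ∀ᶠ n in hyp, |t n| ≤ 1
    · filter_upwards [(hf t ht).tame 1 one_pos] with n hn _ using hn
    · rw [hyp, ← Ultrafilter.eventually_not] at ht
      filter_upwards [ht] with n hn h using absurd h hn
  obtain ⟨p, q, hp, hq, hpq⟩ := hA.exists_good_sum_eq_one (Module.finBasis ℝ E)
    (hf (fun _ => 1) (Eventually.of_forall fun _ => by simp)) hf1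
  have hK : Tame δ fun n => ∑ i, ‖p i n‖ * ‖q i n‖ * 3 := by
    refine Tame.sum _ fun i _ => ?_
    exact (((hp i).tame.of_le (by simp)).mul ((hq i).tame.of_le (by simp))).mul (tame_const (3 : ℝ))
  refine ⟨c / 2, half_pos hc, ?_⟩
  have key : ∀ t : ℕ → ℝ, (∀ᶠ n in hyp, |t n| ≤ 1) → (∀ᶠ n in hyp, 0 ≤ t n) →
      ∃ g, IsGood δ A g ∧ ∀ᶠ n in hyp, ‖t n • (1 : E) - g n‖ ≤ δ n ^ (c / 2) := by
    intro t ht ht0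
    refine ⟨fun n => ∑ i, p i n * f n (t n) * q i n, IsGood.sum hA _ fun i _ =>
      ((hp i).mul (hf t ht)).mul (hq i), ?_⟩
    filter_upwards [ht, ht0, hfc, hbd, hpq, hK (c / 2) (half_pos hc)] with n h1 h2 h3 h4 h5 h6
    have h7 : ‖f n (t n) - t n • f n 1‖ ≤ 3 * δ n ^ c := by
      refine norm_sub_smul_one_le (B := δ n ^ (-1 : ℝ)) (fun s hs0 hs1 => h4 s ?_)
        (fun s s' hs hs' hss => h3 (s, s') ⟨?_, ?_, ?_⟩) h2 (le_of_abs_le h1)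
      all_goals
        refine abs_le.2 ⟨?_, ?_⟩ <;> linarith
    have h8 : t n • (1 : E) - ∑ i, p i n * f n (t n) * q i n =
        -∑ i, p i n * (f n (t n) - t n • f n 1) * q i n := by
      rw [← h5, Finset.smul_sum, ← Finset.sum_sub_distrib, ← Finset.sum_neg_distrib]
      refine Finset.sum_congr rfl fun i _ => ?_
      simp only [mul_sub, sub_mul, mul_smul_comm, smul_mul_assoc, neg_sub]
    rw [h8, norm_neg]
    calc ‖∑ i, p i n * (f n (t n) - t n • f n 1) * q i n‖
        ≤ ∑ i, ‖p i n‖ * ‖q i n‖ * 3 * δ n ^ c := by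
          refine (norm_sum_le _ _).trans (Finset.sum_le_sum fun i _ => ?_)
          calc _ ≤ ‖p i n‖ * ‖f n (t n) - t n • f n 1‖ * ‖q i n‖ :=
                (norm_mul_le _ _).trans (by gcongr; exact norm_mul_le _ _)
            _ ≤ ‖p i n‖ * (3 * δ n ^ c) * ‖q i n‖ := by gcongr
            _ = _ := by ring
      _ = (∑ i, ‖p i n‖ * ‖q i n‖ * 3) * δ n ^ c := by rw [Finset.sum_mul]
      _ ≤ δ n ^ (-(c / 2)) * δ n ^ c := by
          have := hδ.pos n
          gcongr
          exact (le_abs_self _).trans h6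
      _ = δ n ^ (c / 2) := by rw [← Real.rpow_add (hδ.pos n)]; congr 1; ring
  intro t ht
  by_cases ht0 : ∀ᶠ n in hyp, 0 ≤ t n
  · exact key t ht ht0
  · rw [hyp, ← Ultrafilter.eventually_not] at ht0
    obtain ⟨g, hg, h⟩ := key (fun n => -t n) (by simpa using ht)
      (ht0.mono fun n hn => by simpa using (not_le.1 hn).le)
    refine ⟨fun n => -g n, hg.neg, ?_⟩
    filter_upwards [h] with n hn
    refine le_of_eq_of_le ?_ hn
    rw [← norm_neg, neg_smul]
    congr 1
    abel

/-- Small elements are approximated by good elements, to a uniform precision. -/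
lemma Setup.exists_good_near_small [IsSimpleRing E] (hA : Setup δ κ σ A N) (hκ : 0 < κ) :
    ∃ c : ℝ, 0 < c ∧ ∀ x : ℕ → E, Small δ x →
      ∃ g, IsGood δ A g ∧ ∀ᶠ n in hyp, ‖x n - g n‖ ≤ δ n ^ c := by
  obtain ⟨c, hc, hscal⟩ := hA.exists_good_near_scalar hκ
  obtain ⟨w, hw, hspan⟩ := hA.exists_good_spanning (Module.finBasis ℝ E)
  have hK : Tame δ fun n => ∑ p, ‖w p n‖ := Tame.sum _ fun p _ => (hw p).tame.of_le (by simp)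
  refine ⟨c / 2, half_pos hc, ?_⟩
  rintro x ⟨c₁, hc₁, hx⟩
  obtain ⟨τ, hτ, hτx⟩ := hspan (fun n => δ n ^ (-c₁) • x n) (tame_of_bounded 1 (by
    filter_upwards [hx] with n hn
    have := hδ.pos n
    rw [norm_smul, Real.norm_of_nonneg (by positivity)]
    calc δ n ^ (-c₁) * ‖x n‖ ≤ δ n ^ (-c₁) * δ n ^ c₁ := by gcongr
      _ = 1 := by rw [← Real.rpow_add this]; simp))
  have ht : ∀ p, ∀ᶠ n in hyp, |δ n ^ c₁ * τ p n| ≤ 1 := by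
    intro p
    filter_upwards [hτ p c₁ hc₁] with n hn
    have := hδ.pos n
    rw [abs_mul, abs_of_pos (by positivity)]
    calc δ n ^ c₁ * |τ p n| ≤ δ n ^ c₁ * δ n ^ (-c₁) := by gcongr; exact hn
      _ = 1 := by rw [← Real.rpow_add this]; simp
  choose g hg hgt using fun p => hscal _ (ht p)
  refine ⟨fun n => ∑ p, g p n * w p n, IsGood.sum hA _ fun p _ => (hg p).mul (hw p), ?_⟩
  filter_upwards [hτx, eventually_all.2 hgt, hK (c / 2) (half_pos hc)] with n h1 h2 h3
  have hδn := hδ.pos n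
  have h4 : x n = ∑ p, ((δ n ^ c₁ * τ p n) • (1 : E)) * w p n := by
    have : x n = δ n ^ c₁ • δ n ^ (-c₁) • x n := by
      rw [smul_smul, ← Real.rpow_add hδn]; simp
    rw [this, h1, Finset.smul_sum]
    simp [smul_smul]
  rw [h4, ← Finset.sum_sub_distrib]
  calc ‖∑ p, (((δ n ^ c₁ * τ p n) • (1 : E)) * w p n - g p n * w p n)‖
      ≤ ∑ p, δ n ^ c * ‖w p n‖ := by
        refine (norm_sum_le _ _).trans (Finset.sum_le_sum fun p _ => ?_)
        rw [← sub_mul]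
        refine (norm_mul_le _ _).trans ?_
        gcongr
        exact h2 p
    _ = δ n ^ c * ∑ p, ‖w p n‖ := by rw [Finset.mul_sum]
    _ ≤ δ n ^ c * δ n ^ (-(c / 2)) := by
        gcongr
        exact (le_abs_self _).trans h3
    _ = δ n ^ (c / 2) := by rw [← Real.rpow_add hδn]; congr 1; ring

/-- Small elements are good. -/
theorem Setup.isGood_of_small [IsSimpleRing E] (hA : Setup δ κ σ A N) (hκ : 0 < κ)
    {x : ℕ → E} (hx : Small δ x) : IsGood δ A x := by
  obtain ⟨c, hc, hnear⟩ := hA.exists_good_near_small hκ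
  have hpow : ∀ a : ℝ, 0 < a → Small δ fun n => δ n ^ a := fun a ha =>
    ⟨a, ha, Eventually.of_forall fun n => by
      rw [Real.norm_of_nonneg (Real.rpow_nonneg (hδ.pos n).le _)]⟩
  have key : ∀ k : ℕ, ∀ x : ℕ → E, Small δ x →
      ∃ g, IsGood δ A g ∧ ∀ᶠ n in hyp, ‖x n - g n‖ ≤ δ n ^ (c + k * (c / 4)) := by
    intro k
    induction k with
    | zero => simpa using hnear
    | succ k ih =>
      intro x hx
      obtain ⟨s, hs⟩ : ∃ s, s = c + k * (c / 4) := ⟨_, rfl⟩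
      rw [← hs] at ih
      have hcs : c ≤ s := by rw [hs]; linarith [show 0 ≤ k * (c / 4) by positivity]
      obtain ⟨g₀, hg₀, h₀⟩ := hnear x hx
      obtain ⟨π, hπ, hπc⟩ := ih (fun n => δ n ^ (c / 2) • (1 : E))
        ((hpow _ (half_pos hc)).smul_tame (tame_const _))
      obtain ⟨g₁, hg₁, h₁⟩ := ih (fun n => δ n ^ (-(c / 2)) • (x n - g₀ n))
        ⟨c / 2, half_pos hc, by
          filter_upwards [h₀] with n hn
          have hδn := hδ.pos n
          rw [norm_smul, Real.norm_of_nonneg (by positivity)]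
          calc _ ≤ δ n ^ (-(c / 2)) * δ n ^ c := by gcongr
            _ = _ := by rw [← Real.rpow_add hδn]; congr 1; ring⟩
      refine ⟨fun n => g₀ n + π n * g₁ n, hg₀.add hA (hπ.mul hg₁), ?_⟩
      filter_upwards [h₀, hπc, h₁, eventually_const_mul_rpow_le (δ := δ) 3
        (show s + c / 4 < s + c / 2 by linarith)] with n h0 h1 h2 h3
      have hδn := hδ.pos n
      set y := δ n ^ (-(c / 2)) • (x n - g₀ n) with hy
      have hyx : x n - g₀ n = δ n ^ (c / 2) • y := by
        rw [hy, smul_smul, ← Real.rpow_add hδn]; simp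
      have hyn : ‖y‖ ≤ δ n ^ (c / 2) := by
        rw [hy, norm_smul, Real.norm_of_nonneg (by positivity)]
        calc _ ≤ δ n ^ (-(c / 2)) * δ n ^ c := by gcongr
          _ = _ := by rw [← Real.rpow_add hδn]; congr 1; ring
      have hsc : δ n ^ s ≤ δ n ^ (c / 2) := scale_rpow_le (by linarith) n
      have hg1 : ‖g₁ n‖ ≤ 2 * δ n ^ (c / 2) := by
        have := norm_sub_le y (y - g₁ n)
        rw [sub_sub_cancel] at this
        linarith
      have e1 : x n - (g₀ n + π n * g₁ n) =
          δ n ^ (c / 2) • (y - g₁ n) + (δ n ^ (c / 2) • (1 : E) - π n) * g₁ n := by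
        rw [← sub_sub, hyx, smul_sub, sub_mul, smul_one_mul]; abel
      rw [e1]
      calc _ ≤ δ n ^ (c / 2) * δ n ^ s + δ n ^ s * (2 * δ n ^ (c / 2)) := by
            refine (norm_add_le _ _).trans (add_le_add ?_ ((norm_mul_le _ _).trans ?_))
            · rw [norm_smul, Real.norm_of_nonneg (by positivity)]
              gcongr
            · gcongr
        _ = 3 * δ n ^ (s + c / 2) := by rw [Real.rpow_add hδn s]; ring
        _ ≤ δ n ^ (s + c / 4) := h3
        _ = _ := by congr 1; push_cast; rw [hs]; ring
  obtain ⟨k, hk⟩ := exists_nat_ge (1 / (c / 4))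
  rw [div_le_iff₀ (by positivity)] at hk
  obtain ⟨g, hg, h⟩ := key k x hx
  have : IsGood δ A fun n => x n - g n := IsGood.of_norm_le hA (by
    filter_upwards [h] with n hn
    refine hn.trans ?_
    simpa using scale_rpow_le (δ := δ) (show 1 ≤ c + k * (c / 4) by linarith) n)
  simpa using this.add hA hg

end

section

variable {E : Type*} [NormedRing E] [NormedAlgebra ℝ E] [FiniteDimensional ℝ E]
  {δ : ℕ → ℝ} [hδ : IsScale δ] {κ σ : ℝ} {A : ℕ → Set E} {N : ℕ → ℝ}

/-- A sum of images of the difference set under good maps is covered by few translates. -/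
lemma Setup.sum_image_cov (hA : Setup δ κ σ A N) {I : Type*} (s : Finset I) {f : I → ℕ → E →+ E}
    (hf : ∀ i, Good δ A (f i)) :
    TCov δ (fun n => ∑ i ∈ s, f i n '' diffSet δ A n) (diffSet δ A) := by
  classical
  induction s using Finset.induction_on with
  | empty =>
    refine TCov.of_subset (Eventually.of_forall fun n => ?_)
    have := hA.ball_subset n (mem_closedBall_self (hδ.pos n).le)
    simpa using this
  | insert i s hi ih =>
    simp only [Finset.sum_insert hi]
    exact (TCov.add (hf i) ih).trans hA.add_cov

theorem Setup.false_of_basis [IsSimpleRing E] {ι : Type*} [Fintype ι] [DecidableEq ι]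
    (b : Module.Basis ι ℝ E) (hA : Setup δ κ σ A N) (hκ : 0 < κ)
    (hσ : σ < Module.finrank ℝ E) : False := by
  classical
  obtain ⟨k, S, θ, hSA, hS, hθ, he⟩ := hA.exists_energy_le hκ b
  set d := Module.finrank ℝ E with hd
  set η := (d - σ) / 16 with hη
  have hη0 : 0 < η := by rw [hη]; linarith
  set c := η / (d + 1) with hc
  have hc0 : 0 < c := by positivity
  have hdc : c * d ≤ η := by
    rw [hc, div_mul_eq_mul_div, div_le_iff₀ (by positivity)]; nlinarith
  have hpow : Small δ fun n => δ n ^ c :=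
    ⟨c, hc0, Eventually.of_forall fun n => by
      rw [Real.norm_of_nonneg (Real.rpow_nonneg (hδ.pos n).le _)]⟩
  have hx : ∀ p, IsGood δ A fun n => δ n ^ c • θ n p := fun p =>
    hA.isGood_of_small hκ (hpow.smul_tame (tame_of_bounded 1
      (Eventually.of_forall fun n => (norm_le_pi_norm (θ n) p).trans (hθ n))))
  have hy : ∀ l, IsGood δ A fun n => δ n ^ c • b l := fun l =>
    hA.isGood_of_small hκ (hpow.smul_tame (tame_const _))
  set f : Fin k × ι → ℕ → E →+ E := fun p n =>
    (AddMonoidHom.mulLeft (δ n ^ c • θ n p)).comp (AddMonoidHom.mulRight (δ n ^ c • b p.2)) with hf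
  have hfg : ∀ p, Good δ A (f p) := fun p => (hx p).left.comp (hy p.2).right
  have hfalse : ∀ᶠ n in hyp, False := by
    filter_upwards [hA.sum_image_cov Finset.univ hfg η hη0, hA.diffSet_cov η hη0,
      hA.upper η hη0, he η hη0,
      eventually_const_mul_rpow_le (δ := δ) (5 ^ d) (show 4 * η < 8 * η by linarith)]
      with n h1 h2 h3 h4 h5
    have hδn := hδ.pos n
    have hδ1 := hδ.lt_one n
    obtain ⟨a, ha⟩ := hS n
    set r := δ n ^ (2 * c) with hr
    have hr0 : 0 < r := Real.rpow_pos_of_pos hδn _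
    have hr1 : r ≤ 1 := Real.rpow_le_one hδn.le hδ1.le (by positivity)
    set F : (Fin k → E) → E := fun s => combMap b s (θ n) with hF
    have hcov : CovBy (δ n ^ (-η) * (δ n ^ (-η) * N n)) (F '' (words k (S n) : Set (Fin k → E)))
        (closedBall 0 (2 * r⁻¹ * (δ n / 2))) := by
      refine (((h1.trans h2).image (DistribSMul.toAddMonoidHom E r⁻¹)).translate
        (F fun _ => a)).mono le_rfl ?_ ?_
      · rintro _ ⟨s, hs, rfl⟩
        refine ⟨r⁻¹ • ∑ p, f p n (s p.1 - a), ⟨_, ?_, rfl⟩, ?_⟩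
        · refine Set.finsetSum_mem_finsetSum _ _ _ fun p _ => ⟨_, ?_, rfl⟩
          exact ⟨s p.1 - a, ⟨_, hSA n (Fintype.mem_piFinset.1 hs _), _, hSA n ha, rfl⟩, 0,
            mem_closedBall_self hδn.le, add_zero _⟩
        · have e1 : ∑ p, f p n (s p.1 - a) = r • combMap b (s - fun _ => a) (θ n) := by
            rw [combMap_apply, Fintype.sum_prod_type]
            simp only [Finset.smul_sum]
            refine Fintype.sum_congr _ _ fun i => Fintype.sum_congr _ _ fun l => ?_
            simp only [hf, AddMonoidHom.comp_apply, AddMonoidHom.coe_mulLeft,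
              AddMonoidHom.coe_mulRight, smul_mul_assoc, mul_smul_comm, smul_smul, Pi.sub_apply]
            rw [← Real.rpow_add hδn, ← two_mul]
          dsimp only
          rw [e1, smul_smul, inv_mul_cancel₀ hr0.ne', one_smul, combMap_sub, vadd_eq_add, hF]
          exact add_sub_cancel _ _
      · rintro _ ⟨x, hx, rfl⟩
        have hx : ‖x‖ ≤ δ n := by simpa using hx
        simp only [DistribSMul.toAddMonoidHom_apply, mem_closedBall, dist_zero_right,
          norm_smul, norm_inv, Real.norm_of_nonneg hr0.le]
        calc r⁻¹ * ‖x‖ ≤ r⁻¹ * δ n := by gcongr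
          _ = _ := by ring
    have hcard := card_sq_le_mul_card (words k (S n)) F
      (hcov.rescale (half_pos hδn) (by positivity))
    have hcard' : ((words k (S n)).card : ℝ) ^ 2 ≤
        δ n ^ (-η) * (δ n ^ (-η) * N n) * (1 + 2 * (2 * r⁻¹)) ^ d *
          energy b k (S n) (θ n) (δ n) := hcard
    rw [card_words] at hcard'
    push_cast at hcard'
    have hr2 : (1 + 2 * (2 * r⁻¹)) ^ d ≤ 5 ^ d * δ n ^ (-(2 * η)) := by
      calc (1 + 2 * (2 * r⁻¹)) ^ d ≤ (5 * r⁻¹) ^ d := by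
            gcongr
            have := (one_le_inv₀ hr0).2 hr1
            linarith
        _ = 5 ^ d * δ n ^ (-(2 * (c * d))) := by
            rw [mul_pow, hr, ← Real.rpow_neg hδn.le, ← Real.rpow_natCast (δ n ^ _),
              ← Real.rpow_mul hδn.le]
            congr 2; ring
        _ ≤ _ := by
            gcongr 5 ^ d * ?_
            exact Real.rpow_le_rpow_of_exponent_ge hδn hδ1.le (by linarith)
    have hSc : (0 : ℝ) < (S n).card := by exact_mod_cast (hS n).card_pos
    have hN := (hA.pos n).le
    have h6 : 1 * ((S n).card : ℝ) ^ (2 * k) ≤ δ n ^ (4 * η) * ((S n).card : ℝ) ^ (2 * k) := by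
      calc 1 * ((S n).card : ℝ) ^ (2 * k) = (((S n).card : ℝ) ^ k) ^ 2 := by ring
        _ ≤ _ := hcard'
        _ ≤ δ n ^ (-η) * (δ n ^ (-η) * δ n ^ (-(σ + η))) * (5 ^ d * δ n ^ (-(2 * η))) *
            (δ n ^ ((d : ℝ) - η) * ((S n).card : ℝ) ^ (2 * k)) := by gcongr
        _ = 5 ^ d * (δ n ^ (-η) * δ n ^ (-η) * δ n ^ (-(σ + η)) * δ n ^ (-(2 * η)) *
            δ n ^ ((d : ℝ) - η)) * ((S n).card : ℝ) ^ (2 * k) := by ring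
        _ = 5 ^ d * δ n ^ (10 * η) * ((S n).card : ℝ) ^ (2 * k) := by
            simp only [← Real.rpow_add hδn]
            congr 3
            rw [hη]; ring
        _ ≤ 5 ^ d * δ n ^ (8 * η) * ((S n).card : ℝ) ^ (2 * k) := by
            gcongr 5 ^ d * ?_ * _
            exact Real.rpow_le_rpow_of_exponent_ge hδn hδ1.le (by linarith)
        _ ≤ _ := by gcongr
    have h7 := le_of_mul_le_mul_right h6 (by positivity)
    exact absurd h7 (not_le.2 (Real.rpow_lt_one hδn.le hδ1 (by positivity)))
  exact hfalse.exists.choose_spec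

theorem Setup.false [IsSimpleRing E] (hA : Setup δ κ σ A N) (hκ : 0 < κ)
    (hσ : σ < Module.finrank ℝ E) : False :=
  hA.false_of_basis (Module.finBasis ℝ E) hκ hσ

end

section

variable {E : Type*} [NormedRing E] [NormedAlgebra ℝ E] [FiniteDimensional ℝ E]
  {nm : Seminorm ℝ E} {C : ℝ}

lemma sball_eq (hC : 1 ≤ C) (hn : ∀ x, ‖x‖ = C * nm x) (x : E) (r : ℝ) :
    SBall nm x r = closedBall x (C * r) := by
  ext y
  rw [SBall, Set.mem_ofPred_eq, mem_closedBall, dist_eq_norm, hn,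
    mul_le_mul_iff_right₀ (by linarith : (0 : ℝ) < C)]

lemma exists_card_iff_covBy (hC : 1 ≤ C) (hn : ∀ x, ‖x‖ = C * nm x) {δ : ℝ} {S : Set E} {m : ℕ} :
    (∃ F : Finset E, F.card ≤ m ∧ S ⊆ ⋃ x ∈ F, SBall nm x δ) ↔
      CovBy m S (closedBall 0 (C * δ)) := by
  refine exists_congr fun F => and_congr Nat.cast_le.symm ?_
  have : (⋃ x ∈ F, SBall nm x δ) = (F : Set E) + closedBall 0 (C * δ) := by
    ext y
    simp only [sball_eq hC hn, Set.mem_iUnion, Set.mem_add, Finset.mem_coe, exists_prop]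
    refine exists_congr fun x => and_congr_right fun _ => ⟨fun h => ⟨y - x, ?_, ?_⟩, ?_⟩
    · simpa [dist_eq_norm] using h
    · abel
    · rintro ⟨z, hz, rfl⟩
      simpa [dist_eq_norm] using hz
  rw [this]

lemma sCov_le (hC : 1 ≤ C) (hn : ∀ x, ‖x‖ = C * nm x) {δ K : ℝ} {S : Set E}
    (h : CovBy K S (closedBall 0 (C * δ))) : (SCov nm δ S : ℝ) ≤ K := by
  obtain ⟨X, hX, hS⟩ := h
  refine le_trans (Nat.cast_le.2 (Nat.sInf_le ?_)) hX
  exact (exists_card_iff_covBy hC hn).2 ⟨X, le_rfl, hS⟩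

lemma covBy_sCov (hC : 1 ≤ C) (hn : ∀ x, ‖x‖ = C * nm x) {δ R : ℝ} (hδ : 0 < δ) (hR : 0 ≤ R)
    {S : Set E} (h : S ⊆ closedBall 0 R) : CovBy (SCov nm δ S) S (closedBall 0 (C * δ)) := by
  have hCδ : 0 < C * δ := mul_pos (by linarith) hδ
  obtain ⟨X, -, hX⟩ := (covBy_closedBall (V := E) hCδ hR).mono le_rfl h subset_rfl
  have hne : {m : ℕ | ∃ F : Finset E, F.card ≤ m ∧ S ⊆ ⋃ x ∈ F, SBall nm x δ}.Nonempty :=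
    ⟨X.card, (exists_card_iff_covBy hC hn).2 ⟨X, le_rfl, hX⟩⟩
  exact (exists_card_iff_covBy hC hn).1 (Nat.sInf_mem hne)

lemma sDist_le (nm : Seminorm ℝ E) (a : E) {w : E} {W : Set E} (hw : w ∈ W) :
    SDist nm a W ≤ nm (a - w) :=
  csInf_le ⟨0, by rintro _ ⟨w, -, rfl⟩; exact apply_nonneg nm _⟩ ⟨w, hw, rfl⟩

lemma sum_product_of_norm_eq [IsSimpleRing E] (hC : 1 ≤ C) (hn : ∀ x, ‖x‖ = C * nm x)
    {κ σ : ℝ} (hκ : 0 < κ) (hσ : σ < (Module.finrank ℝ E : ℝ)) :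
    ∃ ε : ℝ, 0 < ε ∧ ∃ δ₀ : ℝ, 0 < δ₀ ∧ ∀ δ : ℝ, 0 < δ → δ < δ₀ →
      ∀ A : Set E,
        A ⊆ SBall nm 0 (δ ^ (-ε)) →
        (∀ ρ : ℝ, δ ≤ ρ → δ ^ ε * ρ ^ (-κ) ≤ (SCov nm ρ A : ℝ)) →
        (SCov nm δ A : ℝ) ≤ δ ^ (-(σ + ε)) →
        AwayFromSubalgebras nm (δ ^ ε) A →
        δ ^ (-ε) * (SCov nm δ A : ℝ) ≤
          (SCov nm δ (A + A) : ℝ) + (SCov nm δ (A + A * A) : ℝ) := by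
  by_contra! H
  have hC0 : 0 < C := by linarith
  have H' := fun n : ℕ => H (1 / ((n : ℝ) + 1)) (by positivity) (1 / (C * ((n : ℝ) + 2)))
    (by positivity)
  choose δ hδ0 hδ1 A hA1 hA2 hA3 hA4 hA5 using H'
  set e : ℕ → ℝ := fun n => 1 / ((n : ℝ) + 1) with he
  have hlt : ∀ n, C * δ n < 1 / ((n : ℝ) + 2) := fun n => by
    calc C * δ n < C * (1 / (C * ((n : ℝ) + 2))) := by gcongr; exact hδ1 n
      _ = _ := by field_simp
  have hlim : Tendsto (fun n => C * δ n) atTop (𝓝 0) :=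
    squeeze_zero (fun n => (mul_pos hC0 (hδ0 n)).le)
      (fun n => (hlt n).le.trans (one_div_le_one_div_of_le (by positivity) (by linarith)))
      tendsto_one_div_add_atTop_nhds_zero_nat
  have hscale : IsScale fun n => C * δ n :=
    ⟨fun n => mul_pos hC0 (hδ0 n),
      fun n => (hlt n).trans_le ((div_le_one (by positivity)).2 (by
        have : (0 : ℝ) ≤ n := n.cast_nonneg
        linarith)),
      hlim.mono_left Nat.hyperfilter_le_atTop⟩
  have hpow : ∀ M η : ℝ, 0 < η → ∀ᶠ n in hyp, M * δ n ^ (-e n) ≤ (C * δ n) ^ (-η) := by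
    intro M η hη
    obtain ⟨m, hm⟩ := exists_nat_gt (2 / η)
    filter_upwards [eventually_ge_nat m, eventually_const_le (δ := fun n => C * δ n)
      (|M| * C) (half_pos hη)] with n hmn h1
    have he0 : 0 < e n := by simp only [he]; positivity
    have he1 : e n ≤ 1 := by
      simp only [he]
      exact (div_le_one (by positivity)).2 (by linarith [(n.cast_nonneg : (0 : ℝ) ≤ n)])
    have heη : e n ≤ η / 2 := by
      simp only [he]
      rw [div_le_div_iff₀ (by positivity) two_pos]
      rw [div_lt_iff₀ hη] at hm
      have : (m : ℝ) ≤ n := by exact_mod_cast hmn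
      nlinarith
    have hp : δ n ^ (-e n) ≤ C * (C * δ n) ^ (-e n) := by
      rw [Real.mul_rpow hC0.le (hδ0 n).le, ← mul_assoc]
      refine le_mul_of_one_le_left (Real.rpow_nonneg (hδ0 n).le _) ?_
      rw [Real.rpow_neg hC0.le, ← div_eq_mul_inv, one_le_div (Real.rpow_pos_of_pos hC0 _)]
      simpa using Real.rpow_le_rpow_of_exponent_le hC he1
    have hpos := hscale.pos n
    calc M * δ n ^ (-e n) ≤ |M| * (C * (C * δ n) ^ (-e n)) :=
          mul_le_mul (le_abs_self M) hp (Real.rpow_nonneg (hδ0 n).le _) (abs_nonneg M)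
      _ = |M| * C * (C * δ n) ^ (-e n) := by ring
      _ ≤ (C * δ n) ^ (-(η / 2)) * (C * δ n) ^ (-(η / 2)) := by
          refine mul_le_mul h1 ?_ (Real.rpow_nonneg hpos.le _) (Real.rpow_nonneg hpos.le _)
          exact scale_rpow_le (δ := fun n => C * δ n) (by linarith) n
      _ = (C * δ n) ^ (-η) := by
          rw [← Real.rpow_add hpos]; congr 1; ring
  have hpow' : ∀ η : ℝ, 0 < η → ∀ᶠ n in hyp, (C * δ n) ^ η ≤ δ n ^ e n := by
    intro η hη
    filter_upwards [hpow 1 η hη] with n hn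
    rw [one_mul, Real.rpow_neg (hδ0 n).le, Real.rpow_neg (hscale.pos n).le] at hn
    exact (inv_le_inv₀ (Real.rpow_pos_of_pos (hδ0 n) _)
      (Real.rpow_pos_of_pos (hscale.pos n) _)).1 hn
  set R : ℕ → ℝ := fun n => C * δ n ^ (-e n) with hR
  have hR0 : ∀ n, 0 ≤ R n := fun n => mul_nonneg hC0.le (Real.rpow_nonneg (hδ0 n).le _)
  have hAR : ∀ n, ∀ a ∈ A n, ‖a‖ ≤ R n := fun n a ha => by
    have := hA1 n ha
    rw [sball_eq hC hn] at this
    exact mem_closedBall_zero_iff.1 this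
  have hAc := fun n => covBy_sCov hC hn (hδ0 n) (hR0 n) (S := A n)
    fun a ha => by simpa using hAR n a ha
  have hadd := fun n => covBy_sCov hC hn (hδ0 n) (add_nonneg (hR0 n) (hR0 n)) (S := A n + A n) (by
    rintro _ ⟨a, ha, b, hb, rfl⟩
    simpa using norm_add_le_of_le (hAR n a ha) (hAR n b hb))
  have hmul := fun n => covBy_sCov hC hn (hδ0 n)
    (add_nonneg (hR0 n) (mul_nonneg (hR0 n) (hR0 n))) (S := A n + A n * A n) (by
    rintro _ ⟨a, ha, _, ⟨b, hb, c, hc, rfl⟩, rfl⟩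
    simpa using norm_add_le_of_le (hAR n a ha) ((norm_mul_le b c).trans
      (mul_le_mul (hAR n b hb) (hAR n c hc) (norm_nonneg _) (hR0 n))))
  refine Setup.false (δ := fun n => C * δ n) (A := A) (N := fun n => SCov nm (δ n) (A n))
    ⟨fun n => ?_, fun n => ⟨hAc n, fun K hK => sCov_le hC hn hK⟩, fun η hη => ?_, fun η hη => ?_,
      fun η hη => ?_, fun η hη => ?_, fun η hη => ?_, fun η hη => ?_⟩ hκ hσ
  · rw [Set.nonempty_iff_ne_empty]
    intro h0
    have h1 := hA2 n (δ n) le_rfl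
    have h2 : (SCov nm (δ n) (A n) : ℝ) ≤ 0 :=
      sCov_le hC hn ⟨∅, by simp, by simp [h0]⟩
    exact absurd (h1.trans h2) (not_le.2 (mul_pos (Real.rpow_pos_of_pos (hδ0 n) _)
      (Real.rpow_pos_of_pos (hδ0 n) _)))
  · filter_upwards [hpow C η hη] with n h a ha using (hAR n a ha).trans h
  · filter_upwards [hpow' η hη] with n h ρ hρ K hK
    have hρ0 : 0 < ρ := (hscale.pos n).trans_le hρ
    have h1 := hA2 n (ρ / C) ((le_div_iff₀' hC0).2 hρ)
    have h2 : (SCov nm (ρ / C) (A n) : ℝ) ≤ K :=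
      sCov_le hC hn (by rwa [mul_div_cancel₀ _ hC0.ne'])
    refine le_trans (mul_le_mul h ?_ (Real.rpow_nonneg hρ0.le _)
      (Real.rpow_nonneg (hδ0 n).le _)) (h1.trans h2)
    exact Real.rpow_le_rpow_of_nonpos (by positivity) (div_le_self hρ0.le hC) (by linarith)
  · filter_upwards [hpow (C ^ σ) η hη] with n h
    refine (hA3 n).trans ?_
    have hpos := hscale.pos n
    calc δ n ^ (-(σ + e n)) = (C * δ n) ^ (-σ) * (C ^ σ * δ n ^ (-e n)) := by
          rw [Real.mul_rpow hC0.le (hδ0 n).le, neg_add, Real.rpow_add (hδ0 n),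
            Real.rpow_neg hC0.le]
          have := (Real.rpow_pos_of_pos hC0 σ).ne'
          field_simp
      _ ≤ (C * δ n) ^ (-σ) * (C * δ n) ^ (-η) := by
          gcongr
      _ = _ := by rw [← Real.rpow_add hpos]; congr 1; ring
  · filter_upwards [hpow' η hη] with n h W hW
    obtain ⟨a, ha, hd⟩ := hA4 n W hW
    refine ⟨a, ha, fun w hw => h.trans (hd.trans ((sDist_le nm a hw).trans ?_))⟩
    rw [hn]
    exact le_mul_of_one_le_left (apply_nonneg nm _) hC
  · filter_upwards [hpow 1 η hη] with n h
    rw [one_mul] at h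
    refine (hadd n).mono ?_ subset_rfl subset_rfl
    refine le_trans ?_ (mul_le_mul_of_nonneg_right h (Nat.cast_nonneg _))
    exact (le_add_of_nonneg_right (Nat.cast_nonneg _)).trans (hA5 n).le
  · filter_upwards [hpow 1 η hη] with n h
    rw [one_mul] at h
    refine (hmul n).mono ?_ subset_rfl subset_rfl
    refine le_trans ?_ (mul_le_mul_of_nonneg_right h (Nat.cast_nonneg _))
    exact (le_add_of_nonneg_left (Nat.cast_nonneg _)).trans (hA5 n).le

end

/-- Multiplication in a finite-dimensional algebra is bounded with respect to every norm. -/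
lemma exists_seminorm_mul_le {E : Type*} [Ring E] [Algebra ℝ E] [FiniteDimensional ℝ E]
    (nm : Seminorm ℝ E) (hnm : ∀ x : E, nm x = 0 → x = 0) :
    ∃ C : ℝ, 1 ≤ C ∧ ∀ x y, nm (x * y) ≤ C * nm x * nm y := by
  let _ : NormedAddCommGroup E := AddGroupNorm.toNormedAddCommGroup
    { nm.toAddGroupSeminorm with eq_zero_of_map_eq_zero' := hnm }
  let _ : NormedSpace ℝ E := { norm_smul_le := fun a b => (map_smul_eq_mul nm a b).le }
  let f : E →L[ℝ] E →L[ℝ] E := LinearMap.toContinuousLinearMap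
    ((LinearMap.toContinuousLinearMap : (E →ₗ[ℝ] E) ≃ₗ[ℝ] E →L[ℝ] E).toLinearMap.comp
      (LinearMap.mul ℝ E))
  refine ⟨max 1 ‖f‖, le_max_left _ _, fun x y => ?_⟩
  have h : nm (x * y) ≤ ‖f‖ * nm x * nm y := f.le_opNorm₂ x y
  refine h.trans ?_
  have := apply_nonneg nm x
  have := apply_nonneg nm y
  gcongr
  exact le_max_right _ _

end SumProduct

/-- **Discretized sum–product theorem in simple algebras** (Theorem 1.2).
`E` is a finite-dimensional simple normed real algebra (the norm `nm` need not be
submultiplicative). -/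
theorem discretized_sum_product_in_simple_algebras
    {E : Type*} [Ring E] [Algebra ℝ E] [FiniteDimensional ℝ E] [IsSimpleRing E]
    (nm : Seminorm ℝ E) (hnm : ∀ x : E, nm x = 0 → x = 0)
    (κ : ℝ) (hκ : 0 < κ) (σ : ℝ) (hσ : σ < (Module.finrank ℝ E : ℝ)) :
    ∃ ε : ℝ, 0 < ε ∧ ∃ δ₀ : ℝ, 0 < δ₀ ∧ ∀ δ : ℝ, 0 < δ → δ < δ₀ →
      ∀ A : Set E,
        A ⊆ SBall nm 0 (δ ^ (-ε)) →
        (∀ ρ : ℝ, δ ≤ ρ → δ ^ ε * ρ ^ (-κ) ≤ (SCov nm ρ A : ℝ)) →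
        (SCov nm δ A : ℝ) ≤ δ ^ (-(σ + ε)) →
        AwayFromSubalgebras nm (δ ^ ε) A →
        δ ^ (-ε) * (SCov nm δ A : ℝ) ≤
          (SCov nm δ (A + A) : ℝ) + (SCov nm δ (A + A * A) : ℝ) := by
  obtain ⟨C, hC, hmul⟩ := SumProduct.exists_seminorm_mul_le nm hnm
  have hC0 : 0 < C := by linarith
  let _ : NormedAddCommGroup E := AddGroupNorm.toNormedAddCommGroup
    { toFun := fun x => C * nm x
      map_zero' := by simp
      add_le' := fun x y => by
        rw [← mul_add]
        exact mul_le_mul_of_nonneg_left (map_add_le_add nm x y) hC0.le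
      neg' := fun x => by simp
      eq_zero_of_map_eq_zero' := fun x hx => hnm x (by simpa [hC0.ne'] using hx) }
  have hn : ∀ x : E, ‖x‖ = C * nm x := fun _ => rfl
  let _ : NormedRing E :=
    { ‹NormedAddCommGroup E›, ‹Ring E› with
      norm_mul_le := fun a b => by
        rw [hn, hn, hn]
        calc C * nm (a * b) ≤ C * (C * nm a * nm b) :=
              mul_le_mul_of_nonneg_left (hmul a b) hC0.le
          _ = _ := by ring }
  let _ : NormedAlgebra ℝ E :=
    { ‹Algebra ℝ E› with
      norm_smul_le := fun r x => by
        rw [hn, hn, map_smul_eq_mul]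
        exact (mul_left_comm _ _ _).le }
  exact SumProduct.sum_product_of_norm_eq hC hn hκ hσ
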